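/- Fix g ≥ 1 and let Γ = ⟨a_1,…,a_g,b_1,…,b_g ∣ ∏_{i=1}^g a_i b_i a_i^{-1} b_i^{-1}⟩ be the presented group on 2g generators with the single surface relator (the fundamental group of the closed orientable surface of genus g); write ā_i, b̄_i for the images of the generators in Γ. Then Γ is weakly ucp stable conditional on vanishing of the winding number invariant: for every finite subset S ⊆ Γ and every ε > 0 there exist a finite subset T ⊆ Γ and δ > 0 such that for every n ≥ 1 and every ucp (T,δ)-representation φ : Γ → M_n(ℂ) satisfying (a) every matrix φ(ā_i) and φ(b̄_i) is invertible, (b) the matrix c(φ) := ∏_{i=1}^g φ(ā_i)φ(b̄_i)φ(ā_i)^{-1}φ(b̄_i)^{-1} satisfies ‖c(φ) − 1‖ < 1, and (c) there exists a continuous function h : [0,1] → ℂ with h(0) = h(1) and exp(h(t)) = det(t·1 + (1−t)·c(φ)) for all t ∈ [0,1] (i.e. the winding number of this loop of nonzero determinants is zero), there exist k ∈ ℕ, a unitary representation θ : Γ → M_k(ℂ), and a unitary representation π : Γ → M_{n+k}(ℂ) such that ‖(φ(s) ⊕ θ(s)) − π(s)‖ < ε for all s ∈ S. -/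

import Mathlib

open scoped Matrix.Norms.L2Operator ComplexOrder

noncomputable section

/-- The surface relator `∏_{i=1}^g [a_i, b_i]` in the free group on `2g` generators
(`Sum.inl i` is `a_i`, `Sum.inr i` is `b_i`). -/
def surfaceRelator (g : ℕ) : FreeGroup (Fin g ⊕ Fin g) :=
  (List.ofFn fun i : Fin g =>
    FreeGroup.of (Sum.inl i) * FreeGroup.of (Sum.inr i) *
      (FreeGroup.of (Sum.inl i))⁻¹ * (FreeGroup.of (Sum.inr i))⁻¹).prod

/-- The fundamental group of the closed orientable surface of genus `g`. -/
abbrev SurfaceGroup (g : ℕ) : Type :=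
  PresentedGroup ({surfaceRelator g} : Set (FreeGroup (Fin g ⊕ Fin g)))

/-- The image `ā_i` of the generator `a_i` in the surface group. -/
def aGen {g : ℕ} (i : Fin g) : SurfaceGroup g := PresentedGroup.of (Sum.inl i)

/-- The image `b̄_i` of the generator `b_i` in the surface group. -/
def bGen {g : ℕ} (i : Fin g) : SurfaceGroup g := PresentedGroup.of (Sum.inr i)

/-- A `(T,δ)`-representation of `Γ` on `M_n(ℂ)` (operator norm): a unital map into the closed
unit ball that is `δ`-multiplicative on `T`. -/
def IsQuasiRep {Γ : Type*} [Group Γ] (T : Set Γ) (δ : ℝ) {n : ℕ}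
    (φ : Γ → Matrix (Fin n) (Fin n) ℂ) : Prop :=
  φ 1 = 1 ∧ (∀ x, ‖φ x‖ ≤ 1) ∧ ∀ s ∈ T, ∀ t ∈ T, ‖φ s * φ t - φ (s * t)‖ < δ

/-- A map `φ : Γ → M_n(ℂ)` is unital completely positive if all matrices
`∑_{g,h∈F} conj (z g) * z h • φ (g⁻¹ h)` are positive semidefinite. -/
def IsUcpQuasiRep {Γ : Type*} [Group Γ] {n : ℕ} (φ : Γ → Matrix (Fin n) (Fin n) ℂ) : Prop :=
  ∀ (F : Finset Γ) (z : Γ → ℂ),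
    (∑ g ∈ F, ∑ h ∈ F, ((starRingEnd ℂ) (z g) * z h) • φ (g⁻¹ * h)).PosSemidef

/-- A unitary representation of `Γ` on `M_k(ℂ)`. -/
def IsUnitaryRep {Γ : Type*} [Group Γ] {k : ℕ} (θ : Γ → Matrix (Fin k) (Fin k) ℂ) : Prop :=
  θ 1 = 1 ∧ (∀ x y, θ (x * y) = θ x * θ y) ∧
    ∀ x, θ x ∈ unitary (Matrix (Fin k) (Fin k) ℂ)

/-- Block sum of square matrices. -/
def blockSum {n k : ℕ} (x : Matrix (Fin n) (Fin n) ℂ) (y : Matrix (Fin k) (Fin k) ℂ) :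
    Matrix (Fin (n + k)) (Fin (n + k)) ℂ :=
  Matrix.reindex finSumFinEquiv finSumFinEquiv (Matrix.fromBlocks x 0 0 y)

/-- The image `∏_{i=1}^g [φ(ā_i), φ(b̄_i)]` of the surface relator under a
quasi-representation `φ` (with matrix inverses). -/
def commProd {g n : ℕ} (φ : SurfaceGroup g → Matrix (Fin n) (Fin n) ℂ) :
    Matrix (Fin n) (Fin n) ℂ :=
  (List.ofFn fun i : Fin g =>
    φ (aGen i) * φ (bGen i) * (φ (aGen i))⁻¹ * (φ (bGen i))⁻¹).prod

section

set_option linter.unusedSectionVars false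

variable {ι κ μ ν : Type} [Fintype ι] [DecidableEq ι] [Fintype κ] [DecidableEq κ]
  [Fintype μ] [DecidableEq μ] [Fintype ν] [DecidableEq ν] {m : ℕ}

/-- The product of commutators `∏ [p i, q i]`. -/
def commList {G : Type*} [Monoid G] [Inv G] {m : ℕ} (p q : Fin m → G) : G :=
  (List.ofFn fun i => p i * q i * (p i)⁻¹ * (q i)⁻¹).prod

/-- The value of the surface relator on a tuple. -/
def relVal {G : Type*} [Monoid G] [Inv G] {m : ℕ} (f : Fin m ⊕ Fin m → G) : G :=
  commList (fun i => f (Sum.inl i)) (fun i => f (Sum.inr i))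

theorem commList_succ {G : Type*} [Monoid G] [Inv G] {m : ℕ} (p q : Fin (m + 1) → G) :
    commList p q = p 0 * q 0 * (p 0)⁻¹ * (q 0)⁻¹ *
      commList (fun i => p i.succ) (fun i => q i.succ) := by
  simp [commList, List.ofFn_succ]

theorem map_commList {G H : Type*} [Group G] [Group H] (ψ : G →* H) {m : ℕ} (p q : Fin m → G) :
    ψ (commList p q) = commList (fun i => ψ (p i)) (fun i => ψ (q i)) := by
  simp only [commList, map_list_prod, List.map_ofFn]
  congr 2
  funext i
  simp

theorem map_relVal {G H : Type*} [Group G] [Group H] (ψ : G →* H) {m : ℕ}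
    (f : Fin m ⊕ Fin m → G) : ψ (relVal f) = relVal (fun x => ψ (f x)) :=
  map_commList _ _ _

theorem lift_surfaceRelator {G : Type*} [Group G] {m : ℕ} (f : Fin m ⊕ Fin m → G) :
    FreeGroup.lift f (surfaceRelator m) = relVal f := by
  have := map_relVal (FreeGroup.lift f) (m := m) FreeGroup.of
  simp only [FreeGroup.lift_apply_of] at this
  exact this

theorem commList_one {G : Type*} [Group G] {m : ℕ} :
    commList (fun _ : Fin m => (1 : G)) (fun _ => 1) = 1 := by
  induction m with
  | zero => simp [commList]
  | succ n ih => rw [commList_succ, ih]; simp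

theorem commList_rev {G : Type*} [Group G] {m : ℕ} (p q : Fin m → G) :
    commList (fun i => q i.rev) (fun i => p i.rev) = (commList p q)⁻¹ := by
  have h : (List.ofFn fun i : Fin m => q i.rev * p i.rev * (q i.rev)⁻¹ * (p i.rev)⁻¹) =
      (List.map (·⁻¹) (List.ofFn fun i => p i * q i * (p i)⁻¹ * (q i)⁻¹)).reverse := by
    apply List.ext_getElem
    · simp
    · intro k h1 h2
      simp only [List.length_ofFn] at h1
      simp only [List.getElem_ofFn, List.getElem_reverse, List.getElem_map, List.length_map,
        List.length_ofFn]
      have : (⟨m - 1 - k, by omega⟩ : Fin m) = (⟨k, h1⟩ : Fin m).rev := by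
        ext; simp [Fin.rev]; omega
      rw [this]
      group
  unfold commList
  rw [h, ← List.prod_inv_reverse]

/-- A tuple on `m + 1` handles, given by the first handle and the remaining ones. -/
def handles {G : Type*} {m : ℕ} (t z : G) (a b : Fin m → G) : Fin (m + 1) ⊕ Fin (m + 1) → G :=
  Sum.elim (Fin.cons t a) (Fin.cons z b)

theorem exists_handles {G : Type*} {m : ℕ} (f : Fin (m + 1) ⊕ Fin (m + 1) → G) :
    ∃ t z a b, f = handles t z a b := by
  refine ⟨f (.inl 0), f (.inr 0), fun i => f (.inl i.succ), fun i => f (.inr i.succ), ?_⟩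
  funext x
  rcases x with x | x <;> refine Fin.cases ?_ (fun i => ?_) x <;> simp [handles]

theorem relVal_handles {G : Type*} [Group G] {m : ℕ} (t z : G) (a b : Fin m → G) :
    relVal (handles t z a b) = t * z * t⁻¹ * z⁻¹ * commList a b := by
  simp [relVal, commList_succ, handles]

theorem forall_handles {G H : Type*} {m : ℕ} {r : G → H → Prop} {t z : G} {a b : Fin m → G}
    {t' z' : H} {a' b' : Fin m → H} :
    (∀ x, r (handles t z a b x) (handles t' z' a' b' x)) ↔
      r t t' ∧ r z z' ∧ (∀ i, r (a i) (a' i)) ∧ ∀ i, r (b i) (b' i) := by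
  simp only [Sum.forall, handles, Sum.elim_inl, Sum.elim_inr]
  simp only [Fin.forall_fin_succ, Fin.cons_zero, Fin.cons_succ]
  tauto

theorem l2_opNorm_le_one_of_conjTranspose_mul_self {W : Matrix κ ι ℂ}
    (h : W.conjTranspose * W = 1) : ‖W‖ ≤ 1 := by
  have h1 := Matrix.l2_opNorm_conjTranspose_mul_self W
  rw [h, ← Matrix.diagonal_one, Matrix.l2_opNorm_diagonal] at h1
  have h2 : ‖(fun _ : ι => (1 : ℂ))‖ ≤ 1 := by
    rw [pi_norm_le_iff_of_nonneg zero_le_one]; simp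
  nlinarith [norm_nonneg W]

theorem norm_coe_unitary_le (u : Matrix.unitaryGroup ι ℂ) : ‖(u : Matrix ι ι ℂ)‖ ≤ 1 :=
  l2_opNorm_le_one_of_conjTranspose_mul_self (Unitary.coe_star_mul_self u)

theorem norm_matrix_one_le : ‖(1 : Matrix ι ι ℂ)‖ ≤ 1 := norm_coe_unitary_le 1

theorem norm_mul_unitary (A : Matrix ι ι ℂ) (u : Matrix.unitaryGroup ι ℂ) :
    ‖A * (u : Matrix ι ι ℂ)‖ = ‖A‖ := CStarRing.norm_mul_coe_unitary A u

theorem norm_unitary_mul (A : Matrix ι ι ℂ) (u : Matrix.unitaryGroup ι ℂ) :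
    ‖(u : Matrix ι ι ℂ) * A‖ = ‖A‖ := CStarRing.norm_coe_unitary_mul u A

/-- Block sum of two square matrices as a star homomorphism. -/
def dsumHom (ι κ : Type) [Fintype ι] [DecidableEq ι] [Fintype κ] [DecidableEq κ] :
    (Matrix ι ι ℂ × Matrix κ κ ℂ) →⋆ₐ[ℂ] Matrix (ι ⊕ κ) (ι ⊕ κ) ℂ where
  toFun p := Matrix.fromBlocks p.1 0 0 p.2
  map_one' := by simp
  map_mul' p q := by simp [Matrix.fromBlocks_multiply]
  map_zero' := by simp
  map_add' p q := by simp [Matrix.fromBlocks_add]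
  commutes' r := by
    ext i j
    rcases i with i | i <;> rcases j with j | j <;>
      simp [Matrix.algebraMap_matrix_apply]
  map_star' p := by simp [Matrix.star_eq_conjTranspose, Matrix.fromBlocks_conjTranspose]

/-- Block sum of two square matrices. -/
abbrev dsum (A : Matrix ι ι ℂ) (B : Matrix κ κ ℂ) : Matrix (ι ⊕ κ) (ι ⊕ κ) ℂ :=
  Matrix.fromBlocks A 0 0 B

theorem norm_dsum_le {A : Matrix ι ι ℂ} {B : Matrix κ κ ℂ} {ε : ℝ} (hA : ‖A‖ ≤ ε) (hB : ‖B‖ ≤ ε) :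
    ‖dsum A B‖ ≤ ε :=
  (NonUnitalStarAlgHom.norm_apply_le (dsumHom ι κ) (A, B)).trans (max_le hA hB)

theorem dsum_sub (A A' : Matrix ι ι ℂ) (B B' : Matrix κ κ ℂ) :
    dsum A B - dsum A' B' = dsum (A - A') (B - B') := by
  simp [dsum, sub_eq_add_neg, Matrix.fromBlocks_neg, Matrix.fromBlocks_add]

theorem norm_dsum_sub_le {A A' : Matrix ι ι ℂ} {B B' : Matrix κ κ ℂ} {ε : ℝ} (hA : ‖A - A'‖ ≤ ε)
    (hB : ‖B - B'‖ ≤ ε) : ‖dsum A B - dsum A' B'‖ ≤ ε := by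
  rw [dsum_sub]; exact norm_dsum_le hA hB

/-- Block sum of two unitary matrices. -/
def dsumU : Matrix.unitaryGroup ι ℂ × Matrix.unitaryGroup κ ℂ →* Matrix.unitaryGroup (ι ⊕ κ) ℂ where
  toFun p := ⟨dsum p.1 p.2, by
    have h1 := Unitary.coe_star_mul_self p.1
    have h2 := Unitary.coe_star_mul_self p.2
    rw [Matrix.star_eq_conjTranspose] at h1 h2
    rw [Matrix.mem_unitaryGroup_iff']
    simp [Matrix.star_eq_conjTranspose, Matrix.fromBlocks_conjTranspose,
      Matrix.fromBlocks_multiply, h1, h2]⟩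
  map_one' := by ext1; simp [dsum]
  map_mul' p q := by ext1; simp [dsum, Matrix.fromBlocks_multiply]

@[simp] theorem coe_dsumU (p : Matrix.unitaryGroup ι ℂ × Matrix.unitaryGroup κ ℂ) :
    (dsumU p : Matrix (ι ⊕ κ) (ι ⊕ κ) ℂ) = dsum p.1 p.2 := rfl

theorem relVal_prod {G H : Type*} [Group G] [Group H] {m : ℕ} (f : Fin m ⊕ Fin m → G)
    (f' : Fin m ⊕ Fin m → H) : relVal (fun x => (f x, f' x)) = (relVal f, relVal f') := by
  ext
  · exact map_relVal (MonoidHom.fst G H) _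
  · exact map_relVal (MonoidHom.snd G H) _

theorem relVal_dsumU {m : ℕ} (f : Fin m ⊕ Fin m → Matrix.unitaryGroup ι ℂ)
    (f' : Fin m ⊕ Fin m → Matrix.unitaryGroup κ ℂ) :
    relVal (fun x => dsumU (f x, f' x)) = dsumU (relVal f, relVal f') := by
  rw [← relVal_prod, map_relVal]

/-- A unitary matrix between two index types. -/
structure UnitaryIso (ι κ : Type) [Fintype ι] [DecidableEq ι] [Fintype κ] [DecidableEq κ] where
  /-- the underlying matrix -/
  mat : Matrix κ ι ℂ
  left : mat.conjTranspose * mat = 1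
  right : mat * mat.conjTranspose = 1

namespace UnitaryIso

/-- Conjugation of a matrix. -/
def conj (W : UnitaryIso ι κ) (A : Matrix ι ι ℂ) : Matrix κ κ ℂ := W.mat * A * W.mat.conjTranspose

theorem conj_mul (W : UnitaryIso ι κ) (A B : Matrix ι ι ℂ) :
    W.conj (A * B) = W.conj A * W.conj B := by
  have : W.conj A * W.conj B
      = W.mat * A * (W.mat.conjTranspose * W.mat) * B * W.mat.conjTranspose := by
    simp only [conj, Matrix.mul_assoc]
  rw [this, W.left]
  simp [conj, Matrix.mul_assoc]

theorem conj_one (W : UnitaryIso ι κ) : W.conj 1 = 1 := by simp [conj, W.right]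

theorem conj_sub (W : UnitaryIso ι κ) (A B : Matrix ι ι ℂ) :
    W.conj (A - B) = W.conj A - W.conj B := by
  simp [conj, Matrix.mul_sub, Matrix.sub_mul]

theorem conj_star (W : UnitaryIso ι κ) (A : Matrix ι ι ℂ) : W.conj (star A) = star (W.conj A) := by
  simp [conj, Matrix.star_eq_conjTranspose, Matrix.conjTranspose_mul, Matrix.mul_assoc]

theorem norm_conj_le (W : UnitaryIso ι κ) (A : Matrix ι ι ℂ) : ‖W.conj A‖ ≤ ‖A‖ := by
  have h1 := l2_opNorm_le_one_of_conjTranspose_mul_self W.left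
  have h2 : ‖W.mat.conjTranspose‖ ≤ 1 := by rwa [Matrix.l2_opNorm_conjTranspose]
  calc ‖W.conj A‖ ≤ ‖W.mat * A‖ * ‖W.mat.conjTranspose‖ := Matrix.l2_opNorm_mul _ _
    _ ≤ ‖W.mat * A‖ * 1 := by gcongr
    _ ≤ ‖W.mat‖ * ‖A‖ * 1 := by gcongr; exact Matrix.l2_opNorm_mul _ _
    _ ≤ 1 * ‖A‖ * 1 := by gcongr
    _ = ‖A‖ := by ring

theorem norm_conj_sub_le (W : UnitaryIso ι κ) {A B : Matrix ι ι ℂ} {ε : ℝ} (h : ‖A - B‖ ≤ ε) :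
    ‖W.conj A - W.conj B‖ ≤ ε := by
  rw [← conj_sub]; exact (W.norm_conj_le _).trans h

theorem det_conj (W : UnitaryIso ι κ) (A : Matrix ι ι ℂ) : (W.conj A).det = A.det :=
  Matrix.det_conj_of_mul_eq_one W.right W.left

/-- Conjugation as a homomorphism of unitary groups. -/
def conjU (W : UnitaryIso ι κ) : Matrix.unitaryGroup ι ℂ →* Matrix.unitaryGroup κ ℂ where
  toFun u := ⟨W.conj u, by
    rw [Matrix.mem_unitaryGroup_iff', ← conj_star, ← conj_mul, Unitary.coe_star_mul_self, conj_one]⟩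
  map_one' := by ext1; simp [conj_one]
  map_mul' u v := by ext1; simp [conj_mul]

@[simp] theorem coe_conjU (W : UnitaryIso ι κ) (u : Matrix.unitaryGroup ι ℂ) :
    (W.conjU u : Matrix κ κ ℂ) = W.conj u := rfl

/-- The inverse unitary. -/
def symm (W : UnitaryIso ι κ) : UnitaryIso κ ι where
  mat := W.mat.conjTranspose
  left := by simpa using W.right
  right := by simpa using W.left

theorem symm_conj_conj (W : UnitaryIso ι κ) (A : Matrix ι ι ℂ) : W.symm.conj (W.conj A) = A := by
  have : W.symm.conj (W.conj A) = (W.mat.conjTranspose * W.mat) * A *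
      (W.mat.conjTranspose * W.mat) := by
    simp [conj, symm, Matrix.mul_assoc]
  simp [this, W.left]

/-- Composition. -/
def trans (W : UnitaryIso ι κ) (V : UnitaryIso κ μ) : UnitaryIso ι μ where
  mat := V.mat * W.mat
  left := by
    rw [Matrix.conjTranspose_mul, Matrix.mul_assoc, ← Matrix.mul_assoc V.mat.conjTranspose, V.left,
      Matrix.one_mul, W.left]
  right := by
    rw [Matrix.conjTranspose_mul, Matrix.mul_assoc, ← Matrix.mul_assoc W.mat, W.right,
      Matrix.one_mul, V.right]

theorem trans_conj (W : UnitaryIso ι κ) (V : UnitaryIso κ μ) (A : Matrix ι ι ℂ) :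
    (W.trans V).conj A = V.conj (W.conj A) := by
  simp [conj, trans, Matrix.mul_assoc]

/-- A unitary matrix. -/
def ofUnitary (u : Matrix.unitaryGroup ι ℂ) : UnitaryIso ι ι where
  mat := u
  left := Unitary.coe_star_mul_self u
  right := Unitary.coe_mul_star_self u

/-- Reindexing. -/
def ofEquiv (e : ι ≃ κ) : UnitaryIso ι κ where
  mat := (1 : Matrix κ κ ℂ).submatrix id e
  left := by
    rw [Matrix.conjTranspose_submatrix, ← Matrix.submatrix_mul _ _ _ _ _ Function.bijective_id]
    simp
  right := by
    rw [Matrix.conjTranspose_submatrix, ← Matrix.submatrix_mul _ _ _ _ _ e.bijective]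
    simp

theorem ofEquiv_conj (e : ι ≃ κ) (A : Matrix ι ι ℂ) :
    (ofEquiv e).conj A = A.submatrix e.symm e.symm := by
  ext i j
  simp [conj, ofEquiv, Matrix.mul_apply, Matrix.one_apply, ← Equiv.symm_apply_eq]
  simp [← Equiv.eq_symm_apply]

/-- Block sum. -/
def dsum (W : UnitaryIso ι κ) (V : UnitaryIso μ ν) : UnitaryIso (ι ⊕ μ) (κ ⊕ ν) where
  mat := Matrix.fromBlocks W.mat 0 0 V.mat
  left := by
    simp [Matrix.fromBlocks_conjTranspose, Matrix.fromBlocks_multiply, W.left, V.left]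
  right := by
    simp [Matrix.fromBlocks_conjTranspose, Matrix.fromBlocks_multiply, W.right, V.right]

theorem dsum_conj (W : UnitaryIso ι κ) (V : UnitaryIso μ ν) (A : Matrix ι ι ℂ)
    (B : Matrix μ μ ℂ) : (W.dsum V).conj (_root_.dsum A B) = _root_.dsum (W.conj A) (V.conj B) := by
  simp [conj, dsum, _root_.dsum, Matrix.fromBlocks_conjTranspose, Matrix.fromBlocks_multiply]

theorem relVal_conjU (W : UnitaryIso ι κ) {m : ℕ} (f : Fin m ⊕ Fin m → Matrix.unitaryGroup ι ℂ) :
    relVal (fun x => W.conjU (f x)) = W.conjU (relVal f) := (map_relVal _ _).symm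

end UnitaryIso

/-- `(ι ⊕ κ) ⊕ (ι ⊕ μ)` with the two copies of `ι` separated. -/
def splitEquiv (ι κ μ : Type) : (ι ⊕ κ) ⊕ (ι ⊕ μ) ≃ ι ⊕ ((ι ⊕ κ) ⊕ μ) where
  toFun := Sum.elim (Sum.elim .inl fun k => .inr (.inl (.inr k)))
    (Sum.elim (fun i => .inr (.inl (.inl i))) fun l => .inr (.inr l))
  invFun := Sum.elim (fun i => .inl (.inl i))
    (Sum.elim (Sum.elim (fun i => .inr (.inl i)) fun k => .inl (.inr k)) fun l => .inr (.inr l))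
  left_inv := by rintro ((i | i) | (i | i)) <;> rfl
  right_inv := by rintro (i | (i | i) | i) <;> rfl

theorem splitEquiv_conj (A B : Matrix ι ι ℂ) (D : Matrix κ κ ℂ) (Q : Matrix μ μ ℂ) :
    (UnitaryIso.ofEquiv (splitEquiv ι κ μ)).conj (dsum (dsum A D) (dsum B Q)) =
      dsum A (dsum (dsum B D) Q) := by
  rw [UnitaryIso.ofEquiv_conj]
  ext i j
  rcases i with i | (i | i) | i <;> rcases j with j | (j | j) | j <;> simp [splitEquiv]

theorem splitEquiv_symm_conj (A B : Matrix ι ι ℂ) (D : Matrix κ κ ℂ) (Q : Matrix μ μ ℂ) :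
    (UnitaryIso.ofEquiv (splitEquiv ι κ μ).symm).conj (dsum A (dsum (dsum B D) Q)) =
      dsum (dsum A D) (dsum B Q) := by
  rw [UnitaryIso.ofEquiv_conj]
  ext i j
  rcases i with (i | i) | (i | i) <;> rcases j with (j | j) | (j | j) <;> simp [splitEquiv]

/-- Exchange of the first two summands of `μ ⊕ (ι ⊕ κ)`. -/
def leftCommEquiv (μ ι κ : Type) : μ ⊕ (ι ⊕ κ) ≃ ι ⊕ (μ ⊕ κ) where
  toFun := Sum.elim (fun i => .inr (.inl i)) (Sum.elim .inl fun k => .inr (.inr k))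
  invFun := Sum.elim (fun i => .inr (.inl i)) (Sum.elim .inl fun k => .inr (.inr k))
  left_inv := by rintro (i | i | i) <;> rfl
  right_inv := by rintro (i | i | i) <;> rfl

theorem leftCommEquiv_conj (P : Matrix μ μ ℂ) (A : Matrix ι ι ℂ) (Q : Matrix κ κ ℂ) :
    (UnitaryIso.ofEquiv (leftCommEquiv μ ι κ)).conj (dsum P (dsum A Q)) = dsum A (dsum P Q) := by
  rw [UnitaryIso.ofEquiv_conj]
  ext i j
  rcases i with i | i | i <;> rcases j with j | j | j <;> simp [leftCommEquiv]

theorem sumAssoc_conj (P : Matrix μ μ ℂ) (A : Matrix ι ι ℂ) (Q : Matrix κ κ ℂ) :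
    (UnitaryIso.ofEquiv (Equiv.sumAssoc μ ι κ)).conj (dsum (dsum P A) Q) = dsum P (dsum A Q) := by
  rw [UnitaryIso.ofEquiv_conj]
  ext i j
  rcases i with i | i | i <;> rcases j with j | j | j <;> simp

/-- A tuple of matrices becomes, up to `ε`, a tuple of unitaries satisfying the surface relation
after adding a tuple of unitaries satisfying the surface relation. -/
def Stab (ε : ℝ) (f : Fin m ⊕ Fin m → Matrix ι ι ℂ) : Prop :=
  ∃ (κ : Type) (_ : Fintype κ) (_ : DecidableEq κ)
    (θ : Fin m ⊕ Fin m → Matrix.unitaryGroup κ ℂ)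
    (π : Fin m ⊕ Fin m → Matrix.unitaryGroup (ι ⊕ κ) ℂ),
    relVal θ = 1 ∧ relVal π = 1 ∧ ∀ x, ‖dsum (f x) (θ x).1 - (π x).1‖ ≤ ε

theorem Stab.of_near {ε ε' : ℝ} {f f' : Fin m ⊕ Fin m → Matrix ι ι ℂ} (h : Stab ε f)
    (hε : 0 ≤ ε') (hf : ∀ x, ‖f' x - f x‖ ≤ ε') : Stab (ε' + ε) f' := by
  obtain ⟨κ, _, _, θ, π, h1, h2, h3⟩ := h
  refine ⟨κ, _, _, θ, π, h1, h2, fun x => ?_⟩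
  refine (norm_sub_le_norm_sub_add_norm_sub _ (dsum (f x) (θ x).1) _).trans
    (add_le_add (norm_dsum_sub_le (hf x) ?_) (h3 x))
  simpa using hε

theorem Stab.conj {ε : ℝ} {f : Fin m ⊕ Fin m → Matrix ι ι ℂ} (h : Stab ε f)
    (W : UnitaryIso ι κ) : Stab ε (fun x => W.conj (f x)) := by
  obtain ⟨μ, _, _, θ, π, h1, h2, h3⟩ := h
  let V := W.dsum (UnitaryIso.ofUnitary (1 : Matrix.unitaryGroup μ ℂ))
  refine ⟨μ, _, _, θ, fun x => V.conjU (π x), h1, ?_, fun x => ?_⟩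
  · rw [UnitaryIso.relVal_conjU, h2, map_one]
  · have := V.norm_conj_sub_le (h3 x)
    rw [UnitaryIso.dsum_conj] at this
    simpa [UnitaryIso.conj, UnitaryIso.ofUnitary] using this

theorem Stab.of_dsum {ε : ℝ} {f : Fin m ⊕ Fin m → Matrix ι ι ℂ}
    {θ : Fin m ⊕ Fin m → Matrix.unitaryGroup κ ℂ} (hθ : relVal θ = 1)
    (h : Stab ε (fun x => dsum (f x) (θ x).1)) : Stab ε f := by
  obtain ⟨μ, _, _, θ', π, h1, h2, h3⟩ := h
  let V := UnitaryIso.ofEquiv (Equiv.sumAssoc ι κ μ)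
  refine ⟨κ ⊕ μ, inferInstance, inferInstance, fun x => dsumU (θ x, θ' x), fun x => V.conjU (π x),
    ?_, ?_, fun x => ?_⟩
  · rw [relVal_dsumU, hθ, h1]; exact map_one dsumU
  · rw [UnitaryIso.relVal_conjU, h2, map_one]
  · have := V.norm_conj_sub_le (h3 x)
    rw [sumAssoc_conj] at this
    exact this

/-- A variant of `Stab` where the added summand only has to be close to a tuple satisfying the
surface relation. -/
def StabQ (ε ε' : ℝ) (f : Fin m ⊕ Fin m → Matrix ι ι ℂ) : Prop :=
  ∃ (κ : Type) (_ : Fintype κ) (_ : DecidableEq κ)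
    (θ : Fin m ⊕ Fin m → Matrix.unitaryGroup κ ℂ)
    (Q : Fin m ⊕ Fin m → Matrix κ κ ℂ)
    (π : Fin m ⊕ Fin m → Matrix.unitaryGroup (ι ⊕ κ) ℂ),
    relVal θ = 1 ∧ relVal π = 1 ∧ (∀ x, ‖(θ x).1 - Q x‖ ≤ ε) ∧
      ∀ x, ‖dsum (f x) (Q x) - (π x).1‖ ≤ ε'

theorem StabQ.stab {ε ε' : ℝ} {f : Fin m ⊕ Fin m → Matrix ι ι ℂ} (hε : 0 ≤ ε)
    (h : StabQ ε ε' f) : Stab (ε + ε') f := by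
  obtain ⟨κ, _, _, θ, Q, π, h1, h2, h3, h4⟩ := h
  refine ⟨κ, _, _, θ, π, h1, h2, fun x => ?_⟩
  refine (norm_sub_le_norm_sub_add_norm_sub _ (dsum (f x) (Q x)) _).trans
    (add_le_add (norm_dsum_sub_le ?_ (h3 x)) (h4 x))
  simpa using hε

theorem StabQ.of_relVal_eq_one {ε ε' : ℝ} (hε : 0 ≤ ε) (hnonneg : 0 ≤ ε')
    {f : Fin m ⊕ Fin m → Matrix.unitaryGroup ι ℂ} (h : relVal f = 1) :
    StabQ ε ε' (fun x => (f x : Matrix ι ι ℂ)) := by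
  refine ⟨Empty, inferInstance, inferInstance, fun _ => 1, fun _ => 1, fun x => dsumU (f x, 1),
    commList_one, ?_, fun x => ?_, fun x => ?_⟩
  · rw [relVal_dsumU, h]
    have : relVal (fun _ : Fin m ⊕ Fin m => (1 : Matrix.unitaryGroup Empty ℂ)) = 1 := commList_one
    rw [this]; exact map_one dsumU
  · simpa using hε
  · simpa using hnonneg

/-- A tuple of unitaries is up to `ε` a corner of a tuple satisfying the surface relation. -/
def Complemented (ε : ℝ) (f : Fin m ⊕ Fin m → Matrix ι ι ℂ) : Prop :=
  ∃ (κ : Type) (_ : Fintype κ) (_ : DecidableEq κ)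
    (G : Fin m ⊕ Fin m → Matrix.unitaryGroup (ι ⊕ κ) ℂ)
    (D : Fin m ⊕ Fin m → Matrix κ κ ℂ),
    relVal G = 1 ∧ ∀ x, ‖dsum (f x) (D x) - (G x).1‖ ≤ ε

theorem StabQ.step {ε : ℝ} {f₀ f₁ : Fin m ⊕ Fin m → Matrix ι ι ℂ} (hε : 0 ≤ ε)
    (h : StabQ ε (2 * ε) f₁) (hc : Complemented ε f₁) (hf : ∀ x, ‖f₀ x - f₁ x‖ ≤ ε) :
    StabQ ε (2 * ε) f₀ := by
  obtain ⟨μ, _, _, θ, Q, π, h1, h2, h3, h4⟩ := h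
  obtain ⟨κ, _, _, G, D, h5, h6⟩ := hc
  let V := UnitaryIso.ofEquiv (splitEquiv ι κ μ)
  refine ⟨(ι ⊕ κ) ⊕ μ, inferInstance, inferInstance, fun x => dsumU (G x, θ x),
    fun x => dsum (dsum (f₁ x) (D x)) (Q x), fun x => V.conjU (dsumU (G x, π x)), ?_, ?_,
    fun x => ?_, fun x => ?_⟩
  · rw [relVal_dsumU, h1, h5]; exact map_one dsumU
  · rw [UnitaryIso.relVal_conjU, relVal_dsumU, h2, h5]
    exact (congrArg _ (map_one dsumU)).trans (map_one _)
  · refine norm_dsum_sub_le ?_ (h3 x)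
    rw [norm_sub_rev]; exact h6 x
  · have h7 : ‖dsum (f₀ x) (D x) - (G x).1‖ ≤ 2 * ε := by
      rw [two_mul]
      refine (norm_sub_le_norm_sub_add_norm_sub _ (dsum (f₁ x) (D x)) _).trans
        (add_le_add (norm_dsum_sub_le (hf x) ?_) (h6 x))
      simpa using hε
    have := V.norm_conj_sub_le (norm_dsum_sub_le h7 (h4 x))
    rw [splitEquiv_conj] at this
    exact this

theorem continuousOn_spectrum (A : Matrix ι ι ℂ) (f : ℂ → ℂ) : ContinuousOn f (spectrum ℂ A) :=
  A.finite_spectrum.continuousOn f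

theorem Commute.star_unitary_left {u : Matrix.unitaryGroup ι ℂ} {B : Matrix ι ι ℂ}
    (h : Commute (u : Matrix ι ι ℂ) B) : Commute (star (u : Matrix ι ι ℂ)) B := by
  have h1 := Unitary.coe_star_mul_self u
  have h2 : u.1 * star u.1 = 1 := Unitary.coe_mul_star_self u
  calc star (u : Matrix ι ι ℂ) * B = star (u : Matrix ι ι ℂ) * (B * u) * star (u : Matrix ι ι ℂ) :=
      by
        rw [Matrix.mul_assoc, Matrix.mul_assoc B, h2, Matrix.mul_one]
    _ = B * star (u : Matrix ι ι ℂ) := by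
        rw [← h.eq, ← Matrix.mul_assoc, h1, Matrix.one_mul]

/-- Every unitary matrix is joined to the identity by a chain of small steps, of a length
that does not depend on the matrix or its size. -/
theorem exists_unitary_chain {η : ℝ} (hη : 0 < η) : ∃ n : ℕ, ∀ (ι : Type) [Fintype ι]
    [DecidableEq ι] (v : Matrix.unitaryGroup ι ℂ), ∃ γ : ℕ → Matrix.unitaryGroup ι ℂ,
      γ 0 = 1 ∧ γ n = v ∧ (∀ j, ‖(γ (j + 1)).1 - (γ j).1‖ ≤ η) ∧
      ∀ j (B : Matrix ι ι ℂ), Commute v.1 B → Commute (γ j).1 B := by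
  obtain ⟨n, hn⟩ := exists_nat_gt (Real.pi / η)
  have hn0 : (0 : ℝ) < n := (div_pos Real.pi_pos hη).trans hn
  refine ⟨n, fun ι _ _ v => ?_⟩
  have hmem : ∀ z ∈ spectrum ℂ v.1, ‖z‖ = 1 := fun z hz => by
    simpa using spectrum.subset_circle_of_unitary v.2 hz
  have hnormal : IsStarNormal v.1 := by
    constructor
    exact (Unitary.coe_star_mul_self v).trans (Unitary.coe_mul_star_self v).symm
  let F : ℕ → ℂ → ℂ := fun j z => Complex.exp (Complex.I * ((j / n * Complex.arg z : ℝ) : ℂ))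
  have hF : ∀ j, cfc (F j) v.1 ∈ unitary (Matrix ι ι ℂ) := fun j => by
    rw [cfc_unitary_iff (F j) v.1 hnormal (continuousOn_spectrum _ _)]
    intro z _
    simp only [F, RCLike.star_def, ← Complex.exp_conj, ← Complex.exp_add]
    simp
  refine ⟨fun j => ⟨cfc (F j) v.1, hF j⟩, ?_, ?_, fun j => ?_, fun j B hB => ?_⟩
  · ext1
    simp [F, cfc_const_one]
  · apply Subtype.ext
    show cfc (F n) v.1 = v.1
    conv_rhs => rw [← cfc_id ℂ v.1]
    refine cfc_congr fun z hz => ?_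
    simp only [F, div_self hn0.ne', one_mul, id]
    conv_rhs => rw [← Complex.norm_mul_exp_arg_mul_I z, hmem z hz]
    simp [mul_comm]
  · show ‖cfc (F (j + 1)) v.1 - cfc (F j) v.1‖ ≤ η
    rw [← cfc_sub (F (j + 1)) (F j) v.1 (continuousOn_spectrum _ _) (continuousOn_spectrum _ _)]
    refine norm_cfc_le hη.le fun z _ => ?_
    have h1 : F (j + 1) z - F j z = F j z *
        (Complex.exp (Complex.I * ((Complex.arg z / n : ℝ) : ℂ)) - 1) := by
      simp only [F, mul_sub, ← Complex.exp_add, mul_one]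
      congr 2
      push_cast
      ring
    have h2 : ‖F j z‖ = 1 := by
      simp only [F]
      rw [mul_comm, Complex.norm_exp_ofReal_mul_I]
    rw [h1, norm_mul, h2, one_mul]
    refine Real.norm_exp_I_mul_ofReal_sub_one_le.trans ?_
    rw [norm_div, Real.norm_eq_abs, Real.norm_eq_abs, abs_of_pos hn0, div_le_iff₀ hn0]
    have := Complex.abs_arg_le_pi z
    rw [div_lt_iff₀ hη] at hn
    linarith
  · exact hB.cfc hB.star_unitary_left (F j)

/-- The unitary matrix exchanging two equal summands. -/
def swapU (ι : Type) [Fintype ι] [DecidableEq ι] : Matrix.unitaryGroup (ι ⊕ ι) ℂ :=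
  ⟨Matrix.fromBlocks 0 1 1 0, by
    rw [Matrix.mem_unitaryGroup_iff']
    simp [Matrix.star_eq_conjTranspose, Matrix.fromBlocks_conjTranspose,
      Matrix.fromBlocks_multiply]⟩

theorem swapU_mul_dsumU (u v : Matrix.unitaryGroup ι ℂ) :
    swapU ι * dsumU (u, v) = dsumU (v, u) * swapU ι := by
  ext1
  simp [swapU, dsum, Matrix.fromBlocks_multiply]

/-- Away from the generator `inl 0`, a tuple becomes up to `ε` conjugate to
`1 ⊕ θ` after adding `θ`, where `θ` satisfies the surface relation. -/
def Ladder (ε : ℝ) (f : Fin (m + 1) ⊕ Fin (m + 1) → Matrix.unitaryGroup ι ℂ) : Prop :=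
  ∃ (κ : Type) (_ : Fintype κ) (_ : DecidableEq κ)
    (θ : Fin (m + 1) ⊕ Fin (m + 1) → Matrix.unitaryGroup κ ℂ) (W : UnitaryIso (ι ⊕ κ) (ι ⊕ κ)),
    relVal θ = 1 ∧ ∀ x, x ≠ Sum.inl 0 →
      ‖W.conj (dsum (f x).1 (θ x).1) - dsum 1 (θ x).1‖ ≤ ε

theorem Ladder.one {ε : ℝ} (hε : 0 ≤ ε) :
    Ladder ε (fun _ : Fin (m + 1) ⊕ Fin (m + 1) => (1 : Matrix.unitaryGroup ι ℂ)) := by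
  refine ⟨Empty, inferInstance, inferInstance, fun _ => 1, UnitaryIso.ofUnitary 1, commList_one,
    fun x _ => ?_⟩
  simpa [dsum, UnitaryIso.conj_one] using hε

/-- Any tuple on the generators other than `inl 0` is a summand of a tuple satisfying
the surface relation. -/
theorem exists_double (f : Fin (m + 1) ⊕ Fin (m + 1) → Matrix.unitaryGroup ι ℂ) :
    ∃ (f' : Fin (m + 1) ⊕ Fin (m + 1) → Matrix.unitaryGroup ι ℂ)
      (G : Fin (m + 1) ⊕ Fin (m + 1) → Matrix.unitaryGroup (ι ⊕ ι) ℂ), relVal G = 1 ∧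
      ∀ x, x ≠ Sum.inl 0 → G x = dsumU (f x, f' x) := by
  obtain ⟨t, z, a, b, rfl⟩ := exists_handles f
  refine ⟨handles 1 ((commList a b)⁻¹ * z) (fun i => b i.rev) (fun i => a i.rev),
    handles (swapU ι) (dsumU (z, (commList a b)⁻¹ * z)) (fun i => dsumU (a i, b i.rev))
      (fun i => dsumU (b i, a i.rev)), ?_, fun x hx => ?_⟩
  · have h1 : commList (fun i => dsumU (a i, b i.rev)) (fun i => dsumU (b i, a i.rev)) =
        dsumU (commList a b, (commList a b)⁻¹) := by
      have := relVal_dsumU (Sum.elim a b) (Sum.elim (fun i => b i.rev) (fun i => a i.rev))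
      simp only [relVal, Sum.elim_inl, Sum.elim_inr, commList_rev] at this
      exact this
    rw [relVal_handles, h1, swapU_mul_dsumU, mul_inv_cancel_right, ← map_inv, ← map_mul, ← map_mul]
    convert map_one dsumU using 2
    ext1 <;> simp
  · rcases x with x | x <;> revert hx <;>
      refine Fin.cases (fun hx => ?_) (fun i hx => ?_) x <;> simp [handles] at hx ⊢

theorem Ladder.step {ε : ℝ} {f₀ f₁ : Fin (m + 1) ⊕ Fin (m + 1) → Matrix.unitaryGroup ι ℂ}
    (h : Ladder ε f₁) (hf : ∀ x, ‖(f₀ x).1 - (f₁ x).1‖ ≤ ε) : Ladder ε f₀ := by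
  obtain ⟨κ, _, _, θ, W, h1, h2⟩ := h
  obtain ⟨f', G, hG, hG'⟩ := exists_double f₁
  have hε : 0 ≤ ε := (norm_nonneg _).trans (hf (.inl 0))
  let E₁ := UnitaryIso.ofEquiv (splitEquiv ι ι κ).symm
  let E₂ := (UnitaryIso.ofUnitary (1 : Matrix.unitaryGroup (ι ⊕ ι) ℂ)).dsum W
  let E₃ := UnitaryIso.ofEquiv (leftCommEquiv (ι ⊕ ι) ι κ)
  refine ⟨(ι ⊕ ι) ⊕ κ, inferInstance, inferInstance, fun x => dsumU (G x, θ x),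
    (E₁.trans E₂).trans E₃, ?_, fun x hx => ?_⟩
  · rw [relVal_dsumU, h1, hG]; exact map_one dsumU
  · have hE₂ : (UnitaryIso.ofUnitary (1 : Matrix.unitaryGroup (ι ⊕ ι) ℂ)).conj
        (dsum (f₀ x).1 (f' x).1) = dsum (f₀ x).1 (f' x).1 := by
      simp [UnitaryIso.conj, UnitaryIso.ofUnitary]
    have h3 : ‖dsum (f₀ x).1 (f' x).1 - dsum (f₁ x).1 (f' x).1‖ ≤ ε :=
      norm_dsum_sub_le (hf x) (by simpa using hε)
    have h4 : ((E₁.trans E₂).trans E₃).conj (dsum (f₀ x).1 (dsum (dsum (f₁ x).1 (f' x).1) (θ x).1))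
        = E₃.conj (dsum (dsum (f₀ x).1 (f' x).1) (W.conj (dsum (f₁ x).1 (θ x).1))) := by
      rw [UnitaryIso.trans_conj, UnitaryIso.trans_conj, splitEquiv_symm_conj,
        UnitaryIso.dsum_conj, hE₂]
    have h5 : E₃.conj (dsum (dsum (f₁ x).1 (f' x).1) (dsum 1 (θ x).1)) =
        dsum 1 (dsum (dsum (f₁ x).1 (f' x).1) (θ x).1) := leftCommEquiv_conj _ _ _
    have h6 := E₃.norm_conj_sub_le (norm_dsum_sub_le h3 (h2 x hx))
    rw [h5, ← h4] at h6
    simp only [coe_dsumU, hG' x hx]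
    exact h6

theorem ladder {ε : ℝ} (hε : 0 < ε)
    (f : Fin (m + 1) ⊕ Fin (m + 1) → Matrix.unitaryGroup ι ℂ) : Ladder ε f := by
  obtain ⟨n, hn⟩ := exists_unitary_chain hε
  choose γ h0 h1 h2 _ using fun x => hn ι (f x)
  have key : ∀ j, Ladder ε (fun x => γ x j) := fun j => by
    induction j with
    | zero => simp only [h0]; exact Ladder.one hε.le
    | succ j ih => exact ih.step fun x => h2 x j
  simpa only [h1] using key n

/-- The inclusion of the first summand. -/
abbrev inlMat (ι κ : Type) [DecidableEq ι] : Matrix (ι ⊕ κ) ι ℂ := Matrix.fromRows 1 0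

theorem exists_unitaryIso_of_isometry {V : Matrix μ ι ℂ} (hV : V.conjTranspose * V = 1) :
    ∃ (κ : Type) (_ : Fintype κ) (_ : DecidableEq κ) (W : UnitaryIso (ι ⊕ κ) μ),
      W.mat * inlMat ι κ = V := by
  let v : ι → EuclideanSpace ℂ μ := fun j => WithLp.toLp 2 fun k => V k j
  have hv : Orthonormal ℂ v := by
    rw [orthonormal_iff_ite]
    intro i j
    have := congrFun (congrFun hV i) j
    rw [Matrix.mul_apply, Matrix.one_apply] at this
    rw [← this]
    simp [v, PiLp.inner_apply, mul_comm]
  have hcard : Fintype.card ι ≤ Fintype.card μ := by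
    simpa using hv.linearIndependent.fintype_card_le_finrank
  have hcard' : Fintype.card (ι ⊕ Fin (Fintype.card μ - Fintype.card ι)) = Fintype.card μ := by
    simp; omega
  let v' : ι ⊕ Fin (Fintype.card μ - Fintype.card ι) → EuclideanSpace ℂ μ := Sum.elim v 0
  have hv' : Orthonormal ℂ ((Set.range Sum.inl).domRestrict v') := by
    have h1 : v = (Set.range Sum.inl).domRestrict v' ∘
        fun i => ⟨Sum.inl i, Set.mem_range_self i⟩ := by
      funext i; simp [v']
    have h2 := (orthonormal_iff_ite.1 hv)
    rw [orthonormal_iff_ite]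
    rintro ⟨_, i, rfl⟩ ⟨_, j, rfl⟩
    refine (h2 i j).trans ?_
    by_cases hij : i = j
    · simp [hij]
    · rw [if_neg hij, if_neg fun h => hij (Sum.inl_injective (congrArg Subtype.val h))]
  obtain ⟨b, hb⟩ := hv'.exists_orthonormalBasis_extension_of_card_eq (by simp [hcard'])
  let M : Matrix μ (ι ⊕ Fin (Fintype.card μ - Fintype.card ι)) ℂ := Matrix.of fun k x => b x k
  have hM : M.conjTranspose * M = 1 := by
    ext i j
    have := orthonormal_iff_ite.1 b.orthonormal i j
    rw [Matrix.one_apply, ← this]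
    simp [M, Matrix.mul_apply, PiLp.inner_apply, mul_comm]
  refine ⟨_, inferInstance, inferInstance, ⟨M, hM,
    (Matrix.mul_eq_one_comm_of_card_eq _ _ _ hcard').1 hM⟩, ?_⟩
  ext k j
  have := congrFun (congrArg WithLp.ofLp (hb (Sum.inl j) (Set.mem_range_self j))) k
  have h3 : (M * inlMat ι (Fin (Fintype.card μ - Fintype.card ι))) k j = M k (Sum.inl j) := by
    simp [Matrix.mul_apply, Matrix.one_apply]
  exact h3.trans this

theorem norm_dsum_corner_sub_le {η : ℝ} (f : Matrix.unitaryGroup ι ℂ)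
    (G : Matrix.unitaryGroup (ι ⊕ κ) ℂ)
    (h : ‖G.1 * inlMat ι κ - inlMat ι κ * f.1‖ ≤ η) :
    ‖dsum f.1 G.1.toBlocks₂₂ - G.1‖ ≤ 2 * η := by
  set J : Matrix (ι ⊕ κ) ι ℂ := Matrix.fromRows 1 0 with hJ
  set E := G.1 * J - J * f.1 with hE
  have hη : 0 ≤ η := (norm_nonneg _).trans h
  have hJJ : J.conjTranspose * J = 1 := by
    simp [hJ, Matrix.conjTranspose_fromRows_eq_fromCols_conjTranspose,
      Matrix.fromCols_mul_fromRows]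
  have hJ1 := l2_opNorm_le_one_of_conjTranspose_mul_self hJJ
  have hJ2 : ‖J.conjTranspose‖ ≤ 1 := by rwa [Matrix.l2_opNorm_conjTranspose]
  have hE' : f.1 * E.conjTranspose * G.1 = f.1 * J.conjTranspose - J.conjTranspose * G.1 := by
    have h1 : G.1.conjTranspose * G.1 = 1 := Unitary.coe_star_mul_self G
    have h2 : f.1 * f.1.conjTranspose = 1 := Unitary.coe_mul_star_self f
    simp only [hE, Matrix.conjTranspose_sub, Matrix.conjTranspose_mul, Matrix.mul_sub,
      Matrix.sub_mul]
    rw [Matrix.mul_assoc f.1, Matrix.mul_assoc _ _ G.1, h1,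
        ← Matrix.mul_assoc f.1 _ J.conjTranspose,
      h2]
    simp
  have hE'n : ‖f.1 * J.conjTranspose - J.conjTranspose * G.1‖ ≤ η := by
    rw [← hE']
    calc _ ≤ ‖f.1 * E.conjTranspose‖ * ‖G.1‖ := Matrix.l2_opNorm_mul _ _
      _ ≤ (‖f.1‖ * ‖E.conjTranspose‖) * ‖G.1‖ := by gcongr; exact Matrix.l2_opNorm_mul _ _
      _ ≤ (1 * η) * 1 := by
        rw [Matrix.l2_opNorm_conjTranspose]
        gcongr
        exacts [norm_coe_unitary_le f, norm_coe_unitary_le G]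
      _ = η := by ring
  have key : dsum f.1 G.1.toBlocks₂₂ - G.1 = -(E * J.conjTranspose) +
      J * ((f.1 * J.conjTranspose - J.conjTranspose * G.1) *
        (dsum 0 1 : Matrix (ι ⊕ κ) (ι ⊕ κ) ℂ)) := by
    rw [hE, ← Matrix.fromBlocks_toBlocks G.1]
    generalize G.1.toBlocks₁₁ = A
    generalize G.1.toBlocks₁₂ = B
    generalize G.1.toBlocks₂₁ = C
    generalize G.1.toBlocks₂₂ = D
    have h3 : (Matrix.fromCols f.1 0 - Matrix.fromCols A B) *
        (dsum 0 1 : Matrix (ι ⊕ κ) (ι ⊕ κ) ℂ) = Matrix.fromCols 0 (-B) := by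
      rw [Matrix.sub_mul, Matrix.fromCols_mul_fromBlocks, Matrix.fromCols_mul_fromBlocks]
      ext i j
      rcases j with j | j <;> simp
    have h4 : f.1 * J.conjTranspose - J.conjTranspose * Matrix.fromBlocks A B C D =
        Matrix.fromCols f.1 0 - Matrix.fromCols A B := by
      simp [hJ, Matrix.conjTranspose_fromRows_eq_fromCols_conjTranspose, Matrix.mul_fromCols,
        Matrix.fromCols_mul_fromBlocks]
    rw [h4, h3]
    ext i j
    rcases i with i | i <;> rcases j with j | j <;>
      simp [hJ, Matrix.conjTranspose_fromRows_eq_fromCols_conjTranspose,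
        Matrix.fromBlocks_mul_fromRows, Matrix.fromRows_mul, Matrix.sub_mul,
        Matrix.mul_fromCols]
  have hdz : ‖dsum (0 : Matrix ι ι ℂ) (1 : Matrix κ κ ℂ)‖ ≤ 1 :=
    norm_dsum_le (by simp) norm_matrix_one_le
  rw [key, two_mul]
  refine (norm_add_le _ _).trans (add_le_add ?_ ?_)
  · rw [norm_neg]
    calc _ ≤ ‖E‖ * ‖J.conjTranspose‖ := Matrix.l2_opNorm_mul _ _
      _ ≤ η * 1 := mul_le_mul h hJ2 (norm_nonneg _) hη
      _ = η := mul_one η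
  · calc _ ≤ ‖J‖ * ‖(f.1 * J.conjTranspose - J.conjTranspose * G.1) *
        (dsum 0 1 : Matrix (ι ⊕ κ) (ι ⊕ κ) ℂ)‖ :=
        Matrix.l2_opNorm_mul _ _
      _ ≤ ‖J‖ * (‖f.1 * J.conjTranspose - J.conjTranspose * G.1‖ *
          ‖dsum (0 : Matrix ι ι ℂ) (1 : Matrix κ κ ℂ)‖) := by
        gcongr; exact Matrix.l2_opNorm_mul _ _
      _ ≤ 1 * (η * 1) := by gcongr
      _ = η := by ring

/-- An almost intertwining isometry into a tuple satisfying the surface relation. -/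
theorem complemented_of_isometry {η : ℝ} (f : Fin m ⊕ Fin m → Matrix.unitaryGroup ι ℂ)
    (G : Fin m ⊕ Fin m → Matrix.unitaryGroup μ ℂ) (hG : relVal G = 1) {V : Matrix μ ι ℂ}
    (hV : V.conjTranspose * V = 1) (h : ∀ x, ‖(G x).1 * V - V * (f x).1‖ ≤ η) :
    Complemented (2 * η) fun x => (f x).1 := by
  obtain ⟨κ, _, _, W, rfl⟩ := exists_unitaryIso_of_isometry hV
  refine ⟨κ, _, _, fun x => W.symm.conjU (G x), fun x => (W.symm.conjU (G x)).1.toBlocks₂₂, ?_,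
    fun x => norm_dsum_corner_sub_le _ _ ?_⟩
  · rw [UnitaryIso.relVal_conjU, hG, map_one]
  · have h1 : (W.symm.conjU (G x)).1 * (inlMat ι κ) -
        inlMat ι κ * (f x).1 = W.mat.conjTranspose *
          ((G x).1 * (W.mat * inlMat ι κ) - W.mat * inlMat ι κ * (f x).1) := by
      have h2 : W.mat.conjTranspose * (W.mat * inlMat ι κ * (f x).1) =
          inlMat ι κ * (f x).1 := by
        rw [Matrix.mul_assoc W.mat, ← Matrix.mul_assoc, W.left, Matrix.one_mul]
      rw [Matrix.mul_sub, h2]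
      simp [UnitaryIso.conj, UnitaryIso.symm, Matrix.mul_assoc]
    rw [h1]
    have h3 := l2_opNorm_le_one_of_conjTranspose_mul_self W.left
    calc _ ≤ ‖W.mat.conjTranspose‖ * _ := Matrix.l2_opNorm_mul _ _
      _ ≤ 1 * η := by
        rw [Matrix.l2_opNorm_conjTranspose]
        exact mul_le_mul h3 (h x) (norm_nonneg _) zero_le_one
      _ = η := one_mul η

/-- A column of square matrices. -/
def colMat (A : κ → Matrix ι ι ℂ) : Matrix (ι × κ) ι ℂ := Matrix.of fun x j => A x.2 x.1 j

theorem colMat_conjTranspose_mul_self (A : κ → Matrix ι ι ℂ) :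
    (colMat A).conjTranspose * colMat A = ∑ k, (A k).conjTranspose * A k := by
  ext i j
  simp only [colMat, Matrix.mul_apply, Matrix.sum_apply, Fintype.sum_prod_type,
    Matrix.conjTranspose_apply, Matrix.of_apply]
  exact Finset.sum_comm

theorem norm_colMat_sq_le (A : κ → Matrix ι ι ℂ) : ‖colMat A‖ ^ 2 ≤ ∑ k, ‖A k‖ ^ 2 := by
  rw [sq, ← Matrix.l2_opNorm_conjTranspose_mul_self, colMat_conjTranspose_mul_self]
  refine (norm_sum_le _ _).trans (Finset.sum_le_sum fun k _ => ?_)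
  rw [Matrix.l2_opNorm_conjTranspose_mul_self, sq]

theorem colMat_mul (A : κ → Matrix ι ι ℂ) (B : Matrix ι ι ℂ) :
    colMat A * B = colMat fun k => A k * B := by
  ext i j
  simp [colMat, Matrix.mul_apply]

theorem colMat_sub (A B : κ → Matrix ι ι ℂ) :
    colMat A - colMat B = colMat fun k => A k - B k := by
  ext i j
  simp [colMat]

theorem blockDiagonal_mul_colMat (v A : κ → Matrix ι ι ℂ) :
    Matrix.blockDiagonal v * colMat A = colMat fun k => v k * A k := by
  ext ⟨i, k⟩ j
  simp [colMat, Matrix.mul_apply, Matrix.blockDiagonal_apply, Fintype.sum_prod_type]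

/-- Block diagonal unitaries. -/
def diagU : (κ → Matrix.unitaryGroup ι ℂ) →* Matrix.unitaryGroup (ι × κ) ℂ where
  toFun v := ⟨Matrix.blockDiagonal fun k => (v k).1, by
    rw [Matrix.mem_unitaryGroup_iff', Matrix.star_eq_conjTranspose,
      Matrix.blockDiagonal_conjTranspose, ← Matrix.blockDiagonal_mul]
    have : (fun k => (v k).1.conjTranspose * (v k).1) = 1 := by
      funext k
      exact Unitary.coe_star_mul_self (v k)
    rw [this, Matrix.blockDiagonal_one]⟩
  map_one' := Subtype.ext (Matrix.blockDiagonal_one (m := ι) (o := κ) (α := ℂ))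
  map_mul' u v := Subtype.ext (Matrix.blockDiagonal_mul (fun k => (u k).1) fun k => (v k).1)

theorem coe_diagU (v : κ → Matrix.unitaryGroup ι ℂ) :
    (diagU v).1 = Matrix.blockDiagonal fun k => (v k).1 := rfl

/-- The permutation of the blocks. -/
def shiftU (ι : Type) [Fintype ι] [DecidableEq ι] (σ : Equiv.Perm κ) :
    Matrix.unitaryGroup (ι × κ) ℂ :=
  ⟨(UnitaryIso.ofEquiv (Equiv.prodCongr (Equiv.refl ι) σ)).mat,
    Matrix.mem_unitaryGroup_iff'.2 (UnitaryIso.ofEquiv (Equiv.prodCongr (Equiv.refl ι) σ)).left⟩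

theorem shiftU_mul_colMat (σ : Equiv.Perm κ) (A : κ → Matrix ι ι ℂ) :
    (shiftU ι σ).1 * colMat A = colMat fun k => A (σ.symm k) := by
  ext ⟨i, k⟩ j
  simp only [colMat, shiftU, UnitaryIso.ofEquiv, Matrix.mul_apply, Matrix.submatrix_apply, id,
    Matrix.one_apply, Matrix.of_apply, ← Equiv.symm_apply_eq]
  simp

theorem shiftU_conj_diagU (σ : Equiv.Perm κ) (v : κ → Matrix.unitaryGroup ι ℂ) :
    shiftU ι σ * diagU v * (shiftU ι σ)⁻¹ = diagU fun k => v (σ.symm k) := by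
  refine Subtype.ext ?_
  refine (UnitaryIso.ofEquiv_conj (Equiv.prodCongr (Equiv.refl ι) σ) (diagU v).1).trans ?_
  ext ⟨i, k⟩ ⟨j, l⟩
  simp [coe_diagU, Matrix.blockDiagonal_apply]

theorem diagU_relVal_handles (σ : Equiv.Perm κ) (τ z : κ → Matrix.unitaryGroup ι ℂ)
    (α β : Fin m → κ → Matrix.unitaryGroup ι ℂ)
    (rel : ∀ k, τ (σ k) * z k * (τ k)⁻¹ * (z k)⁻¹ *
      commList (fun i => α i (σ k)) (fun i => β i (σ k)) = 1) :
    relVal (handles (diagU τ) (shiftU ι σ * diagU z) (fun i => diagU (α i))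
      fun i => diagU (β i)) = 1 := by
  rw [relVal_handles, ← map_commList diagU]
  have h1 : diagU τ * (shiftU ι σ * diagU z) * (diagU τ)⁻¹ * (shiftU ι σ * diagU z)⁻¹ =
      diagU τ * (shiftU ι σ * diagU (z * τ⁻¹ * z⁻¹) * (shiftU ι σ)⁻¹) := by
    simp only [map_mul, map_inv]; group
  rw [h1, shiftU_conj_diagU, ← map_mul, ← map_mul]
  convert map_one (diagU (ι := ι) (κ := κ))
  funext k
  have h2 := rel (σ.symm k)
  rw [Equiv.apply_symm_apply] at h2
  have h3 : commList α β k = commList (fun i => α i k) (fun i => β i k) :=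
    map_commList (Pi.evalMonoidHom (fun _ : κ => Matrix.unitaryGroup ι ℂ) k) α β
  simp only [Pi.mul_apply, Pi.inv_apply, Pi.one_apply, h3]
  rw [← h2]
  group

theorem norm_colMat_le {η : ℝ} (hη : 0 ≤ η) {A : κ → Matrix ι ι ℂ} {w : κ → ℝ}
    (h : ∀ k, ‖A k‖ ≤ w k) (hw : ∑ k, w k ^ 2 ≤ η ^ 2) : ‖colMat A‖ ≤ η := by
  refine abs_le_of_sq_le_sq' ((norm_colMat_sq_le A).trans (le_trans ?_ hw)) hη |>.2
  exact Finset.sum_le_sum fun k _ => pow_le_pow_left₀ (norm_nonneg _) (h k) 2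

theorem norm_mul_coe_unitary_le (A : Matrix μ ι ℂ) (u : Matrix.unitaryGroup ι ℂ) :
    ‖A * u.1‖ ≤ ‖A‖ :=
  (Matrix.l2_opNorm_mul _ _).trans
    (mul_le_of_le_one_right (norm_nonneg _) (norm_coe_unitary_le u))

/-- A column of scalar matrices. -/
def windowMat (ι : Type) [Fintype ι] [DecidableEq ι] (w : κ → ℝ) : Matrix (ι × κ) ι ℂ :=
  colMat fun k => (w k : ℂ) • (1 : Matrix ι ι ℂ)

theorem complemented_of_window {η : ℝ} (hη : 0 ≤ η) (σ : Equiv.Perm κ)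
    (τ z : κ → Matrix.unitaryGroup ι ℂ) (α β : Fin m → κ → Matrix.unitaryGroup ι ℂ)
    (rel : ∀ k, τ (σ k) * z k * (τ k)⁻¹ * (z k)⁻¹ *
      commList (fun i => α i (σ k)) (fun i => β i (σ k)) = 1)
    (t ζ : Matrix.unitaryGroup ι ℂ) (a b : Fin m → Matrix.unitaryGroup ι ℂ)
    (w : κ → ℝ) (hw : ∑ k, w k ^ 2 = 1) (hτ : ∀ k, w k ≠ 0 → ‖(τ k).1 - t.1‖ ≤ η)
    (hz : ∀ k, w k ≠ 0 → z k = ζ) (hα : ∀ i k, w k ≠ 0 → α i k = a i)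
    (hβ : ∀ i k, w k ≠ 0 → β i k = b i) (hσ : ∑ k, (w k - w (σ k)) ^ 2 ≤ η ^ 2) :
    Complemented (2 * η) fun x => (handles t ζ a b x).1 := by
  have hcol : ∀ (v : κ → Matrix.unitaryGroup ι ℂ) (u : Matrix.unitaryGroup ι ℂ) {η' : ℝ},
      0 ≤ η' → (∀ k, w k ≠ 0 → ‖(v k).1 - u.1‖ ≤ η') →
      ‖(diagU v).1 * windowMat ι w - windowMat ι w * u.1‖ ≤
        η' := by
    intro v u η' hη' h
    rw [windowMat, coe_diagU, blockDiagonal_mul_colMat, colMat_mul, colMat_sub]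
    refine norm_colMat_le (w := fun k => η' * |w k|) hη' (fun k => ?_) ?_
    · have : (v k).1 * ((w k : ℂ) • 1) - ((w k : ℂ) • 1) * u.1 = (w k : ℂ) • ((v k).1 - u.1) := by
        simp [smul_sub]
      rw [this, norm_smul, Complex.norm_real, Real.norm_eq_abs]
      by_cases h0 : w k = 0
      · simp [h0]
      · rw [mul_comm]
        exact mul_le_mul_of_nonneg_right (h k h0) (abs_nonneg _)
    · simp only [mul_pow, sq_abs, ← Finset.mul_sum, hw, mul_one, le_refl]
  have hcol0 : ∀ (v : κ → Matrix.unitaryGroup ι ℂ) (u : Matrix.unitaryGroup ι ℂ),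
      (∀ k, w k ≠ 0 → v k = u) →
      ‖(diagU v).1 * windowMat ι w - windowMat ι w * u.1‖ ≤
        0 := by
    intro v u h
    refine hcol v u le_rfl fun k hk => ?_
    simp [h k hk]
  refine complemented_of_isometry _ _ (diagU_relVal_handles σ τ z α β rel)
    (V := windowMat ι w) ?_ ?_
  · rw [windowMat, colMat_conjTranspose_mul_self]
    simp only [Matrix.conjTranspose_smul, Matrix.conjTranspose_one, Matrix.mul_smul, Matrix.mul_one,
      smul_smul, ← Finset.sum_smul]
    have : ∑ k, ((w k : ℂ) * star (w k : ℂ)) = 1 := by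
      rw [← Complex.ofReal_one, ← hw]
      push_cast
      exact Finset.sum_congr rfl fun k _ => by simp [sq]
    rw [this, one_smul]
  · refine (forall_handles (r := fun (G : Matrix.unitaryGroup (ι × κ) ℂ)
      (f : Matrix.unitaryGroup ι ℂ) => ‖G.1 * windowMat ι w -
        windowMat ι w * f.1‖ ≤ η)).2 ⟨hcol τ t hη hτ, ?_,
        fun i => (hcol0 _ _ (hα i)).trans hη, fun i => (hcol0 _ _ (hβ i)).trans hη⟩
    have h1 : (diagU z).1 * windowMat ι w =
        windowMat ι w * ζ.1 :=
      sub_eq_zero.1 (norm_le_zero_iff.1 (hcol0 z ζ hz))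
    have h2 : (shiftU ι σ * diagU z).1 = (shiftU ι σ).1 * (diagU z).1 := rfl
    rw [h2, Matrix.mul_assoc, h1, ← Matrix.mul_assoc, windowMat, shiftU_mul_colMat,
        ← Matrix.sub_mul,
      colMat_sub]
    refine (norm_mul_coe_unitary_le _ _).trans ?_
    refine norm_colMat_le (w := fun k => |w (σ.symm k) - w k|) hη (fun k => ?_) ?_
    · rw [← sub_smul, norm_smul, ← Complex.ofReal_sub, Complex.norm_real, Real.norm_eq_abs]
      exact mul_le_of_le_one_right (abs_nonneg _) norm_matrix_one_le
    · rw [← Equiv.sum_comp σ]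
      simpa using hσ

theorem norm_mul_sub_mul_left (u v w : Matrix.unitaryGroup ι ℂ) :
    ‖(u * v).1 - (u * w).1‖ = ‖v.1 - w.1‖ := by
  rw [← norm_unitary_mul (v.1 - w.1) u, Matrix.mul_sub]; rfl

theorem norm_mul_sub_mul_right (u v w : Matrix.unitaryGroup ι ℂ) :
    ‖(v * u).1 - (w * u).1‖ = ‖v.1 - w.1‖ := by
  rw [← norm_mul_unitary (v.1 - w.1) u, Matrix.sub_mul]; rfl

theorem norm_inv_sub_inv (v w : Matrix.unitaryGroup ι ℂ) :
    ‖(v⁻¹).1 - (w⁻¹).1‖ = ‖v.1 - w.1‖ := by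
  rw [← norm_star (v.1 - w.1), star_sub]; rfl

theorem norm_inv_sub_one (v : Matrix.unitaryGroup ι ℂ) : ‖(v⁻¹).1 - 1‖ = ‖v.1 - 1‖ := by
  have := norm_inv_sub_inv v 1
  simpa using this

/-- The iterates of conjugation by `ζ` followed by translation by `R⁻¹`. -/
def drift (R ζ t : Matrix.unitaryGroup ι ℂ) : ℕ → Matrix.unitaryGroup ι ℂ
  | 0 => t
  | k + 1 => R⁻¹ * ζ * drift R ζ t k * ζ⁻¹

theorem norm_drift_sub_le {δ : ℝ} (R ζ t : Matrix.unitaryGroup ι ℂ)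
    (h : ‖(t * ζ * t⁻¹ * ζ⁻¹ * R).1 - 1‖ ≤ δ) (k : ℕ) : ‖(drift R ζ t k).1 - t.1‖ ≤ k * δ := by
  induction k with
  | zero => simp [drift]
  | succ k ih =>
    have h1 : ‖(R⁻¹ * ζ * t * ζ⁻¹).1 - t.1‖ ≤ δ := by
      refine le_trans (le_of_eq ?_) h
      rw [← norm_inv_sub_one, ← norm_mul_sub_mul_right t⁻¹]
      have : (t * ζ * t⁻¹ * ζ⁻¹ * R)⁻¹ = R⁻¹ * ζ * t * ζ⁻¹ * t⁻¹ := by group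
      rw [this, mul_inv_cancel]; rfl
    have h2 : ‖(drift R ζ t (k + 1)).1 - (R⁻¹ * ζ * t * ζ⁻¹).1‖ = ‖(drift R ζ t k).1 - t.1‖ := by
      rw [drift, norm_mul_sub_mul_right, norm_mul_sub_mul_left]
    calc _ ≤ ‖(drift R ζ t (k + 1)).1 - (R⁻¹ * ζ * t * ζ⁻¹).1‖ +
        ‖(R⁻¹ * ζ * t * ζ⁻¹).1 - t.1‖ := norm_sub_le_norm_sub_add_norm_sub _ _ _
      _ ≤ k * δ + δ := add_le_add (h2.trans_le ih) h1
      _ = _ := by push_cast; ring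

theorem apply_finRotate {X : Type*} {n : ℕ} (F : ℕ → X) (hF : F (n + 1) = F 0) (k : Fin (n + 1)) :
    F (finRotate (n + 1) k) = F (k + 1) := by
  rw [coe_finRotate]
  split_ifs with h
  · rw [h, ← hF]; simp
  · rfl

theorem exists_window {η : ℝ} (hη : 0 < η) : ∃ (L : ℕ) (w : ℕ → ℝ), (∀ k, w k ≠ 0 → 1 ≤ k ∧ k ≤ L) ∧
    ∀ n, L < n → ∑ k ∈ Finset.range n, w k ^ 2 = 1 ∧
      ∑ k ∈ Finset.range n, (w k - w (k + 1)) ^ 2 ≤ η ^ 2 := by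
  obtain ⟨L, hL⟩ := exists_nat_gt (2 / η ^ 2)
  have hL0 : (0 : ℝ) < L := lt_of_le_of_lt (by positivity) hL
  set s : ℝ := Real.sqrt (1 / L)
  have hs : s ^ 2 = 1 / L := Real.sq_sqrt (by positivity)
  refine ⟨L, fun k => if 1 ≤ k ∧ k ≤ L then s else 0, fun k hk => by by_contra h; simp [h] at hk,
    fun n hn => ⟨?_, ?_⟩⟩
  · have h1 : ∀ k, (if 1 ≤ k ∧ k ≤ L then s else 0) ^ 2 =
        if 1 ≤ k ∧ k ≤ L then 1 / (L : ℝ) else 0 := fun k => by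
      split_ifs
      · exact hs
      · norm_num
    simp only [h1]
    rw [← Finset.sum_filter]
    have h2 : (Finset.range n).filter (fun k => 1 ≤ k ∧ k ≤ L) = Finset.Icc 1 L := by
      ext k; simp; omega
    rw [h2, Finset.sum_const, Nat.card_Icc, nsmul_eq_mul, Nat.add_sub_cancel]
    field_simp
  · have hle : ∀ k ∈ Finset.range n, ((if 1 ≤ k ∧ k ≤ L then s else 0) -
        (if 1 ≤ k + 1 ∧ k + 1 ≤ L then s else 0)) ^ 2 ≤
        (if k = 0 then 1 / (L : ℝ) else 0) + (if k = L then 1 / (L : ℝ) else 0) := by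
      intro k _
      have hp : (0 : ℝ) ≤ 1 / L := by positivity
      split_ifs <;> first | omega | (simp [hs]; try positivity)
    refine (Finset.sum_le_sum hle).trans ?_
    rw [Finset.sum_add_distrib, Finset.sum_ite_eq', Finset.sum_ite_eq',
      if_pos (Finset.mem_range.2 (by omega)), if_pos (Finset.mem_range.2 hn)]
    rw [div_lt_iff₀ (by positivity)] at hL
    rw [← add_div, div_le_iff₀ hL0]
    linarith

theorem exists_complemented (m : ℕ) {ε : ℝ} (hε : 0 < ε) : ∃ δ > 0, ∀ (ι : Type) [Fintype ι]
    [DecidableEq ι] (f : Fin (m + 1) ⊕ Fin (m + 1) → Matrix.unitaryGroup ι ℂ),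
    ‖(relVal f).1 - 1‖ ≤ δ → Complemented ε fun x => (f x).1 := by
  obtain ⟨L, w, hw, hw'⟩ := exists_window (half_pos hε)
  refine ⟨ε / 2 / (L + 1), by positivity, fun ι _ _ f hf => ?_⟩
  obtain ⟨t, ζ, a, b, rfl⟩ := exists_handles f
  rw [relVal_handles] at hf
  set R := commList a b with hR
  set M := L + 1 with hM
  have hN : 2 * L + 1 + 1 = 2 * M := by omega
  obtain ⟨hw1, hw2⟩ := hw' (2 * L + 1 + 1) (by omega)
  let τ : ℕ → Matrix.unitaryGroup ι ℂ := fun n =>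
    if n ≤ M then drift R ζ t n else drift R ζ t (2 * M - n)
  let z : ℕ → Matrix.unitaryGroup ι ℂ := fun n => if n < M then ζ else ζ⁻¹
  let α : Fin m → ℕ → Matrix.unitaryGroup ι ℂ := fun i n =>
    if 1 ≤ n ∧ n ≤ M then a i else ζ⁻¹ * b i.rev * ζ
  let β : Fin m → ℕ → Matrix.unitaryGroup ι ℂ := fun i n =>
    if 1 ≤ n ∧ n ≤ M then b i else ζ⁻¹ * a i.rev * ζ
  have hrev : commList (fun i => ζ⁻¹ * b i.rev * ζ) (fun i => ζ⁻¹ * a i.rev * ζ) =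
      ζ⁻¹ * R⁻¹ * ζ := by
    have := map_commList (MulAut.conj ζ⁻¹).toMonoidHom (fun i => b i.rev) (fun i => a i.rev)
    rw [commList_rev] at this
    simpa using this.symm
  have hrel : ∀ n < 2 * M, τ (n + 1) * z n * (τ n)⁻¹ * (z n)⁻¹ *
      commList (fun i => α i (n + 1)) (fun i => β i (n + 1)) = 1 := by
    intro n hn
    by_cases h : n < M
    · have h1 : n + 1 ≤ M := h
      simp only [τ, z, α, β, h, h1, h.le, if_true, le_add_iff_nonneg_left, zero_le, true_and, drift]
      rw [← hR]
      group
    · have h1 : ¬ n + 1 ≤ M := by omega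
      have h2 : τ n = drift R ζ t (2 * M - (n + 1) + 1) := by
        simp only [τ]
        split_ifs
        · congr 1; omega
        · congr 1; omega
      rw [h2]
      simp only [τ, z, α, β, h, h1, if_false, and_false, hrev, drift]
      group
  have hsum : ∀ F : ℕ → ℝ, ∑ k : Fin (2 * L + 1 + 1), F k = ∑ k ∈ Finset.range (2 * L + 1 + 1),
      F k :=
    fun F => Fin.sum_univ_eq_sum_range F _
  have hrot : ∀ {X : Type} (F : ℕ → X), F (2 * M) = F 0 → ∀ k : Fin (2 * L + 1 + 1),
      F (finRotate _ k) = F (k + 1) := fun F hF k => apply_finRotate F (by rw [hN, hF]) k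
  have hα : ∀ i, α i (2 * M) = α i 0 := fun i => by
    have : ¬ 2 * M ≤ M := by omega
    simp [α, this]
  have hβ : ∀ i, β i (2 * M) = β i 0 := fun i => by
    have : ¬ 2 * M ≤ M := by omega
    simp [β, this]
  have hτ : τ (2 * M) = τ 0 := by
    have : ¬ 2 * M ≤ M := by omega
    simp [τ, this]
  have hw0 : w (2 * M) = w 0 := by
    rw [not_imp_comm.1 (hw (2 * M)) (by omega), not_imp_comm.1 (hw 0) (by omega)]
  have key := complemented_of_window (half_pos hε).le (finRotate (2 * L + 1 + 1)) (fun k => τ k)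
    (fun k => z k) (fun i k => α i k) (fun i k => β i k) (fun k => ?_) t ζ a b (fun k => w k)
    ((hsum fun k => w k ^ 2).trans hw1) (fun k hk => ?_) (fun k hk => ?_) (fun i k hk => ?_)
    (fun i k hk => ?_) ?_
  · simpa [mul_div_cancel₀] using key
  · simp only [hrot τ hτ, hrot _ (hα _), hrot _ (hβ _)]
    exact hrel k (by have := k.2; omega)
  · have h1 := hw _ hk
    have h2 : τ k = drift R ζ t k := by simp only [τ]; rw [if_pos (by omega)]
    rw [h2]
    refine (norm_drift_sub_le R ζ t hf k).trans ?_
    have h3 : ((k : ℕ) : ℝ) ≤ L + 1 := by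
      have : ((k : ℕ) : ℝ) ≤ L := by exact_mod_cast h1.2
      linarith
    calc _ ≤ ((L : ℝ) + 1) * (ε / 2 / (L + 1)) := by gcongr
      _ = ε / 2 := by field_simp
  · have h1 := hw _ hk
    simp only [z]; rw [if_pos (by omega)]
  · have h1 := hw _ hk
    simp only [α]; rw [if_pos (by omega)]
  · have h1 := hw _ hk
    simp only [β]; rw [if_pos (by omega)]
  · simp only [hrot w hw0]
    exact (hsum fun k => (w k - w (k + 1)) ^ 2).trans_le hw2

theorem norm_mul_sub_mul_le (A B C D : Matrix ι ι ℂ) :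
    ‖A * B - C * D‖ ≤ ‖A - C‖ * ‖B‖ + ‖C‖ * ‖B - D‖ := by
  have : A * B - C * D = (A - C) * B + C * (B - D) := by
    rw [Matrix.sub_mul, Matrix.mul_sub]; abel
  rw [this]
  exact (norm_add_le _ _).trans
    (add_le_add (Matrix.l2_opNorm_mul _ _) (Matrix.l2_opNorm_mul _ _))

theorem norm_le_one_add_of_near {A : Matrix ι ι ℂ} {u : Matrix.unitaryGroup ι ℂ} {ε : ℝ}
    (h : ‖A - u.1‖ ≤ ε) : ‖A‖ ≤ 1 + ε := by
  have h1 := norm_sub_norm_le A u.1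
  have h2 := norm_coe_unitary_le u
  linarith

/-- Evaluation of a word is uniformly continuous near tuples of unitaries. -/
theorem exists_near_lift {X : Type} (w : FreeGroup X) {ε : ℝ} (hε : 0 < ε) :
    ∃ η > 0, ∀ (ι : Type) [Fintype ι] [DecidableEq ι] (p : X → (Matrix ι ι ℂ)ˣ)
      (u : X → Matrix.unitaryGroup ι ℂ), (∀ x, ‖(p x).1 - (u x).1‖ ≤ η) →
      ‖(FreeGroup.lift p w).1 - (FreeGroup.lift u w).1‖ ≤ ε := by
  induction w using FreeGroup.induction_on generalizing ε with
  | C1 => exact ⟨1, one_pos, fun ι _ _ p u _ => by simp [hε.le]⟩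
  | of x => exact ⟨ε, hε, fun ι _ _ p u h => by simpa using h x⟩
  | inv_of x _ =>
    refine ⟨min (1 / 2) (ε / 2), by positivity, fun ι _ _ p u h => ?_⟩
    have hx := h x
    simp only [map_inv, FreeGroup.lift_apply_of]
    have h1 : (p x)⁻¹.1 - ((u x)⁻¹).1 = (p x)⁻¹.1 * ((u x).1 - (p x).1) * ((u x)⁻¹).1 := by
      have h2 : (u x).1 * ((u x)⁻¹).1 = 1 := Unitary.coe_mul_star_self (u x)
      rw [Matrix.mul_sub, Matrix.sub_mul, Matrix.mul_assoc, h2, Units.inv_mul, Matrix.mul_one,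
        Matrix.one_mul]
    have h3 : ‖(p x)⁻¹.1 - ((u x)⁻¹).1‖ ≤
        (1 + ‖(p x)⁻¹.1 - ((u x)⁻¹).1‖) * min (1 / 2) (ε / 2) := by
      conv_lhs => rw [h1, norm_mul_unitary]
      refine (Matrix.l2_opNorm_mul _ _).trans ?_
      rw [norm_sub_rev (u x).1]
      exact mul_le_mul (norm_le_one_add_of_near le_rfl) hx (norm_nonneg _) (by positivity)
    have h4 : min (1 / 2) (ε / 2) ≤ 1 / 2 := min_le_left _ _
    have h5 : min (1 / 2) (ε / 2) ≤ ε / 2 := min_le_right _ _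
    nlinarith [norm_nonneg ((p x)⁻¹.1 - ((u x)⁻¹).1)]
  | mul a b ha hb =>
    obtain ⟨η₁, h₁, ha⟩ := ha (ε := min 1 (ε / 3)) (by positivity)
    obtain ⟨η₂, h₂, hb⟩ := hb (ε := min 1 (ε / 3)) (by positivity)
    refine ⟨min η₁ η₂, lt_min h₁ h₂, fun ι _ _ p u h => ?_⟩
    have h1 := ha ι p u fun x => (h x).trans (min_le_left _ _)
    have h2 := hb ι p u fun x => (h x).trans (min_le_right _ _)
    have h3 := norm_le_one_add_of_near h2
    rw [map_mul, map_mul]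
    have h4 : min 1 (ε / 3) ≤ 1 := min_le_left _ _
    have h5 : min 1 (ε / 3) ≤ ε / 3 := min_le_right _ _
    have h6 : 0 < min 1 (ε / 3) := by positivity
    refine (norm_mul_sub_mul_le _ _ _ _).trans ?_
    have h7 := norm_coe_unitary_le (FreeGroup.lift u a)
    calc _ ≤ min 1 (ε / 3) * (1 + min 1 (ε / 3)) + 1 * min 1 (ε / 3) := by gcongr
      _ ≤ ε := by nlinarith

theorem IsQuasiRep.mono {Γ : Type*} [Group Γ] {S T : Set Γ} {δ δ' : ℝ} {n : ℕ}
    {φ : Γ → Matrix (Fin n) (Fin n) ℂ} (h : IsQuasiRep T δ φ) (hS : S ⊆ T) (hδ : δ ≤ δ') :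
    IsQuasiRep S δ' φ :=
  ⟨h.1, h.2.1, fun s hs t ht => (h.2.2 s (hS hs) t (hS ht)).trans_le hδ⟩

/-- A quasi-representation close to unitaries on generators is close to their evaluation on any
word. -/
theorem exists_quasiRep_near_lift {X Γ : Type} [Group Γ] (ρ : FreeGroup X →* Γ) (w : FreeGroup X)
    {ε : ℝ} (hε : 0 < ε) : ∃ (T : Set Γ) (δ η : ℝ), T.Finite ∧ 0 < δ ∧ 0 < η ∧
      ∀ (n : ℕ) (φ : Γ → Matrix (Fin n) (Fin n) ℂ) (u : X → Matrix.unitaryGroup (Fin n) ℂ),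
      IsQuasiRep T δ φ → (∀ x, ‖φ (ρ (FreeGroup.of x)) - (u x).1‖ ≤ η) →
      ‖φ (ρ w) - (FreeGroup.lift u w).1‖ ≤ ε := by
  induction w using FreeGroup.induction_on generalizing ε with
  | C1 => exact ⟨∅, 1, 1, Set.finite_empty, one_pos, one_pos, fun n φ u hφ _ => by
      simp [hφ.1, hε.le]⟩
  | of x => exact ⟨∅, 1, ε, Set.finite_empty, one_pos, hε, fun n φ u _ h => by simpa using h x⟩
  | inv_of x _ =>
    refine ⟨{ρ (FreeGroup.of x), (ρ (FreeGroup.of x))⁻¹}, ε / 2, ε / 2, by simp, by positivity,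
      by positivity, fun n φ u hφ h => ?_⟩
    have h1 := hφ.2.2 (ρ (FreeGroup.of x)) (by simp) (ρ (FreeGroup.of x))⁻¹ (by simp)
    rw [mul_inv_cancel, hφ.1] at h1
    simp only [map_inv, FreeGroup.lift_apply_of]
    set A := φ (ρ (FreeGroup.of x))
    set B := φ (ρ (FreeGroup.of x))⁻¹
    have h2 : (u x).1 * ((u x)⁻¹).1 = 1 := Unitary.coe_mul_star_self (u x)
    have h3 : (u x).1 * (B - ((u x)⁻¹).1) = (A * B - 1) - (A - (u x).1) * B := by
      rw [Matrix.mul_sub, h2, Matrix.sub_mul]; abel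
    rw [← norm_unitary_mul _ (u x), h3]
    have h4 : ‖(A - (u x).1) * B‖ ≤ ε / 2 * 1 :=
      (Matrix.l2_opNorm_mul _ _).trans
        (mul_le_mul (h x) (hφ.2.1 _) (norm_nonneg _) (by positivity))
    have h5 := norm_sub_le (A * B - 1) ((A - (u x).1) * B)
    linarith
  | mul a b ha hb =>
    obtain ⟨T₁, δ₁, η₁, hT₁, hδ₁, h₁, ha⟩ := ha (ε := ε / 3) (by positivity)
    obtain ⟨T₂, δ₂, η₂, hT₂, hδ₂, h₂, hb⟩ := hb (ε := ε / 3) (by positivity)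
    refine ⟨{ρ a, ρ b} ∪ (T₁ ∪ T₂), min (ε / 3) (min δ₁ δ₂), min η₁ η₂,
      (by simp : Set.Finite {ρ a, ρ b}).union (hT₁.union hT₂), by positivity, by positivity,
      fun n φ u hφ h => ?_⟩
    have h1 := ha n φ u (hφ.mono (by intro; simp; tauto)
      ((min_le_right _ _).trans (min_le_left _ _))) fun x => (h x).trans (min_le_left _ _)
    have h2 := hb n φ u (hφ.mono (by intro; simp; tauto)
      ((min_le_right _ _).trans (min_le_right _ _))) fun x => (h x).trans (min_le_right _ _)
    have h3 := (hφ.2.2 (ρ a) (by simp) (ρ b) (by simp)).le.trans (min_le_left _ _)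
    rw [map_mul, map_mul]
    have h4 := (norm_mul_sub_mul_le (φ (ρ a)) (φ (ρ b)) (FreeGroup.lift u a).1
      (FreeGroup.lift u b).1)
    have h5 : ‖φ (ρ a) - (FreeGroup.lift u a).1‖ * ‖φ (ρ b)‖ ≤ ε / 3 * 1 :=
      mul_le_mul h1 (hφ.2.1 _) (norm_nonneg _) (by positivity)
    have h6 : ‖(FreeGroup.lift u a).1‖ * ‖φ (ρ b) - (FreeGroup.lift u b).1‖ ≤ 1 * (ε / 3) :=
      mul_le_mul (norm_coe_unitary_le _) h2 (norm_nonneg _) zero_le_one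
    have h7 := norm_sub_le_norm_sub_add_norm_sub (φ (ρ a * ρ b)) (φ (ρ a) * φ (ρ b))
      ((FreeGroup.lift u a).1 * (FreeGroup.lift u b).1)
    rw [norm_sub_rev (φ (ρ a * ρ b)) (φ (ρ a) * φ (ρ b))] at h7
    have h8 : (FreeGroup.lift u a * FreeGroup.lift u b).1 =
      (FreeGroup.lift u a).1 * (FreeGroup.lift u b).1 := rfl
    rw [h8]
    linarith

/-- Determinants along the segment from `c` to `1`. -/
def segDet (c : Matrix ι ι ℂ) (t : ℝ) : ℂ :=
  ((t : ℂ) • (1 : Matrix ι ι ℂ) + (1 - (t : ℂ)) • c).det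

/-- Vanishing of the winding number of the segment determinants. -/
def WindZero (c : Matrix ι ι ℂ) : Prop :=
  ∃ h : ℝ → ℂ, ContinuousOn h (Set.Icc 0 1) ∧ h 0 = h 1 ∧
    ∀ t ∈ Set.Icc (0 : ℝ) 1, Complex.exp (h t) = segDet c t

theorem segDet_zero (c : Matrix ι ι ℂ) : segDet c 0 = c.det := by simp [segDet]

theorem segDet_one (c : Matrix ι ι ℂ) : segDet c 1 = 1 := by simp [segDet]

theorem continuous_segDet {X : Type} [TopologicalSpace X] {c : X → Matrix ι ι ℂ}
    (hc : Continuous c) : Continuous fun p : X × ℝ => segDet (c p.1) p.2 := by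
  unfold segDet
  refine Continuous.matrix_det ?_
  have := hc.comp (continuous_fst (Y := ℝ))
  fun_prop

theorem isUnit_of_norm_sub_unitary {A : Matrix ι ι ℂ} (u : Matrix.unitaryGroup ι ℂ)
    (h : ‖A - u.1‖ < 1) : IsUnit A := by
  have h1 : ‖1 - (u⁻¹).1 * A‖ < 1 := by
    rwa [← norm_unitary_mul _ u, Matrix.mul_sub, Matrix.mul_one, ← Matrix.mul_assoc,
      show u.1 * (u⁻¹).1 = 1 from Unitary.coe_mul_star_self u, Matrix.one_mul, norm_sub_rev]
  have h2 := isUnit_one_sub_of_norm_lt_one h1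
  rw [sub_sub_cancel] at h2
  have h3 : IsUnit u.1 := (Unitary.toUnits u).isUnit
  have h4 := h3.mul h2
  rwa [← Matrix.mul_assoc, show u.1 * (u⁻¹).1 = 1 from Unitary.coe_mul_star_self u,
    Matrix.one_mul] at h4

theorem segDet_ne_zero {c : Matrix ι ι ℂ} (hc : ‖c - 1‖ < 1) {t : ℝ} (ht : t ∈ Set.Icc (0 : ℝ) 1) :
    segDet c t ≠ 0 := by
  have h1 : IsUnit ((t : ℂ) • (1 : Matrix ι ι ℂ) + (1 - (t : ℂ)) • c) := by
    refine isUnit_of_norm_sub_unitary 1 ?_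
    have h2 : (t : ℂ) • (1 : Matrix ι ι ℂ) + (1 - (t : ℂ)) • c -
        (1 : Matrix.unitaryGroup ι ℂ).1 = ((1 - t : ℝ) : ℂ) • (c - 1) := by
      change _ - (1 : Matrix ι ι ℂ) = _
      push_cast
      module
    rw [h2, norm_smul, Complex.norm_real, Real.norm_eq_abs, abs_of_nonneg (by linarith [ht.2])]
    exact lt_of_le_of_lt (mul_le_of_le_one_left (norm_nonneg _) (by linarith [ht.1])) hc
  exact ((Matrix.isUnit_iff_isUnit_det _).1 h1).ne_zero

theorem WindZero.of_near {c c' : Matrix ι ι ℂ} (h : WindZero c) (hc : c.det = 1) (hc' : c'.det = 1)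
    (hr : ∀ t ∈ Set.Icc (0 : ℝ) 1, segDet c t ≠ 0 ∧ ‖segDet c' t / segDet c t - 1‖ < 1) :
    WindZero c' := by
  obtain ⟨f, hf, hf1, hf2⟩ := h
  have hcont : ∀ c : Matrix ι ι ℂ, Continuous (segDet c) := fun c =>
    (continuous_segDet (X := Unit) (c := fun _ => c) continuous_const).comp
      (Continuous.prodMk_right ())
  have hs : ∀ t ∈ Set.Icc (0 : ℝ) 1, segDet c' t / segDet c t ∈ Complex.slitPlane := fun t ht =>
    Complex.ball_one_subset_slitPlane (by simpa [dist_eq_norm] using (hr t ht).2)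
  refine ⟨fun t => f t + Complex.log (segDet c' t / segDet c t), hf.add ?_, ?_, fun t ht => ?_⟩
  · refine ContinuousOn.clog ?_ hs
    exact (hcont c').continuousOn.div (hcont c).continuousOn fun t ht => (hr t ht).1
  · simp [segDet_zero, segDet_one, hc, hc', hf1]
  · rw [Complex.exp_add, hf2 t ht, Complex.exp_log (Complex.slitPlane_ne_zero (hs t ht)),
      mul_div_cancel₀ _ (hr t ht).1]

theorem windZero_iff_of_homotopy {X : Type} [TopologicalSpace X] [PreconnectedSpace X]
    {c : X → Matrix ι ι ℂ} (hc : Continuous c) (hdet : ∀ x, (c x).det = 1)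
    (hn : ∀ x, ‖c x - 1‖ < 1) (x y : X) : WindZero (c x) ↔ WindZero (c y) := by
  refine Eq.to_iff (IsLocallyConstant.apply_eq_of_preconnectedSpace
    (f := fun x => WindZero (c x)) ?_ x y)
  refine (IsLocallyConstant.iff_eventually_eq _).2 fun x => ?_
  have hD := continuous_segDet hc
  have h1 : ∀ᶠ y in nhds x, ∀ t ∈ Set.Icc (0 : ℝ) 1,
      ‖segDet (c y) t / segDet (c x) t - 1‖ < 1 ∧ ‖segDet (c x) t / segDet (c y) t - 1‖ < 1 := by
    refine isCompact_Icc.eventually_forall_of_forall_eventually fun t ht => ?_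
    have h0 := segDet_ne_zero (hn x) ht
    have hD' : ContinuousAt (fun p : X × ℝ => segDet (c x) p.2) (x, t) :=
      (hD.comp ((continuous_const (y := x)).prodMk continuous_snd)).continuousAt
    have h2 : ContinuousAt (fun p : X × ℝ => ‖segDet (c p.1) p.2 / segDet (c x) p.2 - 1‖) (x, t) :=
      ((hD.continuousAt.div hD' h0).sub continuousAt_const).norm
    have h3 : ContinuousAt (fun p : X × ℝ => ‖segDet (c x) p.2 / segDet (c p.1) p.2 - 1‖) (x, t) :=
      ((hD'.div hD.continuousAt h0).sub continuousAt_const).norm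
    exact (h2.eventually_lt_const (by simp [h0])).and (h3.eventually_lt_const (by simp [h0]))
  filter_upwards [h1] with y hy
  exact propext
    ⟨fun h => h.of_near (hdet y) (hdet x) fun t ht => ⟨segDet_ne_zero (hn y) ht, (hy t ht).2⟩,
      fun h => h.of_near (hdet x) (hdet y) fun t ht => ⟨segDet_ne_zero (hn x) ht, (hy t ht).1⟩⟩

theorem commList_comm {G : Type*} [CommGroup G] (p q : Fin m → G) : commList p q = 1 := by
  induction m with
  | zero => simp [commList]
  | succ n ih => rw [commList_succ, ih]; simp

theorem coe_relVal_units (p : Fin m ⊕ Fin m → (Matrix ι ι ℂ)ˣ) :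
    (relVal p).1 = relVal fun x => (p x).1 := by
  have : (relVal p).1 = Units.coeHom _ (relVal p) := rfl
  rw [this]
  simp only [relVal, commList, map_list_prod, List.map_ofFn]
  congr 2
  funext i
  simp [Matrix.coe_units_inv]

theorem coe_relVal_unitary (u : Fin m ⊕ Fin m → Matrix.unitaryGroup ι ℂ) :
    (relVal u).1 = relVal fun x => (u x).1 := by
  have h1 := coe_relVal_units fun x => Unitary.toUnits (u x)
  rw [← map_relVal] at h1
  exact h1

theorem det_relVal (p : Fin m ⊕ Fin m → (Matrix ι ι ℂ)ˣ) : (relVal p).1.det = 1 := by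
  have h1 := map_relVal (Units.map (Matrix.detMonoidHom (n := ι) (R := ℂ))) p
  have h2 : relVal (fun x => Units.map (Matrix.detMonoidHom (n := ι) (R := ℂ)) (p x)) = 1 :=
    commList_comm _ _
  rw [h2] at h1
  exact congrArg Units.val h1

theorem continuous_nonsing_inv {X : Type} [TopologicalSpace X] {A : X → Matrix ι ι ℂ}
    (hA : Continuous A) (h : ∀ x, IsUnit (A x)) : Continuous fun x => (A x)⁻¹ := by
  simp only [Matrix.inv_def, Ring.inverse_eq_inv']
  exact (hA.matrix_det.inv₀ fun x => ((Matrix.isUnit_iff_isUnit_det _).1 (h x)).ne_zero).smul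
    hA.matrix_adjugate

theorem continuous_relVal {X : Type} [TopologicalSpace X] {p : X → Fin m ⊕ Fin m → Matrix ι ι ℂ}
    (hp : ∀ i, Continuous fun x => p x i) (h : ∀ x i, IsUnit (p x i)) :
    Continuous fun x => relVal (p x) := by
  simp only [relVal, commList, List.ofFn_eq_map]
  refine continuous_list_prod _ fun i _ => ?_
  exact (((hp _).mul (hp _)).mul (continuous_nonsing_inv (hp _) fun x => h x _)).mul
    (continuous_nonsing_inv (hp _) fun x => h x _)

theorem exists_windZero_near (m : ℕ) : ∃ η > 0, ∀ (ι : Type) [Fintype ι] [DecidableEq ι]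
    (p : Fin m ⊕ Fin m → Matrix ι ι ℂ) (u : Fin m ⊕ Fin m → Matrix.unitaryGroup ι ℂ),
    (∀ x, ‖p x - (u x).1‖ ≤ η) → ‖(relVal u).1 - 1‖ ≤ 1 / 2 →
    (WindZero (relVal p) ↔ WindZero (relVal u).1) := by
  obtain ⟨η, hη, H⟩ := exists_near_lift (surfaceRelator m) (ε := 1 / 4) (by norm_num)
  refine ⟨min η (1 / 2), by positivity, fun ι _ _ p u hp hu => ?_⟩
  let P : unitInterval → Fin m ⊕ Fin m → Matrix ι ι ℂ :=
      fun r x => (u x).1 + (r : ℝ) • (p x - (u x).1)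
  have hP : ∀ r x, ‖P r x - (u x).1‖ ≤ min η (1 / 2) := fun r x => by
    simp only [P, add_sub_cancel_left, norm_smul, Real.norm_eq_abs, abs_of_nonneg r.2.1]
    exact (mul_le_of_le_one_left (norm_nonneg _) r.2.2).trans (hp x)
  have hunit : ∀ r x, IsUnit (P r x) := fun r x =>
    isUnit_of_norm_sub_unitary (u x) (lt_of_le_of_lt ((hP r x).trans (min_le_right _ _))
      (by norm_num))
  have hval : ∀ r, relVal (P r) = (relVal fun x => (hunit r x).unit).1 := fun r => by
    rw [coe_relVal_units]; rfl
  have h0 : relVal (P 0) = (relVal u).1 := by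
    rw [coe_relVal_unitary]; congr 1; funext x; simp [P]
  have h1 : relVal (P 1) = relVal p := by congr 1; funext x; simp [P]
  rw [← h0, ← h1]
  refine windZero_iff_of_homotopy (c := fun r => relVal (P r))
    (continuous_relVal (fun i => ?_) hunit) (fun r => ?_) (fun r => ?_) 1 0
  · simp only [P]; fun_prop
  · simp only [hval]; exact det_relVal _
  · simp only [hval]
    have h2 := H ι (fun x => (hunit r x).unit) u fun x => (hP r x).trans (min_le_left _ _)
    rw [lift_surfaceRelator, lift_surfaceRelator] at h2
    have h3 := norm_sub_le_norm_sub_add_norm_sub (relVal fun x => (hunit r x).unit).1 (relVal u).1 1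
    linarith

open scoped MatrixOrder in
theorem norm_star_mul_self_sub_one_le {A B : Matrix ι ι ℂ} {δ : ℝ} (hA : ‖A‖ ≤ 1) (hB : ‖B‖ ≤ 1)
    (h : ‖B * A - 1‖ ≤ δ) : ‖star A * A - 1‖ ≤ δ * (2 + δ) := by
  have h1 : ∀ C : Matrix ι ι ℂ, ‖C‖ ≤ 1 → star C * C ≤ 1 := fun C hC => by
    rw [← CStarAlgebra.norm_le_one_iff_of_nonneg _ (star_mul_self_nonneg C),
        CStarRing.norm_star_mul_self]
    exact mul_le_one₀ hC (norm_nonneg _) hC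
  have h2 : star (B * A) * (B * A) ≤ star A * A := by
    have := star_left_conjugate_le_conjugate (h1 B hB) A
    simpa [mul_assoc] using this
  have h3 : ‖1 - star A * A‖ ≤ ‖1 - star (B * A) * (B * A)‖ :=
    CStarAlgebra.norm_le_norm_of_nonneg_of_le (sub_nonneg.2 (h1 A hA)) (sub_le_sub_left h2 1)
  rw [norm_sub_rev]
  refine h3.trans ?_
  have h4 : 1 - star (B * A) * (B * A) = -((star (B * A - 1)) * (B * A) + (B * A - 1)) := by
    rw [star_sub, star_one]; noncomm_ring
  rw [h4, norm_neg]
  have h0 : 0 ≤ δ := (norm_nonneg _).trans h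
  have h5 : ‖B * A‖ ≤ 1 + δ := norm_le_one_add_of_near (u := 1) h
  calc _ ≤ ‖star (B * A - 1)‖ * ‖B * A‖ + ‖B * A - 1‖ :=
        (norm_add_le _ _).trans (add_le_add_left (norm_mul_le _ _) _)
    _ ≤ δ * (1 + δ) + δ := by rw [norm_star]; gcongr
    _ = _ := by ring

theorem exists_unitary_near_of_star_mul_self {A : Matrix ι ι ℂ} {η : ℝ} (hη : η ≤ 1 / 2)
    (hA : ‖A‖ ≤ 1) (h : ‖star A * A - 1‖ ≤ η) :
    ∃ u : Matrix.unitaryGroup ι ℂ, ‖A - u.1‖ ≤ η := by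
  set P := star A * A with hP
  have hPs : IsSelfAdjoint P := IsSelfAdjoint.star_mul_self A
  have h0 : 0 ≤ η := (norm_nonneg _).trans h
  have hspec : ∀ x ∈ spectrum ℝ P, |x - 1| ≤ η := by
    have h1 : cfc (fun x : ℝ => x - 1) P = P - 1 := by
      rw [cfc_sub (fun x : ℝ => x) (fun _ => 1) P, cfc_id' ℝ P, cfc_const_one ℝ P]
    rw [← h1, norm_cfc_le_iff (fun x : ℝ => x - 1) P h0] at h
    exact h
  have hpos : ∀ x ∈ spectrum ℝ P, 0 < x := fun x hx => by
    have := abs_le.1 (hspec x hx); linarith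
  have hcont : ContinuousOn (fun x : ℝ => (Real.sqrt x)⁻¹) (spectrum ℝ P) :=
    Real.continuous_sqrt.continuousOn.inv₀ fun x hx => (Real.sqrt_pos.2 (hpos x hx)).ne'
  set S := cfc (fun x : ℝ => (Real.sqrt x)⁻¹) P with hS
  have hSs : star S = S := (cfc_predicate (R := ℝ) _ P).star_eq
  have hSPS : S * P * S = 1 := by
    have h1 : S * P * S = cfc (fun x : ℝ => (Real.sqrt x)⁻¹ * x * (Real.sqrt x)⁻¹) P := by
      rw [cfc_mul (fun x : ℝ => (Real.sqrt x)⁻¹ * x) (fun x : ℝ => (Real.sqrt x)⁻¹) P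
        (hcont.mul (continuousOn_id' _)) hcont, cfc_mul (fun x : ℝ =>
            (Real.sqrt x)⁻¹) (fun x : ℝ => x) P
        hcont (continuousOn_id' _), cfc_id' ℝ P]
    rw [h1, cfc_congr (g := fun _ => (1 : ℝ)) fun x hx => ?_, cfc_const_one ℝ P]
    have h2 := Real.sqrt_pos.2 (hpos x hx)
    have h3 := Real.mul_self_sqrt (hpos x hx).le
    simp only
    field_simp
    rw [sq, h3]
  have hu : A * S ∈ Matrix.unitaryGroup ι ℂ := by
    rw [Matrix.mem_unitaryGroup_iff', star_mul, hSs, ← hSPS, hP]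
    simp only [mul_assoc]
  refine ⟨⟨A * S, hu⟩, ?_⟩
  have h1 : A - A * S = A * (1 - S) := by rw [Matrix.mul_sub, Matrix.mul_one]
  have h2 : 1 - S = cfc (fun x : ℝ => 1 - (Real.sqrt x)⁻¹) P := by
    rw [cfc_sub (fun _ : ℝ => 1) _ P continuousOn_const hcont, cfc_const_one ℝ P]
  have h3 : ‖1 - S‖ ≤ η := by
    rw [h2]
    refine norm_cfc_le h0 fun x hx => ?_
    have h4 := Real.sqrt_pos.2 (hpos x hx)
    have h5 := Real.mul_self_sqrt (hpos x hx).le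
    have h6 := hspec x hx
    have h7 := abs_le.1 h6
    have h8 : 1 - (Real.sqrt x)⁻¹ = (x - 1) / (Real.sqrt x + x) := by
      have h81 : Real.sqrt x + x ≠ 0 := by have := hpos x hx; positivity
      rw [eq_div_iff h81, sub_mul, mul_add, mul_add, inv_mul_cancel₀ h4.ne']
      have h82 : (Real.sqrt x)⁻¹ * x = Real.sqrt x := by
        rw [inv_mul_eq_iff_eq_mul₀ h4.ne', h5]
      rw [h82]
      ring
    have h80 : 0 < Real.sqrt x + x := by have := hpos x hx; positivity
    rw [h8, Real.norm_eq_abs, abs_div, abs_of_pos h80, div_le_iff₀ h80]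
    have h9 : 1 ≤ Real.sqrt x + x := by
      have : (1 / 2 : ℝ) ≤ Real.sqrt x := Real.le_sqrt_of_sq_le (by linarith)
      linarith
    nlinarith
  change ‖A - A * S‖ ≤ η
  rw [h1]
  calc _ ≤ ‖A‖ * ‖1 - S‖ := norm_mul_le _ _
    _ ≤ 1 * η := by gcongr
    _ = η := one_mul η

theorem exists_unitary_near_of_almost_inverse {ε : ℝ} (hε : 0 < ε) : ∃ δ > 0,
    ∀ (ι : Type) [Fintype ι]
    [DecidableEq ι] (A B : Matrix ι ι ℂ), ‖A‖ ≤ 1 → ‖B‖ ≤ 1 → ‖B * A - 1‖ ≤ δ →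
    ∃ u : Matrix.unitaryGroup ι ℂ, ‖A - u.1‖ ≤ ε := by
  refine ⟨min 1 (min ε (1 / 2) / 3), by positivity, fun ι _ _ A B hA hB h => ?_⟩
  have h1 := norm_star_mul_self_sub_one_le hA hB h
  have h2 : min 1 (min ε (1 / 2) / 3) * (2 + min 1 (min ε (1 / 2) / 3)) ≤ min ε (1 / 2) := by
    have h3 : min 1 (min ε (1 / 2) / 3) ≤ 1 := min_le_left _ _
    have h4 : min 1 (min ε (1 / 2) / 3) ≤ min ε (1 / 2) / 3 := min_le_right _ _
    have h5 : 0 < min 1 (min ε (1 / 2) / 3) := by positivity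
    nlinarith
  obtain ⟨u, hu⟩ := exists_unitary_near_of_star_mul_self (min_le_right ε (1 / 2)) hA (h1.trans h2)
  exact ⟨u, hu.trans (min_le_left _ _)⟩

theorem segDet_conj (W : UnitaryIso ι κ) (c : Matrix ι ι ℂ) (t : ℝ) :
    segDet (W.conj c) t = segDet c t := by
  rw [segDet, segDet, ← W.det_conj]
  congr 1
  simp [UnitaryIso.conj, Matrix.mul_add, Matrix.add_mul, W.right]

theorem windZero_conj (W : UnitaryIso ι κ) (c : Matrix ι ι ℂ) :
    WindZero (W.conj c) ↔ WindZero c := by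
  simp only [WindZero, segDet_conj]

theorem windZero_conj_unitary (u : Matrix.unitaryGroup ι ℂ) (c : Matrix.unitaryGroup ι ℂ) :
    WindZero (u * c * u⁻¹).1 ↔ WindZero c.1 :=
  windZero_conj (UnitaryIso.ofUnitary u) c.1

theorem segDet_dsum_one (c : Matrix ι ι ℂ) (t : ℝ) :
    segDet (dsum c (1 : Matrix κ κ ℂ)) t = segDet c t := by
  have h : (t : ℂ) • (1 : Matrix (ι ⊕ κ) (ι ⊕ κ) ℂ) + (1 - (t : ℂ)) • dsum c (1 : Matrix κ κ ℂ) =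
      dsum ((t : ℂ) • (1 : Matrix ι ι ℂ) + (1 - (t : ℂ)) • c) (1 : Matrix κ κ ℂ) := by
    rw [← Matrix.fromBlocks_one, dsum, Matrix.fromBlocks_smul, Matrix.fromBlocks_smul,
      Matrix.fromBlocks_add, dsum]
    congr 1
    · simp
    · simp
    · rw [← add_smul]; simp
  rw [segDet, h, dsum, Matrix.det_fromBlocks_zero₂₁, Matrix.det_one, mul_one, segDet]

theorem windZero_dsum_one (c : Matrix ι ι ℂ) :
    WindZero (dsum c (1 : Matrix κ κ ℂ)) ↔ WindZero c := by
  simp only [WindZero, segDet_dsum_one]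

/-- A commuting family of Hermitian matrices is simultaneously diagonalizable. -/
theorem exists_unitary_diagonalizing_family {n : Type} [Finite n] (T : n → Matrix ι ι ℂ)
    (hT : ∀ i, (T i).IsHermitian) (hC : ∀ i j, Commute (T i) (T j)) :
    ∃ V : Matrix.unitaryGroup ι ℂ, ∀ i, ∃ d : ι → ℂ, T i * V.1 = V.1 * Matrix.diagonal d := by
  classical
  have hS : ∀ i, (Matrix.toEuclideanLin (T i)).IsSymmetric := fun i =>
    Matrix.isSymmetric_toEuclideanLin_iff.2 (hT i)
  have hP : Pairwise (Function.onFun Commute fun i => Matrix.toEuclideanLin (T i)) :=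
      fun i j _ => by
    change Matrix.toEuclideanLin (T i) * Matrix.toEuclideanLin (T j) =
      Matrix.toEuclideanLin (T j) * Matrix.toEuclideanLin (T i)
    ext x : 1
    simp only [Module.End.mul_apply, Matrix.toLpLin_apply, Matrix.mulVec_mulVec, (hC i j).eq]
  have hI := LinearMap.IsSymmetric.directSum_isInternal_of_pairwise_commute hS hP
  have hO := LinearMap.IsSymmetric.orthogonalFamily_iInf_eigenspaces hS
  have hI' := DirectSum.isInternal_ne_bot_iff.2 hI
  have hO' := hO.comp (Subtype.coe_injective
    (p := fun α : n → ℂ => (⨅ j, Module.End.eigenspace (Matrix.toEuclideanLin (T j)) (α j)) ≠ ⊥))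
  let _ := hI.submodule_iSupIndep.fintypeNeBotOfFiniteDimensional
  have hn : Module.finrank ℂ (EuclideanSpace ℂ ι) = Fintype.card ι := finrank_euclideanSpace
  let b := (hI'.subordinateOrthonormalBasis hn hO').reindex (Fintype.equivFin ι).symm
  have hb : ∀ k : ι, ∃ α : n → ℂ, ∀ i, Matrix.toEuclideanLin (T i) (b k) = α i • b k := fun k => by
    have h1 := hI'.subordinateOrthonormalBasis_subordinate hn (Fintype.equivFin ι k) hO'
    refine ⟨(hI'.subordinateOrthonormalBasisIndex hn (Fintype.equivFin ι k) hO').1, fun i => ?_⟩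
    rw [Submodule.mem_iInf] at h1
    have h2 := Module.End.mem_eigenspace_iff.1 (h1 i)
    simpa [b] using h2
  choose α hα using hb
  refine ⟨⟨(EuclideanSpace.basisFun ι ℂ).toBasis.toMatrix b,
    (EuclideanSpace.basisFun ι ℂ).toMatrix_orthonormalBasis_mem_unitary b⟩, fun i => ⟨fun k =>
        α k i, ?_⟩⟩
  ext j k
  have h1 := congrArg (fun x : EuclideanSpace ℂ ι => x j) (hα k i)
  rw [Matrix.mul_diagonal]
  simpa [Matrix.mul_apply, Matrix.toLpLin_apply, Matrix.mulVec, dotProduct,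
    Module.Basis.toMatrix_apply, mul_comm] using h1

/-- Twice the real and the imaginary part of a matrix (up to sign). -/
def hermPart (w : Matrix ι ι ℂ) (b : Bool) : Matrix ι ι ℂ :=
  if b then w + star w else Complex.I • (w - star w)

theorem isHermitian_hermPart (w : Matrix ι ι ℂ) (b : Bool) : (hermPart w b).IsHermitian := by
  rw [Matrix.IsHermitian, ← Matrix.star_eq_conjTranspose]
  cases b
  · simp only [hermPart, Bool.false_eq_true, if_false, star_smul, star_sub, star_star,
        Complex.star_def,
      Complex.conj_I]
    module
  · simp only [hermPart, if_true, star_add, star_star]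
    exact add_comm _ _

/-- Two commuting unitary matrices are simultaneously diagonalizable. -/
theorem exists_unitary_diagonalizing_pair (u v : Matrix.unitaryGroup ι ℂ) (h : Commute u.1 v.1) :
    ∃ (V : Matrix.unitaryGroup ι ℂ) (d e : ι → ℂ),
      (V⁻¹ * u * V).1 = Matrix.diagonal d ∧ (V⁻¹ * v * V).1 = Matrix.diagonal e := by
  have h1 : Commute (star u.1) v.1 := h.star_unitary_left
  have h2 : Commute u.1 (star v.1) := (Commute.star_unitary_left h.symm).symm
  have h3 : Commute (star u.1) (star v.1) := h2.star_unitary_left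
  have hu : Commute u.1 (star u.1) := ((Commute.refl u.1).star_unitary_left).symm
  have hv : Commute v.1 (star v.1) := ((Commute.refl v.1).star_unitary_left).symm
  have hH : ∀ w w' : Matrix ι ι ℂ, Commute w w' → Commute (star w) w' → Commute w (star w') →
      Commute (star w) (star w') → ∀ b b', Commute (hermPart w b) (hermPart w' b') := by
    rintro w w' a1 a2 a3 a4 (_ | _) (_ | _)
    · exact (((a1.sub_left a2).sub_right (a3.sub_left a4)).smul_left _).smul_right _
    · exact ((a1.sub_left a2).add_right (a3.sub_left a4)).smul_left _
    · exact ((a1.add_left a2).sub_right (a3.add_left a4)).smul_right _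
    · exact (a1.add_left a2).add_right (a3.add_left a4)
  obtain ⟨V, hV⟩ := exists_unitary_diagonalizing_family
    (fun p : Bool × Bool => hermPart (if p.1 then u.1 else v.1) p.2) (fun p =>
        isHermitian_hermPart _ _)
    (by
      rintro ⟨_ | _, b⟩ ⟨_ | _, b'⟩
      · exact hH _ _ (Commute.refl _) hv.symm hv (Commute.refl _) b b'
      · exact hH _ _ h.symm h2.symm h1.symm h3.symm b b'
      · exact hH _ _ h h1 h2 h3 b b'
      · exact hH _ _ (Commute.refl _) hu.symm hu (Commute.refl _) b b')
  have key : ∀ w : Matrix.unitaryGroup ι ℂ, (∃ d : ι → ℂ,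
      (w.1 + star w.1) * V.1 = V.1 * Matrix.diagonal d) →
      (∃ d : ι → ℂ, (Complex.I • (w.1 - star w.1)) * V.1 = V.1 * Matrix.diagonal d) →
      ∃ d, (V⁻¹ * w * V).1 = Matrix.diagonal d := by
    rintro w ⟨d, hd⟩ ⟨e, he⟩
    refine ⟨fun k => (1 / 2) * d k - Complex.I / 2 * e k, ?_⟩
    have h5 : Matrix.diagonal (fun k => (1 / 2) * d k - Complex.I / 2 * e k) =
        (1 / 2 : ℂ) • Matrix.diagonal d - (Complex.I / 2) • Matrix.diagonal e := by
      ext j k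
      by_cases hjk : j = k <;> simp [hjk]
    have h6 : w.1 * V.1 = (1 / 2 : ℂ) • ((w.1 + star w.1) * V.1) -
        (Complex.I / 2) • ((Complex.I • (w.1 - star w.1)) * V.1) := by
      have h7 : w.1 = (1 / 2 : ℂ) • (w.1 + star w.1) - (Complex.I / 2) • (Complex.I • (w.1 - star
          w.1)) := by
        rw [smul_smul, div_mul_eq_mul_div, Complex.I_mul_I]
        module
      conv_lhs => rw [h7]
      rw [Matrix.sub_mul, Matrix.smul_mul, Matrix.smul_mul]
    have h8 : (V⁻¹).1 * V.1 = 1 := Unitary.coe_star_mul_self V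
    change (V⁻¹).1 * w.1 * V.1 = _
    rw [Matrix.mul_assoc, h6, hd, he, h5, Matrix.mul_sub, Matrix.mul_smul, Matrix.mul_smul,
      ← Matrix.mul_assoc, ← Matrix.mul_assoc, h8, Matrix.one_mul, Matrix.one_mul]
  obtain ⟨d, hd⟩ := key u (hV (true, true)) (hV (true, false))
  obtain ⟨e, he⟩ := key v (hV (false, true)) (hV (false, false))
  exact ⟨V, d, e, hd, he⟩

/-- The Schatten-type energy `Re tr (2 - c - c*)^(p+1)` of a unitary matrix `c`. -/
def energy (p : ℕ) (c : Matrix ι ι ℂ) : ℝ :=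
  ((1 - c + (1 - star c)) ^ (p + 1)).trace.re

theorem continuous_energy (p : ℕ) : Continuous (energy p : Matrix ι ι ℂ → ℝ) := by
  unfold energy
  refine Complex.continuous_re.comp (Continuous.matrix_trace ?_)
  fun_prop

theorem hasDerivAt_energy (p : ℕ) {c : ℝ → Matrix ι ι ℂ} {c' : Matrix ι ι ℂ} {s : ℝ}
    (h : HasDerivAt c c' s) : HasDerivAt (fun s => energy p (c s))
      ((p + 1) * ((1 - c s + (1 - star (c s))) ^ p * (-c' + -star c')).trace.re) s := by
  have h1 : HasDerivAt (fun s => 1 - c s + (1 - star (c s))) (-c' + -star c') s :=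
    (h.const_sub 1).add (h.star.const_sub 1)
  have h2 := h1.pow' (p + 1)
  have h3 := (Matrix.traceLinearMap ι ℝ ℂ).toContinuousLinearMap.hasFDerivAt.comp_hasDerivAt s h2
  have h4 := Complex.reCLM.hasFDerivAt.comp_hasDerivAt s h3
  refine h4.congr_deriv ?_
  change Complex.re (Matrix.trace (R := ℂ) (∑ i ∈ _, _)) = _
  rw [Matrix.trace_sum, Complex.re_sum]
  rw [Finset.sum_congr rfl (g := fun _ =>
    ((1 - c s + (1 - star (c s))) ^ p * (-c' + -star c')).trace.re) fun i hi => ?_]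
  · simp
  · rw [Matrix.trace_mul_comm, ← Matrix.mul_assoc, ← pow_add, Nat.pred_succ,
      Nat.add_sub_cancel' (Nat.lt_succ_iff.1 (Finset.mem_range.1 hi))]

/-- At a local minimum of the energy of the commutator, a function of the commutator commutes
with the second unitary. -/
theorem commute_of_isLocalMin_energy {p : ℕ} {t z : Matrix.unitaryGroup ι ℂ}
    (hmin : IsLocalMin (fun s : Matrix.unitaryGroup ι ℂ => energy p (s * z * s⁻¹ * z⁻¹).1) t) :
    ∀ c : Matrix.unitaryGroup ι ℂ, c = t * z * t⁻¹ * z⁻¹ →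
      Commute ((1 - c.1 + (1 - star c.1)) ^ p * (c.1 - star c.1)) z.1 := by
  intro c hc
  set N : Matrix ι ι ℂ := (1 - c.1 + (1 - star c.1)) ^ p with hN
  set W : Matrix ι ι ℂ := N * (c.1 - star c.1) with hW
  set Q : Matrix ι ι ℂ := W - star z.1 * W * z.1 with hQ
  have hcc : Commute c.1 (star c.1) := ((Commute.refl c.1).star_unitary_left).symm
  have hNc : Commute N c.1 :=
    (((Commute.one_left _).sub_left (Commute.refl _)).add_left
      ((Commute.one_left _).sub_left hcc.symm)).pow_left p
  have hNc' : Commute N (star c.1) :=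
    (((Commute.one_left _).sub_left hcc).add_left
      ((Commute.one_left _).sub_left (Commute.refl _))).pow_left p
  have hNs : star N = N := by
    rw [hN, star_pow, star_add, star_sub, star_sub, star_one, star_star, add_comm]
  have hWs : star W = -W := by
    rw [hW, star_mul, hNs, star_sub, star_star, Matrix.mul_sub, Matrix.sub_mul, hNc.eq, hNc'.eq,
        neg_sub]
  have hQs : star Q = -Q := by
    rw [hQ, star_sub, star_mul (star z.1 * W) z.1, star_mul (star z.1) W, star_star, hWs]
    noncomm_ring
  have hexp : ∀ s : ℝ, NormedSpace.exp (s • Q) ∈ unitary (Matrix ι ι ℂ) := fun s => by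
    have h1 : star (NormedSpace.exp (s • Q)) = (NormedSpace.exp (s • Q))⁻¹ := by
      rw [Matrix.star_eq_conjTranspose, ← Matrix.exp_conjTranspose, ← Matrix.star_eq_conjTranspose,
        star_smul, hQs, star_trivial, smul_neg, Matrix.exp_neg]
    have h2 := (Matrix.isUnit_iff_isUnit_det _).1 (Matrix.isUnit_exp (s • Q))
    exact ⟨by rw [h1, Matrix.nonsing_inv_mul _ h2], by rw [h1, Matrix.mul_nonsing_inv _ h2]⟩
  let e : ℝ → Matrix.unitaryGroup ι ℂ := fun s => ⟨NormedSpace.exp (s • Q), hexp s⟩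
  have hd : HasDerivAt (fun s : ℝ => (e s).1) Q 0 := by
    have := hasDerivAt_exp_smul_const (𝕂 := ℝ) Q (0 : ℝ)
    simpa using this
  have he0 : e 0 = 1 := Subtype.ext (by simp [e])
  have hd2 : HasDerivAt (fun s : ℝ => ((e s)⁻¹).1) (-Q) 0 := by
    have := hd.star
    rwa [hQs] at this
  let B : Matrix ι ι ℂ := (t * z * t⁻¹).1
  have hcs : ∀ s, (e s * t * z * (e s * t)⁻¹ * z⁻¹).1 = (e s).1 * B * ((e s)⁻¹).1 * (z⁻¹).1 :=
      fun s => by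
    rw [show e s * t * z * (e s * t)⁻¹ * z⁻¹ = e s * (t * z * t⁻¹) * (e s)⁻¹ * z⁻¹ by group]
    rfl
  have hd3 : HasDerivAt (fun s => (e s * t * z * (e s * t)⁻¹ * z⁻¹).1)
      ((Q * B + B * -Q) * (z⁻¹).1) 0 := by
    have := ((hd.mul_const B).mul hd2).mul_const (z⁻¹).1
    simp only [hcs]
    refine this.congr_deriv ?_
    rw [he0, inv_one]
    change (Q * B * 1 + 1 * B * -Q) * _ = _
    rw [Matrix.mul_one, Matrix.one_mul]
  have hloc : IsLocalMin (fun s : ℝ => energy p (e s * t * z * (e s * t)⁻¹ * z⁻¹).1) 0 := by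
    have hcont : ContinuousAt (fun s : ℝ => e s * t) 0 := by
      refine ContinuousAt.mul ?_ continuousAt_const
      exact Topology.IsInducing.subtypeVal.continuousAt_iff.2 hd.continuousAt
    have h1 : Filter.Tendsto (fun s : ℝ => e s * t) (nhds 0) (nhds t) := by
      have := hcont.tendsto
      rwa [he0, one_mul] at this
    have h2 := h1.eventually hmin
    refine h2.mono fun s hs => ?_
    simpa only [he0, one_mul] using hs
  have hzero := hloc.hasDerivAt_eq_zero (hasDerivAt_energy p hd3)
  simp only [he0, one_mul, ← hc] at hzero
  rw [← hN] at hzero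
  have hp : ((p : ℝ) + 1) ≠ 0 := by positivity
  replace hzero := (mul_eq_zero.1 hzero).resolve_left hp
  have hzz : (z⁻¹).1 * z.1 = 1 := Unitary.coe_star_mul_self z
  have hzs : (z⁻¹).1 = star z.1 := rfl
  have hB : B = c.1 * z.1 := by
    rw [hc]
    change B = B * (z⁻¹).1 * z.1
    rw [Matrix.mul_assoc, hzz, Matrix.mul_one]
  have hBz : B * star z.1 = c.1 := by rw [hc]; rfl
  have hBz' : z.1 * star B = star c.1 := by rw [← hBz, star_mul, star_star]
  have hBs : star B = star z.1 * star c.1 := by rw [hB, star_mul]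
  have hQQ : (star Q * Q).trace.re = 0 := by
    have h1 : (N * (-((Q * B + B * -Q) * (z⁻¹).1) + -star ((Q * B + B * -Q) * (z⁻¹).1))).trace =
        (star Q * Q).trace := by
      have h2 : -((Q * B + B * -Q) * (z⁻¹).1) + -star ((Q * B + B * -Q) * (z⁻¹).1) =
          -(Q * c.1) + c.1 * (z.1 * (Q * star z.1)) + star c.1 * Q -
            z.1 * (Q * (star z.1 * star c.1)) := by
        rw [hzs, star_mul, star_add, star_mul, star_mul, star_neg, hQs, star_star, ← hBs,
          ← Matrix.mul_assoc c.1, ← hB, ← hBz', ← hBz]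
        noncomm_ring
      have h3 : (N * (-(Q * c.1) + c.1 * (z.1 * (Q * star z.1)) + star c.1 * Q -
            z.1 * (Q * (star z.1 * star c.1)))).trace =
          -(Q * (N * c.1)).trace + (Q * (star z.1 * (N * c.1) * z.1)).trace +
            (Q * (N * star c.1)).trace - (Q * (star z.1 * (N * star c.1) * z.1)).trace := by
        rw [Matrix.mul_sub, Matrix.mul_add, Matrix.mul_add, Matrix.trace_sub, Matrix.trace_add,
          Matrix.trace_add, Matrix.mul_neg, Matrix.trace_neg]
        congr 1
        · congr 1
          · congr 1
            · rw [Matrix.trace_mul_comm, Matrix.mul_assoc, hNc.eq]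
            · rw [show N * (c.1 * (z.1 * (Q * star z.1))) = (N * c.1 * z.1) * (Q * star z.1) by
                simp only [Matrix.mul_assoc], Matrix.trace_mul_comm]
              simp only [Matrix.mul_assoc]
          · rw [← Matrix.mul_assoc, Matrix.trace_mul_comm]
        · rw [hNc'.eq, show N * (z.1 * (Q * (star z.1 * star c.1))) =
            (N * z.1) * (Q * (star z.1 * star c.1)) by
              simp only [Matrix.mul_assoc], Matrix.trace_mul_comm]
          simp only [Matrix.mul_assoc]
      rw [h2, h3, hQs, Matrix.neg_mul, Matrix.trace_neg]
      conv_rhs => rw [show Q * Q = Q * (N * c.1) - Q * (star z.1 * (N * c.1) * z.1) -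
        Q * (N * star c.1) + Q * (star z.1 * (N * star c.1) * z.1) by
          nth_rewrite 2 [hQ]; rw [hW]; noncomm_ring]
      rw [Matrix.trace_add, Matrix.trace_sub, Matrix.trace_sub]
      ring
    rw [← h1]
    exact hzero
  have hQ0 : Q = 0 := by
    rw [Matrix.star_eq_conjTranspose] at hQQ
    have h1 := (Complex.nonneg_iff.1 (Matrix.posSemidef_conjTranspose_mul_self Q).trace_nonneg).2
    exact Matrix.trace_conjTranspose_mul_self_eq_zero_iff.1 (Complex.ext hQQ h1.symm)
  rw [hQ, sub_eq_zero] at hQ0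
  have hzz' : z.1 * star z.1 = 1 := Unitary.coe_mul_star_self z
  change W * z.1 = z.1 * W
  conv_rhs => rw [hQ0, ← Matrix.mul_assoc, ← Matrix.mul_assoc, hzz', Matrix.one_mul]

theorem injOn_energy_gradient (p : ℕ) : Set.InjOn
    (fun x : ℂ => (1 - x + (1 - star x)) ^ p * (x - star x)) {x | ‖x‖ = 1 ∧ ‖x - 1‖ < 1} := by
  have key : ∀ x : ℂ, (1 - x + (1 - star x)) ^ p * (x - star x) =
      (((2 - 2 * x.re) ^ p * (2 * x.im) : ℝ) : ℂ) * Complex.I := fun x => by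
    have h1 : 1 - x + (1 - star x) = ((2 - 2 * x.re : ℝ) : ℂ) := by
      apply Complex.ext <;> simp
      ring
    have h2 : x - star x = ((2 * x.im : ℝ) : ℂ) * Complex.I := by
      apply Complex.ext <;> simp
      ring
    rw [h1, h2]
    push_cast
    ring
  have hsq : ∀ x : ℂ, ‖x‖ = 1 → x.re ^ 2 + x.im ^ 2 = 1 := fun x hx => by
    have := Complex.sq_norm x
    rw [hx, Complex.normSq_apply] at this
    linarith
  have hre : ∀ x : ℂ, ‖x‖ = 1 → ‖x - 1‖ < 1 → 1 / 2 < x.re ∧ x.re ≤ 1 := fun x hx hx1 => by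
    have h1 := Complex.sq_norm (x - 1)
    rw [Complex.normSq_apply] at h1
    simp only [Complex.sub_re, Complex.one_re, Complex.sub_im, Complex.one_im] at h1
    have h2 := hsq x hx
    have h3 : ‖x - 1‖ ^ 2 < 1 := by nlinarith [norm_nonneg (x - 1)]
    exact ⟨by nlinarith, by nlinarith [sq_nonneg x.im]⟩
  have mono : ∀ x y : ℂ, ‖x‖ = 1 → ‖x - 1‖ < 1 → ‖y‖ = 1 → ‖y - 1‖ < 1 →
      (2 - 2 * x.re) ^ p * (2 * x.im) = (2 - 2 * y.re) ^ p * (2 * y.im) → y.re ≤ x.re := by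
    intro x y hx hx1 hy hy1 h
    by_contra! hlt
    have h1 := hre x hx hx1
    have h2 := hre y hy hy1
    have h3 : ((2 - 2 * x.re) ^ p) ^ 2 * x.im ^ 2 = ((2 - 2 * y.re) ^ p) ^ 2 * y.im ^ 2 := by
      have := congrArg (fun r => (r / 2) ^ 2) h
      nlinarith
    have h4 : y.im ^ 2 < x.im ^ 2 := by nlinarith [hsq x hx, hsq y hy]
    have h5 : (2 - 2 * y.re) ^ p ≤ (2 - 2 * x.re) ^ p := by gcongr; linarith
    have h6 : 0 ≤ (2 - 2 * y.re) ^ p := pow_nonneg (by linarith) p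
    have h7 : 0 < (2 - 2 * x.re) ^ p := pow_pos (by linarith) p
    have h8 : ((2 - 2 * y.re) ^ p) ^ 2 ≤ ((2 - 2 * x.re) ^ p) ^ 2 := by gcongr
    nlinarith [sq_nonneg y.im, pow_pos h7 2]
  rintro x ⟨hx, hx1⟩ y ⟨hy, hy1⟩ hxy
  simp only [key] at hxy
  have h1 := Complex.ofReal_injective (mul_right_cancel₀ Complex.I_ne_zero hxy)
  have h2 : x.re = y.re := le_antisymm (mono y x hy hy1 hx hx1 h1.symm) (mono x y hx hx1 hy hy1 h1)
  have h3 := hsq x hx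
  have h4 := hsq y hy
  refine Complex.ext h2 ?_
  rcases (hre x hx hx1).2.eq_or_lt with h5 | h5
  · rw [h5] at h3
    rw [← h2, h5] at h4
    have h6 : x.im = 0 := by nlinarith
    have h7 : y.im = 0 := by nlinarith
    rw [h6, h7]
  · rw [← h2] at h1
    have h6 := mul_left_cancel₀ (pow_pos (show 0 < 2 - 2 * x.re by linarith) p).ne' h1
    linarith

theorem norm_spectrum_sub_one_le (c : Matrix.unitaryGroup ι ℂ) {x : ℂ} (hx : x ∈ spectrum ℂ c.1) :
    ‖x - 1‖ ≤ ‖c.1 - 1‖ := by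
  have hn : IsStarNormal c.1 := ⟨(Commute.refl c.1).star_unitary_left⟩
  have h1 : cfc (fun x : ℂ => x - 1) c.1 = c.1 - 1 := by
    rw [cfc_sub (fun x : ℂ => x) (fun _ => 1) c.1, cfc_id' ℂ c.1, cfc_const_one ℂ c.1]
  rw [← h1]
  exact norm_apply_le_norm_cfc (fun x : ℂ => x - 1) c.1 hx

theorem commute_of_commute_energy_gradient {p : ℕ} {c z : Matrix.unitaryGroup ι ℂ}
    (hc : ‖c.1 - 1‖ < 1) (h : Commute ((1 - c.1 + (1 - star c.1)) ^ p * (c.1 - star c.1)) z.1) :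
    Commute c.1 z.1 := by
  have hn : IsStarNormal c.1 := ⟨(Commute.refl c.1).star_unitary_left⟩
  set ψ : ℂ → ℂ := fun x => (1 - x + (1 - star x)) ^ p * (x - star x) with hψ
  set W := (1 - c.1 + (1 - star c.1)) ^ p * (c.1 - star c.1) with hW
  have hcont : ∀ f : ℂ → ℂ, ContinuousOn f (spectrum ℂ c.1) := continuousOn_spectrum c.1
  have hWc : cfc ψ c.1 = W := by
    rw [hψ, cfc_mul (fun x : ℂ => (1 - x + (1 - star x)) ^ p) (fun x : ℂ =>
        x - star x) c.1 (hcont _)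
      (hcont _), cfc_pow (fun x : ℂ => 1 - x + (1 - star x)) p c.1 (hcont _),
      cfc_add c.1 (fun x : ℂ => 1 - x) (fun x : ℂ => 1 - star x) (hcont _) (hcont _),
      cfc_sub (fun _ : ℂ => 1) (fun x : ℂ => x) c.1 (hcont _) (hcont _),
      cfc_sub (fun _ : ℂ => 1) (fun x : ℂ => star x) c.1 (hcont _) (hcont _),
      cfc_sub (fun x : ℂ => x) (fun x : ℂ => star x) c.1 (hcont _) (hcont _),
      cfc_star_id (R := ℂ) c.1, cfc_id' ℂ c.1, cfc_const_one ℂ c.1]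
  have hinj : Set.InjOn ψ (spectrum ℂ c.1) := by
    refine Set.InjOn.mono (fun x hx => ?_) (injOn_energy_gradient p)
    exact ⟨by simpa using spectrum.subset_circle_of_unitary c.2 hx,
      (norm_spectrum_sub_one_le c hx).trans_lt hc⟩
  have hcW : cfc (Function.invFunOn ψ (spectrum ℂ c.1)) W = c.1 := by
    rw [← hWc, ← cfc_comp _ ψ c.1 hn ((c.1.finite_spectrum.image ψ).continuousOn _) (hcont _),
      cfc_congr (f := Function.invFunOn ψ (spectrum ℂ c.1) ∘ ψ) (g :=
          fun x => x) fun x hx => hinj.leftInvOn_invFunOn hx, cfc_id' ℂ c.1]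
  have hWn : Commute (star W) z.1 := by
    have h1 : star W = cfc (fun x => star (ψ x)) c.1 := by rw [← hWc, cfc_star]
    have h2 : (fun x => star (ψ x)) = fun x => -ψ x := by
      funext x
      simp only [hψ, star_mul', star_pow, star_add, star_sub, star_one, star_star]
      ring
    rw [h1, h2, cfc_neg, hWc]
    exact h.neg_left
  rw [← hcW]
  exact Commute.cfc h hWn _

/-- The angle in `[0, 2π)` from `q` to `z`. -/
def angleFrom (q z : ℂ) : ℝ := toIcoMod Real.two_pi_pos 0 (Complex.arg (z / q))

theorem angleFrom_nonneg (q z : ℂ) : 0 ≤ angleFrom q z := left_le_toIcoMod _ _ _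

theorem angleFrom_lt (q z : ℂ) : angleFrom q z < 2 * Real.pi := by
  simpa only [angleFrom, zero_add] using toIcoMod_lt_right Real.two_pi_pos 0 (Complex.arg (z / q))

theorem angleFrom_self {q : ℂ} (hq : q ≠ 0) : angleFrom q q = 0 := by
  simp [angleFrom, div_self hq]

theorem mul_exp_angleFrom {q z : ℂ} (hq : ‖q‖ = 1) (hz : ‖z‖ = 1) :
    q * Complex.exp (angleFrom q z * Complex.I) = z := by
  have hq0 : q ≠ 0 := fun h => by simp [h] at hq
  have h1 : (angleFrom q z : ℂ) * Complex.I = Complex.arg (z / q) * Complex.I -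
      (toIcoDiv Real.two_pi_pos 0 (Complex.arg (z / q)) : ℤ) * (2 * Real.pi * Complex.I) := by
    rw [angleFrom, toIcoMod]
    push_cast
    simp
    ring
  have h2 := Complex.norm_mul_exp_arg_mul_I (z / q)
  rw [norm_div, hq, hz, div_one, Complex.ofReal_one, one_mul] at h2
  rw [h1, Complex.exp_sub, Complex.exp_int_mul_two_pi_mul_I, div_one, h2, mul_div_cancel₀ _ hq0]

/-- If rotating a configuration of points on the circle by small angles of total zero permutes the
configuration, then some point moving backwards crosses the final position of a point moving
    forwards. -/
theorem exists_crossing {a a' : ι → ℂ} {y : ι → ℝ} (ha : ∀ i, ‖a i‖ = 1)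
    (ha' : ∀ i, a' i = a i * Complex.exp (y i * Complex.I))
    (hmap : Finset.univ.val.map a = Finset.univ.val.map a') (hy : ∑ i,
        y i = 0) {j : ι} (hj : 0 < y j) :
    ∃ k s, y k ≤ s ∧ s < 0 ∧ a' k = a' j * Complex.exp ((s : ℝ) * Complex.I) := by
  have hn' : ∀ i, ‖a' i‖ = 1 := fun i => by
    rw [ha', norm_mul, ha, Complex.norm_exp_ofReal_mul_I, one_mul]
  set q := a' j with hq
  have hq0 : q ≠ 0 := fun h => by
    have := hn' j
    rw [← hq, h, norm_zero] at this
    exact zero_ne_one this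
  have hsum : ∑ i, angleFrom q (a i) = ∑ i, angleFrom q (a' i) := by
    have := congrArg (fun s => (s.map (angleFrom q)).sum) hmap
    rw [Multiset.map_map, Multiset.map_map] at this
    exact this
  have hw : ∀ i, ∃ w : ℤ, angleFrom q (a i) + y i = angleFrom q (a' i) + w * (2 * Real.pi) :=
      fun i => by
    have h1 := mul_exp_angleFrom (hn' j) (hn' i)
    rw [ha' i] at h1
    nth_rewrite 2 [← mul_exp_angleFrom (hn' j) (ha i)] at h1
    rw [mul_assoc, ← Complex.exp_add, ← ha' i] at h1
    obtain ⟨w, hw⟩ := Complex.exp_eq_exp_iff_exists_int.1 (mul_left_cancel₀ hq0 h1)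
    refine ⟨-w, ?_⟩
    have h2 : ((angleFrom q (a' i) : ℝ) : ℂ) = ((angleFrom q (a i) + y i + w * (2 * Real.pi) : ℝ) :
        ℂ) := by
      apply mul_right_cancel₀ Complex.I_ne_zero
      push_cast
      rw [hw]
      ring
    have h3 := Complex.ofReal_injective h2
    rw [h3]
    push_cast
    ring
  choose w hw using hw
  have hw0 : ∑ i, w i = 0 := by
    have h1 := Finset.sum_congr rfl fun i (_ : i ∈ Finset.univ) => hw i
    rw [Finset.sum_add_distrib, Finset.sum_add_distrib, hsum, hy, ← Finset.sum_mul] at h1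
    have h2 : (∑ i, (w i : ℝ)) * (2 * Real.pi) = 0 := by linarith
    have h3 := (mul_eq_zero.1 h2).resolve_right Real.two_pi_pos.ne'
    exact_mod_cast h3
  have hwj : 0 < w j := by
    have h1 := hw j
    rw [← hq, angleFrom_self hq0, zero_add] at h1
    have h2 := angleFrom_nonneg q (a j)
    by_contra! h3
    have h4 : (w j : ℝ) ≤ 0 := by exact_mod_cast h3
    nlinarith [Real.two_pi_pos]
  obtain ⟨k, hk⟩ : ∃ k, w k < 0 := by
    by_contra! h
    have := Finset.single_le_sum (fun i _ => h i) (Finset.mem_univ j)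
    omega
  refine ⟨k, angleFrom q (a' k) - 2 * Real.pi, ?_, by linarith [angleFrom_lt q (a' k)], ?_⟩
  · have h1 := hw k
    have h2 : (w k : ℝ) ≤ -1 := by exact_mod_cast Int.le_sub_one_of_lt hk
    nlinarith [Real.two_pi_pos, angleFrom_nonneg q (a k)]
  · push_cast
    rw [sub_mul, Complex.exp_sub, Complex.exp_two_pi_mul_I, div_one,
        mul_exp_angleFrom (hn' j) (hn' k)]

/-- Moving two angles towards each other decreases the energy. -/
theorem energy_pair_lt (p : ℕ) {a b s : ℝ} (ha : a ≤ Real.pi / 2) (hb : -(Real.pi / 2) ≤ b)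
    (ha0 : 0 < a) (hbs : b ≤ s) (hs : s < 0) :
    (2 - 2 * Real.cos (a + s)) ^ (p + 1) + (2 - 2 * Real.cos (b - s)) ^ (p + 1) <
      (2 - 2 * Real.cos a) ^ (p + 1) + (2 - 2 * Real.cos b) ^ (p + 1) := by
  have key : ∀ t ∈ Set.Ioo (0 : ℝ) 1, (2 - 2 * Real.cos (t * a + (1 - t) * b)) ^ (p + 1) <
      t * (2 - 2 * Real.cos a) ^ (p + 1) + (1 - t) * (2 - 2 * Real.cos b) ^ (p + 1) := by
    rintro t ⟨ht0, ht1⟩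
    have h1 := strictConcaveOn_cos_Icc.2 (x := a) ⟨by linarith, ha⟩ (y := b) ⟨hb, by linarith⟩
      (by linarith) ht0 (show 0 < 1 - t by linarith) (by ring)
    simp only [smul_eq_mul] at h1
    have h2 : 2 - 2 * Real.cos (t * a + (1 - t) * b) <
        t * (2 - 2 * Real.cos a) + (1 - t) * (2 - 2 * Real.cos b) := by linarith
    have hA : 0 ≤ 2 - 2 * Real.cos a := by linarith [Real.cos_le_one a]
    have hB : 0 ≤ 2 - 2 * Real.cos b := by linarith [Real.cos_le_one b]
    have hC : 0 ≤ 2 - 2 * Real.cos (t * a + (1 - t) * b) := by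
      linarith [Real.cos_le_one (t * a + (1 - t) * b)]
    have h3 := pow_lt_pow_left₀ h2 hC (Nat.succ_ne_zero p)
    have h4 := (convexOn_pow (𝕜 := ℝ) (p + 1)).2 hA hB ht0.le (show 0 ≤ 1 - t by linarith) (by ring)
    simp only [smul_eq_mul] at h4
    exact h3.trans_le h4
  have hab : 0 < a - b := by linarith
  have h1 := key ((a + s - b) / (a - b)) ⟨div_pos (by linarith) hab,
      (div_lt_one hab).2 (by linarith)⟩
  have h2 := key (-s / (a - b)) ⟨div_pos (by linarith) hab, (div_lt_one hab).2 (by linarith)⟩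
  have e1 : (a + s - b) / (a - b) * a + (1 - (a + s - b) / (a - b)) * b = a + s := by
    field_simp
    ring
  have e2 : -s / (a - b) * a + (1 - -s / (a - b)) * b = b - s := by
    field_simp
    ring
  have e3 : -s / (a - b) = 1 - (a + s - b) / (a - b) := by
    field_simp
    ring
  rw [e1] at h1
  rw [e2, e3] at h2
  linarith

/-- The diagonal unitary with the given angles. -/
def phaseDiag (y : ι → ℝ) : Matrix ι ι ℂ := Matrix.diagonal fun i => Complex.exp (y i * Complex.I)

theorem norm_exp_sub_one_sq (y : ℝ) :
    ‖Complex.exp (y * Complex.I) - 1‖ ^ 2 = 2 - 2 * Real.cos y := by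
  rw [← Complex.normSq_eq_norm_sq, Complex.normSq_apply]
  simp only [Complex.sub_re, Complex.sub_im, Complex.exp_ofReal_mul_I_re,
      Complex.exp_ofReal_mul_I_im,
    Complex.one_re, Complex.one_im]
  nlinarith [Real.sin_sq_add_cos_sq y]

theorem norm_diagonal_sub_le {a b : ι → ℂ} {r : ℝ} (hr : 0 ≤ r) :
    ‖(Matrix.diagonal a - Matrix.diagonal b : Matrix ι ι ℂ)‖ ≤ r ↔ ∀ i, ‖a i - b i‖ ≤ r := by
  rw [Matrix.diagonal_sub, Matrix.l2_opNorm_diagonal, pi_norm_le_iff_of_nonneg hr]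

theorem norm_phaseDiag_sub_one_le {y : ι → ℝ} {r : ℝ} (hr : 0 ≤ r) :
    ‖phaseDiag y - 1‖ ≤ r ↔ ∀ i, 2 - 2 * Real.cos (y i) ≤ r ^ 2 := by
  rw [phaseDiag, ← Matrix.diagonal_one, norm_diagonal_sub_le hr]
  refine forall_congr' fun i => ?_
  rw [← norm_exp_sub_one_sq, sq_le_sq₀ (norm_nonneg _) hr]

theorem energy_phaseDiag (p : ℕ) (y : ι → ℝ) :
    energy p (phaseDiag y) = ∑ i, (2 - 2 * Real.cos (y i)) ^ (p + 1) := by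
  have h1 : 1 - phaseDiag y + (1 - star (phaseDiag y)) =
      Matrix.diagonal fun i => ((2 - 2 * Real.cos (y i) : ℝ) : ℂ) := by
    rw [phaseDiag, Matrix.star_eq_conjTranspose, Matrix.diagonal_conjTranspose,
        ← Matrix.diagonal_one,
      Matrix.diagonal_sub, Matrix.diagonal_sub, Matrix.diagonal_add]
    congr 1
    funext i
    apply Complex.ext
    · simp only [Complex.add_re, Complex.sub_re, Complex.one_re, Pi.star_apply, Complex.star_def,
        Complex.conj_re, Complex.exp_ofReal_mul_I_re, Complex.ofReal_re]
      ring
    · simp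
  rw [energy, h1, Matrix.diagonal_pow, Matrix.trace_diagonal, Complex.re_sum]
  refine Finset.sum_congr rfl fun i _ => ?_
  rw [Pi.pow_apply, ← Complex.ofReal_pow, Complex.ofReal_re]

theorem energy_conj (p : ℕ) (V c : Matrix.unitaryGroup ι ℂ) :
    energy p (V * c * V⁻¹).1 = energy p c.1 := by
  have h1 : V.1 * star V.1 = 1 := Unitary.coe_mul_star_self V
  have h2 : star V.1 * V.1 = 1 := Unitary.coe_star_mul_self V
  have e1 : (V * c * V⁻¹).1 = V.1 * c.1 * star V.1 := rfl
  have h3 : 1 - (V * c * V⁻¹).1 + (1 - star (V * c * V⁻¹).1) =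
      V.1 * (1 - c.1 + (1 - star c.1)) * star V.1 := by
    rw [e1, star_mul (V.1 * c.1) (star V.1), star_mul V.1 c.1, star_star, mul_add, add_mul, mul_sub,
      mul_sub, sub_mul, sub_mul, mul_one, h1, mul_assoc V.1 (star c.1)]
  have h4 : ∀ (X : Matrix ι ι ℂ) (k : ℕ), (V.1 * X * star V.1) ^ (k + 1) = V.1 * X ^ (k + 1) * star
      V.1 := by
    intro X k
    induction k with
    | zero => simp
    | succ k ih =>
      rw [pow_succ, ih, pow_succ X (k + 1)]
      calc V.1 * X ^ (k + 1) * star V.1 * (V.1 * X * star V.1) =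
          V.1 * X ^ (k + 1) * (star V.1 * V.1) * X * star V.1 := by simp only [mul_assoc]
        _ = _ := by rw [h2, mul_one]; simp only [mul_assoc]
  rw [energy, h3, h4, Matrix.trace_mul_cycle, h2, one_mul, energy]

/-- Angles of a diagonal unitary matrix. -/
theorem exists_angles {w : Matrix.unitaryGroup ι ℂ} {d : ι → ℂ} (h : w.1 = Matrix.diagonal d) :
    (∀ i, ‖d i‖ = 1) ∧ w.1 = phaseDiag fun i => (d i).arg := by
  have h1 : ∀ i, ‖d i‖ = 1 := fun i => by
    have h2 : star w.1 * w.1 = 1 := Unitary.coe_star_mul_self w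
    rw [h, Matrix.star_eq_conjTranspose, Matrix.diagonal_conjTranspose,
        Matrix.diagonal_mul_diagonal,
      ← Matrix.diagonal_one] at h2
    have h3 := congrFun (Matrix.diagonal_injective h2) i
    have h4 := congrArg norm h3
    simp only [Pi.star_apply, norm_mul, norm_star, norm_one] at h4
    nlinarith [norm_nonneg (d i)]
  refine ⟨h1, ?_⟩
  rw [h, phaseDiag]
  congr 1
  funext i
  have := Complex.norm_mul_exp_arg_mul_I (d i)
  rw [h1 i, Complex.ofReal_one, one_mul] at this
  exact this.symm

theorem exists_phaseDiag (c : Matrix.unitaryGroup ι ℂ) :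
    ∃ (V w : Matrix.unitaryGroup ι ℂ) (y : ι → ℝ), c = V * w * V⁻¹ ∧ w.1 = phaseDiag y := by
  obtain ⟨V, d, -, h, -⟩ := exists_unitary_diagonalizing_pair c c (Commute.refl _)
  exact ⟨V, _, _, by group, (exists_angles h).2⟩

theorem norm_conj_unitary_sub_one (V w : Matrix.unitaryGroup ι ℂ) :
    ‖(V * w * V⁻¹).1 - 1‖ = ‖w.1 - 1‖ := by
  have h2 := norm_mul_sub_mul_left V (w * V⁻¹) (V⁻¹)
  have h3 := norm_mul_sub_mul_right (V⁻¹) w 1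
  rw [← mul_assoc, mul_inv_cancel] at h2
  rw [one_mul] at h3
  exact h2.trans h3

theorem energy_le_card_mul (p : ℕ) (c : Matrix.unitaryGroup ι ℂ) :
    energy p c.1 ≤ Fintype.card ι * (‖c.1 - 1‖ ^ 2) ^ (p + 1) := by
  obtain ⟨V, w, y, rfl, hy⟩ := exists_phaseDiag c
  rw [energy_conj, hy, energy_phaseDiag]
  have h1 : ‖(V * w * V⁻¹).1 - 1‖ = ‖phaseDiag y - 1‖ := by rw [norm_conj_unitary_sub_one, hy]
  rw [h1]
  have h2 := (norm_phaseDiag_sub_one_le (y := y) (norm_nonneg _)).1 le_rfl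
  calc _ ≤ ∑ _i : ι, (‖phaseDiag y - 1‖ ^ 2) ^ (p + 1) := Finset.sum_le_sum fun i _ =>
        pow_le_pow_left₀ (by linarith [Real.cos_le_one (y i)]) (h2 i) _
    _ = _ := by simp

theorem norm_sub_one_le_of_energy_le {p : ℕ} {c : Matrix.unitaryGroup ι ℂ} {r : ℝ} (hr : 0 ≤ r)
    (h : energy p c.1 ≤ (r ^ 2) ^ (p + 1)) : ‖c.1 - 1‖ ≤ r := by
  obtain ⟨V, w, y, rfl, hy⟩ := exists_phaseDiag c
  rw [energy_conj, hy, energy_phaseDiag] at h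
  rw [norm_conj_unitary_sub_one, hy, norm_phaseDiag_sub_one_le hr]
  intro i
  have h0 : ∀ i, 0 ≤ 2 - 2 * Real.cos (y i) := fun i => by linarith [Real.cos_le_one (y i)]
  exact le_of_pow_le_pow_left₀ (Nat.succ_ne_zero p) (sq_nonneg r)
    ((Finset.single_le_sum (fun i _ => pow_nonneg (h0 i) (p + 1)) (Finset.mem_univ i)).trans h)

/-- Angles in the right half plane sum to zero when the winding number vanishes. -/
theorem sum_eq_zero_of_windZero {y : ι → ℝ} (hy : ∀ i, 0 < Real.cos (y i))
    (hy' : ∀ i, y i ∈ Set.Ioc (-Real.pi) Real.pi) (h : WindZero (phaseDiag y)) : ∑ i, y i = 0 := by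
  obtain ⟨f, hf, hf1, hf2⟩ := h
  set e : ι → ℂ := fun i => Complex.exp (y i * Complex.I) with he
  have hs : ∀ i, ∀ t ∈ Set.Icc (0 : ℝ) 1, ((t : ℂ) + (1 - (t : ℂ)) * e i) ∈ Complex.slitPlane := by
    intro i t ht
    left
    have h1 : ((t : ℂ) + (1 - (t : ℂ)) * e i).re = t + (1 - t) * Real.cos (y i) := by
      rw [← Complex.exp_ofReal_mul_I_re (y i), ← Complex.ofReal_one, ← Complex.ofReal_sub,
        Complex.add_re, Complex.re_ofReal_mul, Complex.ofReal_re]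
    rw [h1]
    rcases ht.1.eq_or_lt with h0 | h0
    · rw [← h0]
      linarith [hy i]
    · have := mul_nonneg (show 0 ≤ 1 - t by linarith [ht.2]) (hy i).le
      linarith
  set L : ℝ → ℂ := fun t => ∑ i, Complex.log ((t : ℂ) + (1 - (t : ℂ)) * e i) with hL
  have hLc : ContinuousOn L (Set.Icc 0 1) := by
    refine continuousOn_finsetSum _ fun i _ => ContinuousOn.clog ?_ (hs i)
    fun_prop
  have hdet : ∀ t, segDet (phaseDiag y) t = ∏ i, ((t : ℂ) + (1 - (t : ℂ)) * e i) := fun t => by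
    rw [segDet, phaseDiag, ← Matrix.diagonal_one, ← Matrix.diagonal_smul, ← Matrix.diagonal_smul,
      Matrix.diagonal_add, Matrix.det_diagonal]
    simp [he]
  have hexp : ∀ t ∈ Set.Icc (0 : ℝ) 1, Complex.exp (L t) = segDet (phaseDiag y) t := fun t ht => by
    rw [hdet, hL, Complex.exp_sum]
    exact Finset.prod_congr rfl fun i _ => Complex.exp_log (Complex.slitPlane_ne_zero (hs i t ht))
  have hsub : ((fun t => f t - L t) '' Set.Icc 0 1).Subsingleton := by
    refine (Set.Countable.isTotallyDisconnected (s := Set.range fun n : ℤ =>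
        n * (2 * Real.pi * Complex.I))
      (Set.countable_range _)) _ ?_ (isPreconnected_Icc.image _ (hf.sub hLc))
    rintro _ ⟨t, ht, rfl⟩
    have h1 : Complex.exp (f t - L t) = 1 := by
      rw [Complex.exp_sub, hf2 t ht, ← hexp t ht, div_self (Complex.exp_ne_zero _)]
    obtain ⟨n, hn⟩ := Complex.exp_eq_one_iff.1 h1
    exact ⟨n, hn.symm⟩
  have h1 : f 0 - L 0 = f 1 - L 1 := hsub ⟨0, by simp, rfl⟩ ⟨1, by simp, rfl⟩
  have h2 : L 0 = L 1 := by
    rw [hf1] at h1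
    exact sub_right_injective h1
  have h3 : L 1 = 0 := by simp [hL]
  have h4 : L 0 = ((∑ i, y i : ℝ) : ℂ) * Complex.I := by
    simp only [hL, he]
    push_cast
    rw [Finset.sum_mul]
    refine Finset.sum_congr rfl fun i _ => ?_
    rw [zero_add, sub_zero, one_mul, Complex.log_exp]
    · simpa using (hy' i).1
    · simpa using (hy' i).2
  rw [h3, h4] at h2
  exact_mod_cast (mul_eq_zero.1 h2).resolve_right Complex.I_ne_zero

theorem exists_permutation_unitary (σ : Equiv.Perm ι) : ∃ P : Matrix.unitaryGroup ι ℂ,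
    ∀ d : ι → ℂ, P.1 * Matrix.diagonal d * star P.1 = Matrix.diagonal fun i => d (σ.symm i) := by
  refine ⟨⟨(UnitaryIso.ofEquiv σ).mat, (UnitaryIso.ofEquiv σ).left, (UnitaryIso.ofEquiv σ).right⟩,
      fun d => ?_⟩
  refine (UnitaryIso.ofEquiv_conj σ _).trans ?_
  rw [Matrix.submatrix_diagonal_equiv]
  rfl

theorem map_eq_of_conj_diagonal {k : Matrix.unitaryGroup ι ℂ} {a a' : ι → ℂ}
    (h : k.1 * Matrix.diagonal a * star k.1 = Matrix.diagonal a') :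
    Finset.univ.val.map a = Finset.univ.val.map a' := by
  have hp : ∀ d : ι → ℂ, (Matrix.diagonal d).charpoly.roots = Finset.univ.val.map d := fun d => by
    rw [Matrix.charpoly_diagonal, Finset.prod]
    have := Polynomial.roots_multiset_prod_X_sub_C (Finset.univ.val.map d)
    rwa [Multiset.map_map] at this
  have h1 : star k.1 * (k.1 * Matrix.diagonal a) = Matrix.diagonal a := by
    rw [← mul_assoc, Unitary.coe_star_mul_self k, one_mul]
  rw [← hp, ← hp, ← h, Matrix.charpoly_mul_comm, h1]

theorem phaseDiag_mul_diagonal (y : ι → ℝ) (a : ι → ℂ) :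
    phaseDiag y * Matrix.diagonal a = Matrix.diagonal fun i =>
        a i * Complex.exp (y i * Complex.I) := by
  rw [phaseDiag, Matrix.diagonal_mul_diagonal]
  congr 1
  funext i
  exact mul_comm _ _

theorem exists_energy_descent_diagonal {p : ℕ} {k z : Matrix.unitaryGroup ι ℂ} {a : ι → ℂ} {y : ι →
    ℝ}
    (hz : z.1 = Matrix.diagonal a) (hc : (k * z * k⁻¹ * z⁻¹).1 = phaseDiag y)
    (hn : ‖(k * z * k⁻¹ * z⁻¹).1 - 1‖ < 1) (hy : ∀ i, y i ∈ Set.Ioc (-Real.pi) Real.pi)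
    (hw : WindZero (k * z * k⁻¹ * z⁻¹).1) (hne : ∃ i, y i ≠ 0) {η : ℝ} (hη : 0 < η) :
    ∃ (n : ℕ) (γ : ℕ → Matrix.unitaryGroup ι ℂ), γ 0 = k ∧
      (∀ j, ‖(γ (j + 1)).1 - (γ j).1‖ ≤ η) ∧
      (∀ j, ‖(γ j * z * (γ j)⁻¹ * z⁻¹).1 - 1‖ ≤ 3 * ‖(k * z * k⁻¹ * z⁻¹).1 - 1‖) ∧
      energy p (γ n * z * (γ n)⁻¹ * z⁻¹).1 < energy p (k * z * k⁻¹ * z⁻¹).1 := by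
  set ρ := ‖(k * z * k⁻¹ * z⁻¹).1 - 1‖ with hρ
  have hρ0 : 0 ≤ ρ := norm_nonneg _
  have hcos : ∀ i, 2 - 2 * Real.cos (y i) ≤ ρ ^ 2 :=
    (norm_phaseDiag_sub_one_le hρ0).1 (by rw [← hc])
  have hcos0 : ∀ i, 0 < Real.cos (y i) := fun i => by nlinarith [hcos i]
  have hyabs : ∀ i, |y i| ≤ Real.pi / 2 := fun i => by
    by_contra! h
    have h1 : |y i| ≤ Real.pi := abs_le.2 ⟨(hy i).1.le, (hy i).2⟩
    have h2 := Real.cos_nonpos_of_pi_div_two_le_of_le h.le (by linarith [Real.pi_pos])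
    rw [Real.cos_abs] at h2
    linarith [hcos0 i]
  have hsum : ∑ i, y i = 0 := sum_eq_zero_of_windZero hcos0 hy (hc ▸ hw)
  obtain ⟨i₀, hi₀⟩ := hne
  obtain ⟨j, -, hj⟩ := Finset.exists_pos_of_sum_zero_of_exists_nonzero y hsum ⟨i₀,
      Finset.mem_univ _, hi₀⟩
  set a' : ι → ℂ := fun i => a i * Complex.exp (y i * Complex.I) with ha'
  have hkz : (k * z * k⁻¹).1 = Matrix.diagonal a' := by
    have h1 : k * z * k⁻¹ = (k * z * k⁻¹ * z⁻¹) * z := by group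
    rw [h1, show ((k * z * k⁻¹ * z⁻¹) * z).1 = (k * z * k⁻¹ * z⁻¹).1 * z.1 from rfl, hc, hz,
      phaseDiag_mul_diagonal]
  have hmap := map_eq_of_conj_diagonal (k := k) (a := a) (a' := a') (by rw [← hkz, ← hz]; rfl)
  obtain ⟨l, s, hls, hs, hl⟩ := exists_crossing (exists_angles hz).1 (fun i => rfl) hmap hsum hj
  change a' l = a' j * _ at hl
  have hlj : l ≠ j := fun h => by subst h; linarith
  set b : ι → ℂ := Function.update a' l (a' j) with hb
  have hs1 : ‖a' l - a' j‖ ≤ ρ := by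
    have h1 : ‖a' j‖ = 1 := (exists_angles hkz).1 j
    have h2 : a' l - a' j = a' j * (Complex.exp (s * Complex.I) - 1) := by rw [hl]; ring
    rw [h2, norm_mul, h1, one_mul, ← sq_le_sq₀ (norm_nonneg _) hρ0, norm_exp_sub_one_sq]
    have h3 : Real.cos (y l) ≤ Real.cos s := by
      rw [← Real.cos_neg (y l), ← Real.cos_neg s]
      exact Real.cos_le_cos_of_nonneg_of_le_pi (by linarith)
        (by linarith [(abs_le.1 (hyabs l)).1, Real.pi_pos]) (by linarith)
    linarith [hcos l]
  have hwB : ‖(k * z * k⁻¹).1 - Matrix.diagonal b‖ ≤ ρ := by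
    rw [hkz, norm_diagonal_sub_le hρ0]
    intro i
    by_cases h : i = l
    · subst h
      simpa [hb] using hs1
    · simp [hb, h, hρ0]
  have hwz : ‖(k * z * k⁻¹).1 - z.1‖ = ρ := by
    have h1 := norm_mul_sub_mul_right z (k * z * k⁻¹ * z⁻¹) 1
    rw [inv_mul_cancel_right, one_mul] at h1
    exact h1
  obtain ⟨P, hP⟩ := exists_permutation_unitary (Equiv.swap j l)
  have hPB : Commute P.1 (Matrix.diagonal b) := by
    have h1 := hP b
    have h2 : (fun i => b ((Equiv.swap j l).symm i)) = b := by
      funext i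
      rw [Equiv.symm_swap]
      by_cases h : i = j
      · subst h; simp [hb, hlj.symm]
      · by_cases h' : i = l
        · subst h'; simp [hb, hlj.symm]
        · rw [Equiv.swap_apply_of_ne_of_ne h h']
    rw [h2] at h1
    have h3 := congrArg (· * P.1) h1
    simp only [mul_assoc] at h3
    rw [Unitary.coe_star_mul_self P, mul_one] at h3
    exact h3
  obtain ⟨n, hn⟩ := exists_unitary_chain hη
  obtain ⟨γ, h0, hend, hstep, hcomm⟩ := hn ι P
  have hassoc : ∀ q : Matrix.unitaryGroup ι ℂ, q * k * z * (q * k)⁻¹ * z⁻¹ = q * (k * z * k⁻¹) *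
      q⁻¹ * z⁻¹ :=
    fun q => by group
  refine ⟨n, fun i => γ i * k, by simp only [h0, one_mul], fun i => ?_, fun i => ?_, ?_⟩
  · rw [norm_mul_sub_mul_right]
    exact hstep i
  · simp only [hassoc]
    have h1 := norm_mul_sub_mul_right z (γ i * (k * z * k⁻¹) * (γ i)⁻¹ * z⁻¹) 1
    rw [inv_mul_cancel_right, one_mul] at h1
    have e0 : ‖(γ i * (k * z * k⁻¹) * (γ i)⁻¹ * z⁻¹).1 - 1‖ = ‖(γ i * (k * z * k⁻¹) * (γ i)⁻¹).1 -
        z.1‖ := h1.symm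
    have h2 : (γ i).1 * Matrix.diagonal b * star (γ i).1 = Matrix.diagonal b := by
      rw [(hcomm i _ hPB).eq, mul_assoc,
        show (γ i).1 * star (γ i).1 = 1 from Unitary.coe_mul_star_self (γ i), mul_one]
    have h3 : ‖(γ i * (k * z * k⁻¹) * (γ i)⁻¹).1 - Matrix.diagonal b‖ ≤ ρ := by
      have h4 : (γ i * (k * z * k⁻¹) * (γ i)⁻¹).1 - Matrix.diagonal b =
          (γ i).1 * (((k * z * k⁻¹).1 - Matrix.diagonal b) * ((γ i)⁻¹).1) := by
        nth_rewrite 1 [← h2]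
        rw [Matrix.sub_mul, Matrix.mul_sub, ← Matrix.mul_assoc, ← Matrix.mul_assoc]
        rfl
      rw [h4, norm_unitary_mul, norm_mul_unitary]
      exact hwB
    rw [e0]
    calc _ = ‖((γ i * (k * z * k⁻¹) * (γ i)⁻¹).1 - Matrix.diagonal b) -
          ((k * z * k⁻¹).1 - Matrix.diagonal b) + ((k * z * k⁻¹).1 - z.1)‖ := by congr 1; abel
      _ ≤ ρ + ρ + ρ := (norm_add_le _ _).trans (add_le_add ((norm_sub_le _ _).trans (add_le_add h3
          hwB)) hwz.le)
      _ = 3 * ρ := by ring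
  · simp only [hassoc, hend]
    set y' : ι → ℝ := Function.update (Function.update y j (y j + s)) l (y l - s) with hy'
    have h1 : (P * (k * z * k⁻¹) * P⁻¹).1 = phaseDiag y' * z.1 := by
      have h2 : (P * (k * z * k⁻¹) * P⁻¹).1 = P.1 * (k * z * k⁻¹).1 * star P.1 := rfl
      rw [h2, hkz, hP, hz, phaseDiag_mul_diagonal]
      congr 1
      funext i
      rw [Equiv.symm_swap]
      by_cases h : i = j
      · subst h
        rw [Equiv.swap_apply_left, hl]
        simp only [hy', ha', Function.update_of_ne hlj.symm, Function.update_self]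
        push_cast
        rw [mul_assoc, ← Complex.exp_add]
        ring_nf
      · by_cases h' : i = l
        · subst h'
          rw [Equiv.swap_apply_right]
          simp only [hy', Function.update_self]
          have h5 : a' j = a' i * Complex.exp (-(s * Complex.I)) := by
            rw [hl, mul_assoc, ← Complex.exp_add]
            simp
          rw [h5]
          simp only [ha']
          push_cast
          rw [mul_assoc, ← Complex.exp_add]
          ring_nf
        · rw [Equiv.swap_apply_of_ne_of_ne h h']
          simp only [hy', Function.update_of_ne h', Function.update_of_ne h, ha']
    have h2 : (P * (k * z * k⁻¹) * P⁻¹ * z⁻¹).1 = phaseDiag y' := by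
      have h3 : (P * (k * z * k⁻¹) * P⁻¹ * z⁻¹).1 = (P * (k * z * k⁻¹) * P⁻¹).1 * (star z.1) := rfl
      rw [h3, h1, mul_assoc, show z.1 * star z.1 = 1 from Unitary.coe_mul_star_self z, mul_one]
    rw [h2, hc, energy_phaseDiag, energy_phaseDiag]
    have hsplit : ∀ f : ι → ℝ, ∑ i, f i = f j + f l + ∑ i ∈ (Finset.univ.erase j).erase l,
        f i := fun f => by
      rw [add_assoc, Finset.add_sum_erase _ f (Finset.mem_erase.2 ⟨hlj, Finset.mem_univ l⟩),
        Finset.add_sum_erase _ f (Finset.mem_univ j)]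
    rw [hsplit, hsplit (fun i => (2 - 2 * Real.cos (y i)) ^ (p + 1))]
    have e1 : y' j = y j + s := by simp [hy', hlj.symm]
    have e2 : y' l = y l - s := by simp [hy']
    have e3 : ∑ i ∈ (Finset.univ.erase j).erase l, (2 - 2 * Real.cos (y' i)) ^ (p + 1) =
        ∑ i ∈ (Finset.univ.erase j).erase l, (2 - 2 * Real.cos (y i)) ^ (p + 1) := by
      refine Finset.sum_congr rfl fun i hi => ?_
      have hi' := Finset.mem_erase.1 hi
      rw [hy', Function.update_of_ne hi'.1, Function.update_of_ne (Finset.mem_erase.1 hi'.2).1]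
    rw [e1, e2, e3]
    have := energy_pair_lt p (abs_le.1 (hyabs j)).2 (abs_le.1 (hyabs l)).1 hj hls hs
    linarith

theorem exists_energy_descent {p : ℕ} {k z : Matrix.unitaryGroup ι ℂ}
    (hc : Commute (k * z * k⁻¹ * z⁻¹).1 z.1) (hn : ‖(k * z * k⁻¹ * z⁻¹).1 - 1‖ < 1)
    (hw : WindZero (k * z * k⁻¹ * z⁻¹).1) (hne : k * z * k⁻¹ * z⁻¹ ≠ 1) {η : ℝ} (hη : 0 < η) :
    ∃ (n : ℕ) (γ : ℕ → Matrix.unitaryGroup ι ℂ), γ 0 = k ∧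
      (∀ j, ‖(γ (j + 1)).1 - (γ j).1‖ ≤ η) ∧
      (∀ j, ‖(γ j * z * (γ j)⁻¹ * z⁻¹).1 - 1‖ ≤ 3 * ‖(k * z * k⁻¹ * z⁻¹).1 - 1‖) ∧
      energy p (γ n * z * (γ n)⁻¹ * z⁻¹).1 < energy p (k * z * k⁻¹ * z⁻¹).1 := by
  obtain ⟨V, e, a, he, ha⟩ := exists_unitary_diagonalizing_pair _ _ hc
  have hconj : ∀ q : Matrix.unitaryGroup ι ℂ, q * (V⁻¹ * z * V) * q⁻¹ * (V⁻¹ * z * V)⁻¹ =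
      V⁻¹ * ((V * q * V⁻¹) * z * (V * q * V⁻¹)⁻¹ * z⁻¹) * V⁻¹⁻¹ := fun q => by group
  have hk : (V⁻¹ * k * V) * (V⁻¹ * z * V) * (V⁻¹ * k * V)⁻¹ * (V⁻¹ * z * V)⁻¹ =
      V⁻¹ * (k * z * k⁻¹ * z⁻¹) * V⁻¹⁻¹ := by group
  obtain ⟨n, γ, h0, h1, h2, h3⟩ := exists_energy_descent_diagonal (p := p) (k := V⁻¹ * k * V) ha
    (y := fun i => (e i).arg)
    (by rw [hk, inv_inv]; exact (exists_angles he).2)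
    (by rwa [hk, norm_conj_unitary_sub_one])
    (fun i => Complex.arg_mem_Ioc _)
    (by rw [hk]; exact (windZero_conj_unitary _ _).2 hw)
    (by
      by_contra! h
      apply hne
      have h4 := (exists_angles he).2
      have h5 : (V⁻¹ * (k * z * k⁻¹ * z⁻¹) * V) = 1 := by
        apply Subtype.ext
        rw [h4, phaseDiag]
        simp [h]
      calc k * z * k⁻¹ * z⁻¹ = V * (V⁻¹ * (k * z * k⁻¹ * z⁻¹) * V) * V⁻¹ := by group
        _ = 1 := by rw [h5]; group) hη
  refine ⟨n, fun j => V * γ j * V⁻¹, ?_, fun j => ?_, fun j => ?_, ?_⟩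
  · simp only [h0]
    group
  · rw [norm_mul_sub_mul_right, norm_mul_sub_mul_left]
    exact h1 j
  · have := h2 j
    rwa [hk, hconj, norm_conj_unitary_sub_one, norm_conj_unitary_sub_one] at this
  · rwa [hk, hconj, energy_conj, energy_conj] at h3

theorem exists_windZero_commutator_near : ∃ η > 0, ∀ (ι : Type) [Fintype ι] [DecidableEq ι]
    (k k' z : Matrix.unitaryGroup ι ℂ), ‖k.1 - k'.1‖ ≤ η → ‖(k * z * k⁻¹ * z⁻¹).1 - 1‖ ≤ 1 / 2 →
    WindZero (k * z * k⁻¹ * z⁻¹).1 → WindZero (k' * z * k'⁻¹ * z⁻¹).1 := by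
  obtain ⟨η, hη, h⟩ := exists_windZero_near 1
  refine ⟨η, hη, fun ι _ _ k k' z hk hn hw => ?_⟩
  have hr : ∀ q : Matrix.unitaryGroup ι ℂ, relVal (handles q z (fun i : Fin 0 =>
      i.elim0) fun i => i.elim0) =
      q * z * q⁻¹ * z⁻¹ := fun q => by
    rw [relVal_handles]
    simp [commList]
  have h1 := h ι (fun x => (handles k' z (fun i : Fin 0 => i.elim0) (fun i => i.elim0) x).1)
    (handles k z (fun i : Fin 0 => i.elim0) fun i => i.elim0)
    ((forall_handles (r := fun q q' : Matrix.unitaryGroup ι ℂ => ‖q.1 - q'.1‖ ≤ η)).2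
      ⟨by rwa [norm_sub_rev k'.1 k.1], by simpa using hη.le, fun i => i.elim0, fun i => i.elim0⟩)
    (by rwa [hr])
  rw [← coe_relVal_unitary, hr, hr] at h1
  exact h1.2 hw

theorem compactSpace_unitaryGroup : CompactSpace (Matrix.unitaryGroup ι ℂ) := by
  have : ProperSpace (Matrix ι ι ℂ) := FiniteDimensional.proper ℂ _
  refine isCompact_iff_compactSpace.1 (Metric.isCompact_of_isClosed_isBounded ?_ ?_)
  · have h1 : ((Matrix.unitaryGroup ι ℂ : Submonoid (Matrix ι ι ℂ)) : Set (Matrix ι ι ℂ)) =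
        {A | A * star A = 1} := by
      ext A
      exact Matrix.mem_unitaryGroup_iff
    rw [h1]
    exact isClosed_eq (by fun_prop) continuous_const
  · refine Bornology.IsBounded.subset (Metric.isBounded_closedBall (x :=
        (0 : Matrix ι ι ℂ)) (r := 1)) fun A hA => ?_
    rw [mem_closedBall_zero_iff]
    exact norm_coe_unitary_le ⟨A, hA⟩

/-- A commutator near the identity with vanishing winding number can be deformed to the identity by
moving the first factor in small steps. -/
theorem exists_chain_to_commuting {δ η : ℝ} (hδ : 0 < δ) (hδ' : δ ≤ 1 / 12) (hη : 0 < η)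
    {k z : Matrix.unitaryGroup ι ℂ} (hn : ‖(k * z * k⁻¹ * z⁻¹).1 - 1‖ ≤ δ)
    (hw : WindZero (k * z * k⁻¹ * z⁻¹).1) :
    ∃ k' : Matrix.unitaryGroup ι ℂ, Relation.ReflTransGen
      (fun a b => ‖a.1 - b.1‖ ≤ η ∧ ‖(b * z * b⁻¹ * z⁻¹).1 - 1‖ ≤ 6 * δ) k k' ∧
      k' * z * k'⁻¹ * z⁻¹ = 1 := by
  obtain ⟨η₀, hη₀, hwind⟩ := exists_windZero_commutator_near
  set r : Matrix.unitaryGroup ι ℂ → Matrix.unitaryGroup ι ℂ → Prop :=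
    fun a b => ‖a.1 - b.1‖ ≤ min η η₀ ∧ ‖(b * z * b⁻¹ * z⁻¹).1 - 1‖ ≤ 6 * δ with hr
  suffices h : ∃ k', Relation.ReflTransGen r k k' ∧ k' * z * k'⁻¹ * z⁻¹ = 1 by
    obtain ⟨k', h1, h2⟩ := h
    exact ⟨k', Relation.ReflTransGen.mono (fun a b hab =>
        ⟨hab.1.trans (min_le_left _ _), hab.2⟩) _ _ h1, h2⟩
  have hη' : 0 < min η η₀ := lt_min hη hη₀
  have hinv : ∀ q, Relation.ReflTransGen r k q →
      ‖(q * z * q⁻¹ * z⁻¹).1 - 1‖ ≤ 6 * δ ∧ WindZero (q * z * q⁻¹ * z⁻¹).1 := fun q hq => by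
    induction hq with
    | refl => exact ⟨by linarith, hw⟩
    | tail _ h ih => exact ⟨h.2, hwind _ _ _ _ (h.1.trans (min_le_right _ _)) (by linarith [ih.1])
        ih.2⟩
  have hcont : Continuous fun q : Matrix.unitaryGroup ι ℂ => (q * z * q⁻¹ * z⁻¹).1 := by fun_prop
  have hclosed : IsClosed {q | Relation.ReflTransGen r k q} := by
    refine isClosed_of_closure_subset fun q hq => ?_
    have h1 : ‖(q * z * q⁻¹ * z⁻¹).1 - 1‖ ≤ 6 * δ := by
      have h2 : IsClosed {q : Matrix.unitaryGroup ι ℂ | ‖(q * z * q⁻¹ * z⁻¹).1 - 1‖ ≤ 6 * δ} :=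
        isClosed_le (hcont.sub continuous_const).norm continuous_const
      exact closure_minimal (fun q hq => (hinv q hq).1) h2 hq
    obtain ⟨q', hq', hd⟩ := mem_closure_iff.1 hq {q' | ‖q'.1 - q.1‖ < min η η₀}
      (isOpen_lt ((continuous_subtype_val.sub continuous_const).norm) continuous_const)
      (by simpa using hη')
    exact hd.tail ⟨(show ‖q'.1 - q.1‖ < _ from hq').le, h1⟩
  obtain ⟨p, hp⟩ : ∃ p : ℕ, (Fintype.card ι : ℝ) ≤ 4 ^ (p + 1) := by
    obtain ⟨p, hp⟩ := pow_unbounded_of_one_lt (Fintype.card ι : ℝ) (show (1 : ℝ) < 4 by norm_num)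
    exact ⟨p, hp.le.trans (pow_le_pow_right₀ (by norm_num) (Nat.le_succ p))⟩
  have := compactSpace_unitaryGroup (ι := ι)
  obtain ⟨q, hq, hmin⟩ := hclosed.isCompact.exists_isMinOn ⟨k, Relation.ReflTransGen.refl⟩
    ((continuous_energy p).comp hcont).continuousOn
  have hmin' : ∀ q', Relation.ReflTransGen r k q' →
      energy p (q * z * q⁻¹ * z⁻¹).1 ≤ energy p (q' * z * q'⁻¹ * z⁻¹).1 := fun q' hq' => hmin hq'
  have hq2 : ‖(q * z * q⁻¹ * z⁻¹).1 - 1‖ ≤ 2 * δ := by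
    refine norm_sub_one_le_of_energy_le (p := p) (by linarith) ?_
    calc _ ≤ _ := hmin' k Relation.ReflTransGen.refl
      _ ≤ _ := energy_le_card_mul p _
      _ ≤ 4 ^ (p + 1) * (δ ^ 2) ^ (p + 1) := by gcongr
      _ = _ := by rw [← mul_pow]; ring_nf
  refine ⟨q, hq, ?_⟩
  by_contra hne
  have hloc : IsLocalMin (fun s : Matrix.unitaryGroup ι ℂ => energy p (s * z * s⁻¹ * z⁻¹).1) q := by
    have h1 : ∀ᶠ s in nhds q, ‖q.1 - s.1‖ < min η η₀ :=
      ((continuous_const.sub continuous_subtype_val).norm.tendsto q).eventually_lt_const (by simpa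
          using hη')
    have h2 : ∀ᶠ s in nhds q, ‖(s * z * s⁻¹ * z⁻¹).1 - 1‖ < 6 * δ :=
      ((hcont.sub continuous_const).norm.tendsto q).eventually_lt_const
        (show ‖(q * z * q⁻¹ * z⁻¹).1 - 1‖ < 6 * δ by linarith)
    filter_upwards [h1, h2] with s hs1 hs2
    exact hmin' s (hq.tail ⟨hs1.le, hs2.le⟩)
  have hcomm := commute_of_commute_energy_gradient (by linarith) (commute_of_isLocalMin_energy hloc
      _ rfl)
  obtain ⟨n, γ, h0, h1, h2, h3⟩ := exists_energy_descent (p :=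
      p) hcomm (by linarith) (hinv q hq).2 hne hη'
  have hγ : ∀ j, Relation.ReflTransGen r k (γ j) := fun j => by
    induction j with
    | zero => rwa [h0]
    | succ j ih => exact ih.tail ⟨by rw [norm_sub_rev (γ j).1 (γ (j + 1)).1]; exact h1 j, by
      linarith [h2 (j + 1)]⟩
  exact absurd (hmin' _ (hγ n)) (not_le.2 h3)

theorem exists_stab (m : ℕ) {ε : ℝ} (hε : 0 < ε) : ∃ δ > 0, ∀ (ι : Type) [Fintype ι] [DecidableEq ι]
    (f : Fin (m + 1) ⊕ Fin (m + 1) → Matrix.unitaryGroup ι ℂ), ‖(relVal f).1 - 1‖ ≤ δ →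
    WindZero (relVal f).1 → Stab ε fun x => (f x).1 := by
  have hε₁ : 0 < ε / 8 := by positivity
  obtain ⟨δ₁, hδ₁, hcompl⟩ := exists_complemented m hε₁
  set δ := min (1 / 12) (δ₁ / 6) with hδdef
  have hδ : 0 < δ := by positivity
  have hδ1 : δ ≤ 1 / 12 := min_le_left _ _
  have hδ2 : 6 * δ ≤ δ₁ := by linarith [min_le_right (1 / 12) (δ₁ / 6)]
  obtain ⟨η₀, hη₀, hwind⟩ := exists_windZero_near (m + 1)
  obtain ⟨η₁, hη₁, hlift⟩ := exists_near_lift (surfaceRelator (m + 1)) (half_pos hδ)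
  refine ⟨δ / 2, half_pos hδ, fun ι _ _ f hf hw => ?_⟩
  set ε₂ := min (ε / 8) (min η₀ η₁) with hε₂def
  have hε₂ : 0 < ε₂ := by positivity
  obtain ⟨κ, _, _, θ, W, hθ, hW⟩ := ladder hε₂ f
  set F : Fin (m + 1) ⊕ Fin (m + 1) → Matrix.unitaryGroup (ι ⊕ κ) ℂ :=
    fun x => W.conjU (dsumU (f x, θ x)) with hF
  have hrF : relVal F = W.conjU (dsumU (relVal f, 1)) := by
    rw [hF, UnitaryIso.relVal_conjU, relVal_dsumU, hθ]
  have hFn : ‖(relVal F).1 - 1‖ ≤ δ / 2 := by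
    have h1 : ‖W.conj (dsum (relVal f).1 (1 : Matrix κ κ ℂ)) - W.conj 1‖ ≤ δ / 2 := by
      refine W.norm_conj_sub_le ?_
      rw [← Matrix.fromBlocks_one]
      exact norm_dsum_sub_le hf (by simpa using (half_pos hδ).le)
    rw [W.conj_one] at h1
    rw [hrF]
    exact h1
  have hFw : WindZero (relVal F).1 := by
    rw [hrF]
    exact (windZero_conj W _).2 ((windZero_dsum_one _).2 hw)
  obtain ⟨T, z, a, b, hΘ⟩ := exists_handles fun x => dsumU ((1 : Matrix.unitaryGroup ι ℂ), θ x)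
  have hΘ1 : T * z * T⁻¹ * z⁻¹ * commList a b = 1 := by
    rw [← relVal_handles, ← hΘ, relVal_dsumU, hθ]
    have : relVal (fun _ : Fin (m + 1) ⊕ Fin (m + 1) => (1 : Matrix.unitaryGroup ι ℂ)) = 1 :=
        commList_one
    rw [this]
    exact map_one dsumU
  have hrel : ∀ q, relVal (handles (T * q) z a b) = T * (q * z * q⁻¹ * z⁻¹) * T⁻¹ := fun q => by
    rw [relVal_handles, eq_inv_of_mul_eq_one_right hΘ1]
    group
  set k := T⁻¹ * F (.inl 0) with hk
  set U := handles (T * k) z a b with hU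
  have hUF : ∀ x, ‖(U x).1 - (F x).1‖ ≤ ε₂ := fun x => by
    by_cases hx : x = .inl 0
    · subst hx
      have : U (.inl 0) = F (.inl 0) := by simp [hU, handles, hk]
      rw [this]
      simpa using hε₂.le
    · have h1 : U x = dsumU ((1 : Matrix.unitaryGroup ι ℂ), θ x) := by
        rw [hU, show dsumU ((1 : Matrix.unitaryGroup ι ℂ),
            θ x) = handles T z a b x from congrFun hΘ x]
        rcases x with x | x
        · obtain ⟨i, rfl⟩ := Fin.exists_succ_eq.2 fun h => hx (congrArg Sum.inl h)
          simp [handles]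
        · rfl
      rw [h1, norm_sub_rev]
      exact hW x hx
  have hUn : ‖(relVal U).1 - 1‖ ≤ δ := by
    have h1 := hlift (ι ⊕ κ) (fun x => Unitary.toUnits (U x)) F
      (fun x => (hUF x).trans ((min_le_right _ _).trans (min_le_right _ _)))
    rw [lift_surfaceRelator, lift_surfaceRelator, ← map_relVal] at h1
    have h2 := (norm_sub_le_norm_sub_add_norm_sub (relVal U).1 (relVal F).1 1).trans (add_le_add h1
        hFn)
    linarith
  have hUw : WindZero (relVal U).1 := by
    rw [coe_relVal_unitary]
    exact (hwind _ _ F (fun x => (hUF x).trans ((min_le_right _ _).trans (min_le_left _ _)))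
      (by linarith)).2 hFw
  rw [hU, hrel, norm_conj_unitary_sub_one] at hUn
  rw [hU, hrel, windZero_conj_unitary] at hUw
  obtain ⟨k', hchain, hk'⟩ := exists_chain_to_commuting hδ hδ1 hε₁ hUn hUw
  have hstab : StabQ (ε / 8) (2 * (ε / 8)) fun x => (U x).1 := by
    refine Relation.ReflTransGen.head_induction_on
      (motive := fun q _ => StabQ (ε / 8) (2 * (ε / 8)) fun x =>
          (handles (T * q) z a b x).1) hchain ?_ ?_
    · refine StabQ.of_relVal_eq_one hε₁.le (by positivity) ?_
      rw [hrel, hk']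
      group
    · intro q q' hqq' _ ih
      refine ih.step hε₁.le (hcompl _ _ ?_) ?_
      · rw [hrel, norm_conj_unitary_sub_one]
        exact hqq'.2.trans hδ2
      · refine (forall_handles (r := fun u v : Matrix.unitaryGroup (ι ⊕ κ) ℂ =>
            ‖u.1 - v.1‖ ≤ ε / 8)).2
          ⟨?_, ?_, fun i => ?_, fun i => ?_⟩
        · rw [norm_mul_sub_mul_left]
          exact hqq'.1
        all_goals simpa using hε₁.le
  have h1 : Stab (5 * ε / 8 + (ε / 8 + 2 * (ε / 8))) fun x => (F x).1 :=
    (hstab.stab hε₁.le).of_near (by positivity) fun x => by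
      rw [norm_sub_rev]
      exact (hUF x).trans ((min_le_left _ _).trans (by linarith))
  rw [show 5 * ε / 8 + (ε / 8 + 2 * (ε / 8)) = ε by ring] at h1
  have h2 := h1.conj W.symm
  refine Stab.of_dsum hθ ?_
  convert h2 using 2 with x
  exact (W.symm_conj_conj _).symm

/-- Unitary tuples that are close on generators are close on finitely many words. -/
theorem exists_unitary_near_lift {X : Type} {S : Set (FreeGroup X)} (hS : S.Finite) {ε : ℝ}
    (hε : 0 < ε) : ∃ η > 0, ∀ (ι : Type) [Fintype ι] [DecidableEq ι]
      (u v : X → Matrix.unitaryGroup ι ℂ), (∀ x, ‖(v x).1 - (u x).1‖ ≤ η) →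
      ∀ w ∈ S, ‖(FreeGroup.lift v w).1 - (FreeGroup.lift u w).1‖ ≤ ε := by
  induction S, hS using Set.Finite.induction_on with
  | empty => exact ⟨1, one_pos, fun _ _ _ _ _ _ w hw => hw.elim⟩
  | @insert w S _ _ ih =>
    obtain ⟨η, hη, H⟩ := ih
    obtain ⟨η', hη', H'⟩ := exists_near_lift w hε
    refine ⟨min η η', by positivity, fun ι _ _ u v h w' hw' => ?_⟩
    rcases hw' with rfl | hw'
    · have h1 := H' ι (fun x => Unitary.toUnits (v x)) u fun x => (h x).trans (min_le_right _ _)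
      have h2 : FreeGroup.lift (fun x => Unitary.toUnits (v x)) w'
          = Unitary.toUnits (FreeGroup.lift v w') :=
        DFunLike.congr_fun (FreeGroup.ext_hom _ (Unitary.toUnits.comp (FreeGroup.lift v))
          fun x => by simp) w'
      rw [h2] at h1
      exact h1
    · exact H ι u v (fun x => (h x).trans (min_le_left _ _)) w' hw'

/-- A quasi-representation close to unitaries on generators is close to their evaluation on
finitely many words. -/
theorem exists_quasiRep_near_lift_of_finite {X Γ : Type} [Group Γ] (ρ : FreeGroup X →* Γ)
    {S : Set (FreeGroup X)} (hS : S.Finite) {ε : ℝ} (hε : 0 < ε) :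
    ∃ (T : Set Γ) (δ η : ℝ), T.Finite ∧ 0 < δ ∧ 0 < η ∧
      ∀ (n : ℕ) (φ : Γ → Matrix (Fin n) (Fin n) ℂ) (u : X → Matrix.unitaryGroup (Fin n) ℂ),
      IsQuasiRep T δ φ → (∀ x, ‖φ (ρ (FreeGroup.of x)) - (u x).1‖ ≤ η) →
      ∀ w ∈ S, ‖φ (ρ w) - (FreeGroup.lift u w).1‖ ≤ ε := by
  induction S, hS using Set.Finite.induction_on with
  | empty => exact ⟨∅, 1, 1, Set.finite_empty, one_pos, one_pos, fun _ _ _ _ _ w hw => hw.elim⟩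
  | @insert w S _ _ ih =>
    obtain ⟨T, δ, η, hT, hδ, hη, H⟩ := ih
    obtain ⟨T', δ', η', hT', hδ', hη', H'⟩ := exists_quasiRep_near_lift ρ w hε
    refine ⟨T ∪ T', min δ δ', min η η', hT.union hT', by positivity, by positivity,
      fun n φ u hφ h w' hw' => ?_⟩
    rcases hw' with rfl | hw'
    · exact H' n φ u (hφ.mono Set.subset_union_right (min_le_right _ _))
        fun x => (h x).trans (min_le_right _ _)
    · exact H n φ u (hφ.mono Set.subset_union_left (min_le_left _ _))
        (fun x => (h x).trans (min_le_left _ _)) w' hw'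

/-- A quasi-representation is close to unitaries on the generators. -/
theorem exists_quasiRep_near_unitary {X Γ : Type} [Finite X] [Group Γ] (γ : X → Γ) {ε : ℝ}
    (hε : 0 < ε) : ∃ (T : Set Γ) (δ : ℝ), T.Finite ∧ 0 < δ ∧
      ∀ (n : ℕ) (φ : Γ → Matrix (Fin n) (Fin n) ℂ), IsQuasiRep T δ φ →
      ∃ u : X → Matrix.unitaryGroup (Fin n) ℂ, ∀ x, ‖φ (γ x) - (u x).1‖ ≤ ε := by
  obtain ⟨δ, hδ, H⟩ := exists_unitary_near_of_almost_inverse hε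
  refine ⟨Set.range γ ∪ Set.range fun x => (γ x)⁻¹, δ,
    (Set.finite_range _).union (Set.finite_range _), hδ, fun n φ hφ => ?_⟩
  have key : ∀ x, ∃ u : Matrix.unitaryGroup (Fin n) ℂ, ‖φ (γ x) - u.1‖ ≤ ε := fun x => by
    refine H (Fin n) _ (φ (γ x)⁻¹) (hφ.2.1 _) (hφ.2.1 _) ?_
    have := hφ.2.2 (γ x)⁻¹ (Or.inr ⟨x, rfl⟩) (γ x) (Or.inl ⟨x, rfl⟩)
    rw [inv_mul_cancel, hφ.1] at this
    exact this.le
  choose u hu using key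
  exact ⟨u, hu⟩

theorem blockSum_eq_conj {n k : ℕ} (A : Matrix (Fin n) (Fin n) ℂ) (B : Matrix (Fin k) (Fin k) ℂ) :
    blockSum A B = (UnitaryIso.ofEquiv finSumFinEquiv).conj (dsum A B) := by
  rw [UnitaryIso.ofEquiv_conj]
  rfl

/-- A tuple of unitaries satisfying the surface relation defines a unitary representation. -/
def repOfRelVal {g : ℕ} {u : Fin g ⊕ Fin g → Matrix.unitaryGroup ι ℂ} (hu : relVal u = 1) :
    SurfaceGroup g →* Matrix.unitaryGroup ι ℂ :=
  PresentedGroup.toGroup (f := u) fun r hr => by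
    rw [Set.mem_singleton_iff.1 hr, lift_surfaceRelator, hu]

theorem repOfRelVal_of {g : ℕ} {u : Fin g ⊕ Fin g → Matrix.unitaryGroup ι ℂ} (hu : relVal u = 1)
    (x : Fin g ⊕ Fin g) : repOfRelVal hu (PresentedGroup.of x) = u x :=
  PresentedGroup.toGroup.of _

theorem isUnitaryRep_coe {Γ : Type*} [Group Γ] {k : ℕ} (θ : Γ →* Matrix.unitaryGroup (Fin k) ℂ) :
    IsUnitaryRep fun s => (θ s).1 :=
  ⟨congrArg Subtype.val (map_one θ), fun x y => congrArg Subtype.val (map_mul θ x y), fun x =>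
      (θ x).2⟩

theorem Stab.exists_rep {g n : ℕ} {u : Fin g ⊕ Fin g → Matrix.unitaryGroup (Fin n) ℂ} {ε : ℝ}
    (h : Stab ε fun x => (u x).1) : ∃ (k : ℕ) (θ : SurfaceGroup g →* Matrix.unitaryGroup (Fin k) ℂ)
      (π : SurfaceGroup g →* Matrix.unitaryGroup (Fin (n + k)) ℂ),
      ∀ x, ‖blockSum (u x).1 (θ (PresentedGroup.of x)).1 - (π (PresentedGroup.of x)).1‖ ≤ ε := by
  obtain ⟨κ, _, _, θ, π, hθ, hπ, h⟩ := h
  let V : UnitaryIso κ (Fin (Fintype.card κ)) := UnitaryIso.ofEquiv (Fintype.equivFin κ)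
  let V' := (UnitaryIso.ofUnitary (1 : Matrix.unitaryGroup (Fin n) ℂ)).dsum V
  let W : UnitaryIso (Fin n ⊕ κ) (Fin (n + Fintype.card κ)) :=
    V'.trans (UnitaryIso.ofEquiv finSumFinEquiv)
  have hθ' : relVal (fun x => V.conjU (θ x)) = 1 := by
    rw [UnitaryIso.relVal_conjU, hθ, map_one]
  have hπ' : relVal (fun x => W.conjU (π x)) = 1 := by
    rw [UnitaryIso.relVal_conjU, hπ, map_one]
  refine ⟨_, repOfRelVal hθ', repOfRelVal hπ', fun x => ?_⟩
  rw [repOfRelVal_of, repOfRelVal_of, blockSum_eq_conj]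
  have h1 : (UnitaryIso.ofUnitary (1 : Matrix.unitaryGroup (Fin n) ℂ)).conj (u x).1 = (u x).1 := by
    simp [UnitaryIso.conj, UnitaryIso.ofUnitary]
  have h2 : W.conj (dsum (u x).1 (θ x).1)
      = (UnitaryIso.ofEquiv finSumFinEquiv).conj (dsum (u x).1 (V.conjU (θ x)).1) := by
    rw [UnitaryIso.trans_conj, UnitaryIso.dsum_conj, h1]
    rfl
  rw [← h2]
  exact W.norm_conj_sub_le (h x)

theorem norm_blockSum_lift_sub_le {g n k : ℕ} {u : Fin g ⊕ Fin g → Matrix.unitaryGroup (Fin n) ℂ}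
    {θ : SurfaceGroup g →* Matrix.unitaryGroup (Fin k) ℂ}
    {π : SurfaceGroup g →* Matrix.unitaryGroup (Fin (n + k)) ℂ} {S : Set (FreeGroup (Fin g ⊕ Fin
        g))}
    {η ε : ℝ} (hS : ∀ (ι : Type) [Fintype ι] [DecidableEq ι]
      (u v : Fin g ⊕ Fin g → Matrix.unitaryGroup ι ℂ), (∀ x, ‖(v x).1 - (u x).1‖ ≤ η) →
      ∀ w ∈ S, ‖(FreeGroup.lift v w).1 - (FreeGroup.lift u w).1‖ ≤ ε)
    (h : ∀ x, ‖blockSum (u x).1 (θ (PresentedGroup.of x)).1 - (π (PresentedGroup.of x)).1‖ ≤ η)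
    {w : FreeGroup (Fin g ⊕ Fin g)} (hw : w ∈ S) :
    ‖blockSum (FreeGroup.lift u w).1 (θ (PresentedGroup.mk _ w)).1 - (π (PresentedGroup.mk _ w)).1‖
      ≤ ε := by
  let W : UnitaryIso (Fin n ⊕ Fin k) (Fin (n + k)) := UnitaryIso.ofEquiv finSumFinEquiv
  let ψ := W.conjU.comp (dsumU.comp ((FreeGroup.lift u).prod (θ.comp (PresentedGroup.mk _))))
  have h1 : FreeGroup.lift (fun x => W.conjU (dsumU (u x, θ (PresentedGroup.of x)))) = ψ :=
    FreeGroup.ext_hom _ _ fun x => by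
      simp only [FreeGroup.lift_apply_of, ψ, MonoidHom.comp_apply, MonoidHom.prod_apply]
      rfl
  have h2 : FreeGroup.lift (fun x => π (PresentedGroup.of x)) = π.comp (PresentedGroup.mk _) :=
    FreeGroup.ext_hom _ _ fun x => by
      simp only [FreeGroup.lift_apply_of, MonoidHom.comp_apply]
      rfl
  have h3 := hS _ (fun x => π (PresentedGroup.of x))
    (fun x => W.conjU (dsumU (u x, θ (PresentedGroup.of x))))
    (fun x => by have := h x; rwa [blockSum_eq_conj] at this) w hw
  rw [h1, h2] at h3
  rw [blockSum_eq_conj]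
  exact h3

theorem norm_blockSum_sub_le {n k : ℕ} {A B : Matrix (Fin n) (Fin n) ℂ} {ε : ℝ} (h : ‖A - B‖ ≤ ε)
    (C : Matrix (Fin k) (Fin k) ℂ) : ‖blockSum A C - blockSum B C‖ ≤ ε := by
  rw [blockSum_eq_conj, blockSum_eq_conj]
  refine UnitaryIso.norm_conj_sub_le _ (norm_dsum_sub_le h ?_)
  simpa using (norm_nonneg _).trans h

end

/-- The fundamental group of the closed orientable surface of genus `g`
is weakly ucp stable, conditional on vanishing of the winding number invariant. -/
theorem statement12 (g : ℕ) (hg : 1 ≤ g)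
    (S : Set (SurfaceGroup g)) (hS : S.Finite) (ε : ℝ) (hε : 0 < ε) :
    ∃ (T : Set (SurfaceGroup g)) (δ : ℝ), T.Finite ∧ 0 < δ ∧
      ∀ (n : ℕ), 1 ≤ n → ∀ φ : SurfaceGroup g → Matrix (Fin n) (Fin n) ℂ,
        IsQuasiRep T δ φ → IsUcpQuasiRep φ →
        (∀ i : Fin g, IsUnit (φ (aGen i)) ∧ IsUnit (φ (bGen i))) →
        ‖commProd φ - 1‖ < 1 →
        (∃ h : ℝ → ℂ, ContinuousOn h (Set.Icc 0 1) ∧ h 0 = h 1 ∧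
          ∀ t ∈ Set.Icc (0 : ℝ) 1,
            Complex.exp (h t) =
              ((t : ℂ) • (1 : Matrix (Fin n) (Fin n) ℂ) + (1 - (t : ℂ)) • commProd φ).det) →
        ∃ (k : ℕ) (θ : SurfaceGroup g → Matrix (Fin k) (Fin k) ℂ)
          (π : SurfaceGroup g → Matrix (Fin (n + k)) (Fin (n + k)) ℂ),
          IsUnitaryRep θ ∧ IsUnitaryRep π ∧
          ∀ s ∈ S, ‖blockSum (φ s) (θ s) - π s‖ < ε := by
  obtain ⟨m, rfl⟩ : ∃ m, g = m + 1 := ⟨g - 1, by omega⟩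
  let ρ := PresentedGroup.mk ({surfaceRelator (m + 1)} : Set (FreeGroup (Fin (m + 1) ⊕ Fin (m +
      1))))
  choose word hword using (PresentedGroup.mk_surjective
    ({surfaceRelator (m + 1)} : Set (FreeGroup (Fin (m + 1) ⊕ Fin (m + 1)))))
  have hS' := hS.image word
  have hε' : 0 < ε / 4 := by positivity
  obtain ⟨ε₁, hε₁, hclose⟩ := exists_unitary_near_lift hS' hε'
  obtain ⟨δ₀, hδ₀, hstab⟩ := exists_stab m hε₁
  obtain ⟨T₁, δ₁, η₁, hT₁, hδ₁, hη₁, hwords⟩ := exists_quasiRep_near_lift_of_finite ρ hS' hε'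
  obtain ⟨T₂, δ₂, η₂, hT₂, hδ₂, hη₂, hrel⟩ := exists_quasiRep_near_lift ρ (surfaceRelator (m + 1))
    (ε := min δ₀ (1 / 2)) (by positivity)
  obtain ⟨η₃, hη₃, hwind⟩ := exists_windZero_near (m + 1)
  obtain ⟨T₃, δ₃, hT₃, hδ₃, hpolar⟩ := exists_quasiRep_near_unitary
    (fun x => ρ (FreeGroup.of x)) (ε := min η₁ (min η₂ η₃)) (by positivity)
  refine ⟨T₁ ∪ (T₂ ∪ T₃), min δ₁ (min δ₂ δ₃), hT₁.union (hT₂.union hT₃), by positivity,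
    fun n _ φ hφ _ _ _ hw => ?_⟩
  have hφ₁ : IsQuasiRep T₁ δ₁ φ := hφ.mono Set.subset_union_left (min_le_left _ _)
  have hφ' : IsQuasiRep (T₂ ∪ T₃) (min δ₂ δ₃) φ := hφ.mono Set.subset_union_right (min_le_right _ _)
  have hφ₂ : IsQuasiRep T₂ δ₂ φ := hφ'.mono Set.subset_union_left (min_le_left _ _)
  have hφ₃ : IsQuasiRep T₃ δ₃ φ := hφ'.mono Set.subset_union_right (min_le_right _ _)
  obtain ⟨u, hu⟩ := hpolar n φ hφ₃
  have hu₁ : ∀ x, ‖φ (ρ (FreeGroup.of x)) - (u x).1‖ ≤ η₁ := fun x => (hu x).trans (min_le_left _ _)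
  have hu₂ : ∀ x, ‖φ (ρ (FreeGroup.of x)) - (u x).1‖ ≤ η₂ := fun x =>
    (hu x).trans ((min_le_right _ _).trans (min_le_left _ _))
  have hu₃ : ∀ x, ‖φ (ρ (FreeGroup.of x)) - (u x).1‖ ≤ η₃ := fun x =>
    (hu x).trans ((min_le_right _ _).trans (min_le_right _ _))
  have hr : ‖(relVal u).1 - 1‖ ≤ min δ₀ (1 / 2) := by
    have h1 := hrel n φ u hφ₂ hu₂
    have h2 : ρ (surfaceRelator (m + 1)) = 1 := PresentedGroup.one_of_mem rfl
    rwa [h2, hφ.1, lift_surfaceRelator, norm_sub_rev] at h1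
  have hwu : WindZero (relVal u).1 :=
    (hwind (Fin n) (fun x => φ (ρ (FreeGroup.of x))) u hu₃ (hr.trans (min_le_right _ _))).1 hw
  obtain ⟨k, θ, π, hθπ⟩ := (hstab (Fin n) u (hr.trans (min_le_left _ _)) hwu).exists_rep
  refine ⟨k, fun s => (θ s).1, fun s => (π s).1, isUnitaryRep_coe θ, isUnitaryRep_coe π,
    fun s hs => ?_⟩
  have h1 := hwords n φ u hφ₁ hu₁ (word s) ⟨s, hs, rfl⟩
  have h2 := norm_blockSum_lift_sub_le hclose hθπ (w := word s) ⟨s, hs, rfl⟩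
  have h3 : ρ (word s) = s := hword s
  rw [h3] at h1
  rw [hword] at h2
  have h4 := norm_sub_le_norm_sub_add_norm_sub (blockSum (φ s) (θ s).1)
    (blockSum (FreeGroup.lift u (word s)).1 (θ s).1) (π s).1
  linarith [norm_blockSum_sub_le h1 (θ s).1]

end
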